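/- arXiv:2602.10292 — 2 statements merged into one kernel-verified Lean document; each statement's English description precedes it below -/
import Mathlib

section
/- Fix positive integers k and t with k ≥ 2t+3. For every function r : ℕ → ℕ with r(n) ≥ 1 for all n and r(n)/n^{k-2t-1} → 0 as n → ∞, there exists n₀ such that for all n > n₀: ρ_{n,k,t}(C(n-t-1,k-t-1) + r(n)) = r(n) · C(k,t) · C(n-k-t-1, k-2t-1). -/
/-- The number of unordered pairs of distinct sets `F₁, F₂ ∈ F` with `|F₁ ∩ F₂| = t`. -/
def rhoPairs (t : ℕ) (F : Finset (Finset ℕ)) : ℕ :=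
  ((F.powersetCard 2).filter
    (fun P => ∃ A ∈ P, ∃ B ∈ P, A ≠ B ∧ (A ∩ B).card = t)).card

/-- `ρ_{n,k,t}(ℓ)`: the minimum of `ρ(F)` over families `F` of `k`-element subsets
of `[n]` with `|F| = ℓ`. -/
noncomputable def rhoMin (n k t ℓ : ℕ) : ℕ :=
  sInf { m : ℕ | ∃ F : Finset (Finset ℕ),
    F ⊆ (Finset.Icc 1 n).powersetCard k ∧ F.card = ℓ ∧ rhoPairs t F = m }

/-- The Frankl–Katona theorem: if no nonempty subfamily of `r` sets has an intersection of size
`r - 1`, then there are at most as many sets as points. -/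
theorem card_le_card_of_card_inter_add_one_ne {ι α : Type*} [DecidableEq ι] [DecidableEq α]
    (s : Finset ι) (X : ι → Finset α) (Y : Finset α) (hXY : ∀ i ∈ s, X i ⊆ Y)
    (h : ∀ J ⊆ s, J.Nonempty → (Y.filter fun y => ∀ i ∈ J, y ∈ X i).card + 1 ≠ J.card) :
    s.card ≤ Y.card := by
  induction hn : s.card using Nat.strong_induction_on generalizing s X Y with
  | _ N ih =>
  subst hn
  have key : ∀ i ∈ s, ∀ y ∈ X i, (s.filter fun j => y ∈ X j).card ≤ (X i).card := by
    intro i hi y hy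
    have hiP : i ∈ s.filter fun j => y ∈ X j := by simp [hi, hy]
    have hlt : ((s.filter fun j => y ∈ X j).erase i).card < s.card :=
      (Finset.card_erase_lt_of_mem hiP).trans_le (Finset.card_filter_le _ _)
    have := ih _ hlt ((s.filter fun j => y ∈ X j).erase i)
      (fun j => (X j ∩ X i).erase y) ((X i).erase y)
      (by
        intro j _
        exact Finset.erase_subset_erase _ Finset.inter_subset_right)
      (by
        intro J hJ hJne hc
        have hJs : ∀ j ∈ J, j ≠ i ∧ j ∈ s ∧ y ∈ X j := by
          intro j hj
          have := hJ hj
          simp only [Finset.mem_erase, Finset.mem_filter] at this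
          exact ⟨this.1, this.2.1, this.2.2⟩
        have hiJ : i ∉ J := fun hmem => (hJs i hmem).1 rfl
        refine h (insert i J) ?_ (Finset.insert_nonempty _ _) ?_
        · intro j hj
          rcases Finset.mem_insert.1 hj with rfl | hj
          · exact hi
          · exact (hJs j hj).2.1
        · rw [Finset.card_insert_of_notMem hiJ, ← hc]
          have heq : (Y.filter fun z => ∀ j ∈ insert i J, z ∈ X j) =
              insert y (((X i).erase y).filter fun z => ∀ j ∈ J, z ∈ (X j ∩ X i).erase y) := by
            ext z
            simp only [Finset.mem_filter, Finset.mem_insert, forall_eq_or_imp, Finset.mem_erase,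
              Finset.mem_inter]
            constructor
            · rintro ⟨_, hz1, hz2⟩
              by_cases hzy : z = y
              · exact Or.inl hzy
              · exact Or.inr ⟨⟨hzy, hz1⟩, fun j hj => ⟨hzy, hz2 j hj, hz1⟩⟩
            · rintro (rfl | ⟨⟨_, hz1⟩, hz2⟩)
              · exact ⟨hXY i hi hy, hy, fun j hj => (hJs j hj).2.2⟩
              · exact ⟨hXY i hi hz1, hz1, fun j hj => (hz2 j hj).2.1⟩
          rw [heq, Finset.card_insert_of_notMem (by simp)])
      rfl
    rw [Finset.card_erase_of_mem hiP, Finset.card_erase_of_mem hy] at this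
    have hpos : 0 < (X i).card := Finset.card_pos.2 ⟨y, hy⟩
    omega
  have hne : ∀ i ∈ s, 0 < (X i).card := by
    intro i hi
    rw [Nat.pos_iff_ne_zero]
    intro h0
    refine h {i} (by simpa using hi) (by simp) ?_
    have : X i = ∅ := Finset.card_eq_zero.1 h0
    simp [this]
  have hcalc : (s.card : ℚ) ≤ Y.card := by
    calc (s.card : ℚ) = ∑ i ∈ s, ∑ y ∈ X i, (1 : ℚ) / (X i).card := by
          rw [Finset.card_eq_sum_ones, Nat.cast_sum]
          refine Finset.sum_congr rfl fun i hi => ?_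
          have := hne i hi
          rw [Finset.sum_const, nsmul_eq_mul]
          field_simp
          simp
      _ ≤ ∑ i ∈ s, ∑ y ∈ X i, (1 : ℚ) / (s.filter fun j => y ∈ X j).card := by
          refine Finset.sum_le_sum fun i hi => Finset.sum_le_sum fun y hy => ?_
          have h1 := key i hi y hy
          have h2 : 0 < (s.filter fun j => y ∈ X j).card :=
            Finset.card_pos.2 ⟨i, by simp [hi, hy]⟩
          exact one_div_le_one_div_of_le (by exact_mod_cast h2) (by exact_mod_cast h1)
      _ = ∑ y ∈ Y, ∑ i ∈ s.filter (fun j => y ∈ X j),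
            (1 : ℚ) / (s.filter fun j => y ∈ X j).card := by
          refine Finset.sum_comm' ?_
          intro i y
          simp only [Finset.mem_filter]
          exact ⟨fun h => ⟨h, hXY i h.1 h.2⟩, fun h => h.1⟩
      _ ≤ ∑ y ∈ Y, 1 := by
          refine Finset.sum_le_sum fun y _ => ?_
          rw [Finset.sum_const, nsmul_eq_mul, mul_one_div]
          exact div_self_le_one _
      _ = Y.card := by simp
  exact_mod_cast hcalc

/-- Let `x` assign to every `t`-subset of a `(2t+1+a)`-set `F` a further point of `F`. If every
`(t+a-1)`-subset of `F` lies in a proper subset closed under `x`, then all values of `x` lie in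
some `(t+1)`-set. -/
theorem exists_core_of_closed_cover {α : Type*} [DecidableEq α] {t a : ℕ} (ha : 2 ≤ a)
    {F : Finset α} (hF : F.card = 2 * t + 1 + a) (x : Finset α → α)
    (hx : ∀ T ⊆ F, T.card = t → x T ∈ F ∧ x T ∉ T)
    (hcov : ∀ S ⊆ F, S.card = t + a - 1 → ∃ S', S ⊆ S' ∧ S' ⊆ F ∧ S' ≠ F ∧
      ∀ T ⊆ S', T.card = t → x T ∈ S') :
    ∃ K ⊆ F, K.card = t + 1 ∧ ∀ T ⊆ F, T.card = t → x T ∈ K := by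
  classical
  let Cov : Finset α → Prop := fun A => ∃ S', A ⊆ S' ∧ S' ⊆ F ∧ S' ≠ F ∧
      ∀ T ⊆ S', T.card = t → x T ∈ S'
  have hne : (F.powerset.filter fun A => ¬ Cov A).Nonempty := by
    refine ⟨F, ?_⟩
    simp only [Finset.mem_filter, Finset.mem_powerset, subset_rfl, true_and]
    rintro ⟨S', h1, h2, h3, -⟩
    exact h3 (Finset.Subset.antisymm h2 h1)
  obtain ⟨A, hA, hmin⟩ := Finset.exists_min_image _ Finset.card hne
  simp only [Finset.mem_filter, Finset.mem_powerset] at hA hmin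
  obtain ⟨hAF, hAcov⟩ := hA
  have hsub : ∀ b ∈ A, Cov (A.erase b) := by
    intro b hb
    by_contra hc
    have := hmin _ ⟨(Finset.erase_subset _ _).trans hAF, hc⟩
    have := Finset.card_erase_lt_of_mem hb
    omega
  have hAF' := Finset.card_le_card hAF
  have hAcard : t + a ≤ A.card := by
    by_contra hlt
    obtain ⟨S, hAS, hSF, hS⟩ := Finset.exists_subsuperset_card_eq hAF
      (n := t + a - 1) (by omega) (by omega)
    obtain ⟨S', h1, h2⟩ := hcov S hSF hS
    exact hAcov ⟨S', hAS.trans h1, h2⟩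
  choose! S hSA hSF hSne hScl using hsub
  have hbS : ∀ b ∈ A, b ∉ S b := by
    intro b hb hbS
    refine hAcov ⟨S b, ?_, hSF b hb, hSne b hb, hScl b hb⟩
    intro z hz
    by_cases hzb : z = b
    · rwa [hzb]
    · exact hSA b hb (Finset.mem_erase.2 ⟨hzb, hz⟩)
  have hZ : ∀ J ⊆ A, J.Nonempty → (F.filter fun z => ∀ b ∈ J, z ∈ S b).card ≠ t := by
    intro J hJA hJ hc
    have h1 := hx _ (Finset.filter_subset _ _) hc
    refine h1.2 (Finset.mem_filter.2 ⟨h1.1, fun b hb => ?_⟩)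
    refine hScl b (hJA hb) _ ?_ hc
    intro z hz
    exact (Finset.mem_filter.1 hz).2 b hb
  have hZcard : ∀ J ⊆ A, (F.filter fun z => ∀ b ∈ J, z ∈ S b).card =
      (A.card - J.card) + ((F \ A).filter fun z => ∀ b ∈ J, z ∈ S b).card := by
    intro J hJA
    rw [← Finset.card_sdiff_of_subset hJA, ← Finset.card_union_of_disjoint]
    · congr 1
      ext z
      simp only [Finset.mem_filter, Finset.mem_union, Finset.mem_sdiff]
      constructor
      · rintro ⟨h1, h2⟩
        by_cases hzA : z ∈ A
        · exact Or.inl ⟨hzA, fun hzJ => hbS z hzA (h2 z hzJ)⟩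
        · exact Or.inr ⟨⟨h1, hzA⟩, h2⟩
      · rintro (⟨h1, h2⟩ | ⟨⟨h1, h2⟩, h3⟩)
        · refine ⟨hAF h1, fun b hb => hSA b (hJA hb) (Finset.mem_erase.2 ⟨?_, h1⟩)⟩
          rintro rfl
          exact h2 hb
        · exact ⟨h1, h3⟩
    · rw [Finset.disjoint_left]
      intro z hz hz'
      exact (Finset.mem_sdiff.1 (Finset.mem_filter.1 hz').1).2 (Finset.mem_sdiff.1 hz).1
  have hFA : (F \ A).card = 2 * t + 1 + a - A.card := by
    rw [Finset.card_sdiff_of_subset hAF, hF]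
  have hG : ∀ G ⊆ A, G.card = A.card - t - 1 →
      t + 1 ≤ ((F \ A).filter fun z => ∀ b ∈ G, z ∈ S b).card := by
    intro G hGA hGc
    have := card_le_card_of_card_inter_add_one_ne (A \ G)
      (fun b => ((F \ A).filter fun z => ∀ b ∈ G, z ∈ S b).filter fun z => z ∈ S b)
      ((F \ A).filter fun z => ∀ b ∈ G, z ∈ S b) (fun i _ => Finset.filter_subset _ _)
      (by
        intro J hJ hJne hc
        have hJA : G ∪ J ⊆ A := Finset.union_subset hGA (hJ.trans Finset.sdiff_subset)
        have hdis : Disjoint G J :=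
          Finset.disjoint_of_subset_right hJ Finset.disjoint_sdiff
        apply hZ (G ∪ J) hJA (hJne.mono Finset.subset_union_right)
        rw [hZcard _ hJA, Finset.card_union_of_disjoint hdis]
        have hJc : J.card ≤ (A \ G).card := Finset.card_le_card hJ
        rw [Finset.card_sdiff_of_subset hGA] at hJc
        have heq : ((F \ A).filter fun z => ∀ b ∈ G ∪ J, z ∈ S b) =
            (((F \ A).filter fun z => ∀ b ∈ G, z ∈ S b).filter fun y => ∀ i ∈ J, y ∈
              ((F \ A).filter fun z => ∀ b ∈ G, z ∈ S b).filter fun z => z ∈ S i) := by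
          ext z
          simp only [Finset.mem_filter, Finset.mem_union]
          constructor
          · rintro ⟨h1, h2⟩
            have h3 : ∀ b ∈ G, z ∈ S b := fun b hb => h2 b (Or.inl hb)
            exact ⟨⟨h1, h3⟩, fun i hi => ⟨⟨h1, h3⟩, h2 i (Or.inr hi)⟩⟩
          · rintro ⟨⟨h1, h2⟩, h3⟩
            refine ⟨h1, fun b hb => ?_⟩
            rcases hb with hb | hb
            · exact h2 b hb
            · exact (h3 b hb).2
        rw [heq]
        omega)
    rw [Finset.card_sdiff_of_subset hGA] at this
    omega
  refine ⟨F \ A, Finset.sdiff_subset, ?_, ?_⟩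
  · obtain ⟨G, hGA, hGc⟩ := Finset.exists_subset_card_eq (s := A) (n := A.card - t - 1) (by omega)
    have h1 := (hG G hGA hGc).trans (Finset.card_filter_le _ _)
    omega
  · intro T hTF hT
    obtain ⟨h1, h2⟩ := hx T hTF hT
    by_contra hcon
    have hbA : x T ∈ A := by
      by_contra hb
      exact hcon (Finset.mem_sdiff.2 ⟨h1, hb⟩)
    obtain ⟨G, hbG, hGA, hGc⟩ := Finset.exists_subsuperset_card_eq
      (Finset.singleton_subset_iff.2 hbA) (n := A.card - t - 1) (by simp; omega) (by omega)
    have h3 := hG G hGA hGc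
    have h4 : ((F \ A).filter fun z => ∀ b ∈ G, z ∈ S b) = F \ A :=
      Finset.eq_of_subset_of_card_le (Finset.filter_subset _ _) (by omega)
    refine hbS _ hbA (hScl _ hbA T ?_ hT)
    intro z hz
    have hzb : z ≠ x T := by
      rintro rfl
      exact h2 hz
    by_cases hzA : z ∈ A
    · exact hSA _ hbA (Finset.mem_erase.2 ⟨hzb, hzA⟩)
    · have : z ∈ F \ A := Finset.mem_sdiff.2 ⟨hTF hz, hzA⟩
      rw [← h4] at this
      exact (Finset.mem_filter.1 this).2 _ (hbG (Finset.mem_singleton_self _))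

/-- The `t`-subsets of members of `𝒢`. -/
def tShadow (t : ℕ) (𝒢 : Finset (Finset ℕ)) : Finset (Finset ℕ) :=
  𝒢.biUnion (Finset.powersetCard t)

/-- The number of ordered pairs in `𝒜 × ℬ` with intersection of size `t`. -/
def crossPairs (t : ℕ) (𝒜 ℬ : Finset (Finset ℕ)) : ℕ :=
  ((𝒜 ×ˢ ℬ).filter fun p => (p.1 ∩ p.2).card = t).card

theorem mem_tShadow {t : ℕ} {𝒢 : Finset (Finset ℕ)} {T : Finset ℕ} :
    T ∈ tShadow t 𝒢 ↔ ∃ F ∈ 𝒢, T ⊆ F ∧ T.card = t := by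
  simp [tShadow, Finset.mem_powersetCard]

theorem tShadow_mono {t : ℕ} {𝒜 ℬ : Finset (Finset ℕ)} (h : 𝒜 ⊆ ℬ) :
    tShadow t 𝒜 ⊆ tShadow t ℬ :=
  Finset.biUnion_subset_biUnion_of_subset_left _ h

theorem crossPairs_mono {t : ℕ} {𝒜 𝒜' ℬ ℬ' : Finset (Finset ℕ)} (h : 𝒜 ⊆ 𝒜') (h' : ℬ ⊆ ℬ') :
    crossPairs t 𝒜 ℬ ≤ crossPairs t 𝒜' ℬ' :=
  Finset.card_le_card (Finset.filter_subset_filter _ (Finset.product_subset_product h h'))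

theorem card_filter_superset_le {n j : ℕ} (𝒢 : Finset (Finset ℕ))
    (h𝒢 : 𝒢 ⊆ (Finset.Icc 1 n).powersetCard j) (T : Finset ℕ) :
    (𝒢.filter fun S => T ⊆ S).card ≤ n ^ (j - T.card) := by
  calc (𝒢.filter fun S => T ⊆ S).card
      ≤ ((Finset.Icc 1 n).powersetCard (j - T.card)).card := by
        refine Finset.card_le_card_of_injOn (fun S => S \ T) ?_ ?_
        · intro S hS
          have hS := Finset.mem_filter.1 hS
          obtain ⟨h1, h2⟩ := Finset.mem_powersetCard.1 (h𝒢 hS.1)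
          exact Finset.mem_powersetCard.2 ⟨Finset.sdiff_subset.trans h1, by
            rw [Finset.card_sdiff_of_subset hS.2, h2]⟩
        · intro S hS S' hS' h
          have hS := (Finset.mem_filter.1 hS).2
          have hS' := (Finset.mem_filter.1 hS').2
          have h : S \ T = S' \ T := h
          rw [← Finset.sdiff_union_of_subset hS, h, Finset.sdiff_union_of_subset hS']
    _ ≤ n ^ (j - T.card) := by
        rw [Finset.card_powersetCard]
        simpa using Nat.choose_le_pow n (j - T.card)

/-- One can choose a reference set through each `t`-set so that few members of the family meet
a reference set in exactly that `t`-set. -/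
theorem exists_reference_sets {t : ℕ} (ht : 1 ≤ t) {k : ℕ} (𝒢 𝒮 : Finset (Finset ℕ))
    (hk : ∀ F ∈ 𝒢, F.card = k) (h𝒮 : ∀ T ∈ 𝒮, T.card = t) :
    ∃ R : Finset ℕ → Finset ℕ, (∀ T, (R T).card ≤ k) ∧
      (∀ F ∈ 𝒢, ∀ T ⊆ F, T ⊆ R T) ∧
      (∑ T ∈ 𝒮, (𝒢.filter fun F => F ∩ R T = T).card) ^ 2 ≤ 𝒮.card * crossPairs t 𝒢 𝒢 := by
  classical
  have hR : ∀ T : Finset ℕ, ∃ R : Finset ℕ, R.card ≤ k ∧ (∀ F ∈ 𝒢, T ⊆ F → T ⊆ R) ∧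
      (T.card = t →
      (𝒢.filter fun F => F ∩ R = T).card ^ 2 ≤
        ((𝒢 ×ˢ 𝒢).filter fun p => p.1 ∩ p.2 = T).card) := by
    intro T
    by_cases hne : (𝒢.filter fun F => T ⊆ F).Nonempty
    · obtain ⟨R, hR, hmin⟩ := Finset.exists_min_image _
        (fun R => (𝒢.filter fun F => F ∩ R = T).card) hne
      obtain ⟨hR𝒢, hTR⟩ := Finset.mem_filter.1 hR
      refine ⟨R, (hk R hR𝒢).le, fun _ _ _ => hTR, fun _ => ?_⟩
      have hfib : ((𝒢 ×ˢ 𝒢).filter fun p => p.1 ∩ p.2 = T).card =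
          ∑ R' ∈ 𝒢, (𝒢.filter fun F => F ∩ R' = T).card := by
        rw [Finset.card_filter, Finset.sum_product_right]
        refine Finset.sum_congr rfl fun R' _ => ?_
        rw [Finset.card_filter]
      rw [hfib]
      have hsub : (𝒢.filter fun F => F ∩ R = T) ⊆ 𝒢.filter fun F => T ⊆ F := by
        intro F hF
        obtain ⟨h1, h2⟩ := Finset.mem_filter.1 hF
        exact Finset.mem_filter.2 ⟨h1, h2 ▸ Finset.inter_subset_left⟩
      calc (𝒢.filter fun F => F ∩ R = T).card ^ 2
          ≤ (𝒢.filter fun F => T ⊆ F).card * (𝒢.filter fun F => F ∩ R = T).card := by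
            rw [sq]
            exact Nat.mul_le_mul_right _ (Finset.card_le_card hsub)
        _ = ∑ R' ∈ 𝒢.filter (fun F => T ⊆ F), (𝒢.filter fun F => F ∩ R = T).card := by
            rw [Finset.sum_const, smul_eq_mul]
        _ ≤ ∑ R' ∈ 𝒢.filter (fun F => T ⊆ F), (𝒢.filter fun F => F ∩ R' = T).card :=
            Finset.sum_le_sum hmin
        _ ≤ _ := Finset.sum_le_sum_of_subset (Finset.filter_subset _ _)
    · refine ⟨∅, by simp, fun F hF hTF => absurd ⟨F, Finset.mem_filter.2 ⟨hF, hTF⟩⟩ hne,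
        fun hT => ?_⟩
      have : (𝒢.filter fun F => F ∩ ∅ = T) = ∅ := by
        refine Finset.filter_eq_empty_iff.2 fun F _ h => ?_
        rw [Finset.inter_empty] at h
        rw [← h, Finset.card_empty] at hT
        omega
      rw [this]
      simp
  choose R hRk hRT hR using hR
  refine ⟨R, hRk, fun F hF T hT => hRT T F hF hT, ?_⟩
  calc (∑ T ∈ 𝒮, (𝒢.filter fun F => F ∩ R T = T).card) ^ 2
      ≤ 𝒮.card * ∑ T ∈ 𝒮, (𝒢.filter fun F => F ∩ R T = T).card ^ 2 :=
        sq_sum_le_card_mul_sum_sq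
    _ ≤ 𝒮.card * ∑ T ∈ 𝒮, ((𝒢 ×ˢ 𝒢).filter fun p => p.1 ∩ p.2 = T).card :=
        Nat.mul_le_mul_left _ (Finset.sum_le_sum fun T hT => hR T (h𝒮 T hT))
    _ ≤ 𝒮.card * crossPairs t 𝒢 𝒢 := by
        refine Nat.mul_le_mul_left _ ?_
        rw [← Finset.card_biUnion]
        · refine Finset.card_le_card ?_
          intro p hp
          obtain ⟨T, hT, hp⟩ := Finset.mem_biUnion.1 hp
          obtain ⟨h1, h2⟩ := Finset.mem_filter.1 hp
          exact Finset.mem_filter.2 ⟨h1, by rw [h2, h𝒮 T hT]⟩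
        · intro T _ T' _ hne
          rw [Function.onFun, Finset.disjoint_left]
          intro p hp hp'
          exact hne ((Finset.mem_filter.1 hp).2.symm.trans (Finset.mem_filter.1 hp').2)

open Classical in
/-- A bound for the number of `k`-sets generated by `S` under bounded-choice closure. -/
theorem card_generated_le {t k : ℕ} (𝒢 : Finset (Finset ℕ)) (hk : ∀ F ∈ 𝒢, F.card = k)
    (R : Finset ℕ → Finset ℕ) (hR : ∀ T, (R T).card ≤ k)
    (x : Finset ℕ → Finset ℕ → ℕ)
    (hx : ∀ F ∈ 𝒢, ∀ T ⊆ F, T.card = t → x F T ∈ F ∧ x F T ∈ R T) (S : Finset ℕ) :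
    (𝒢.filter fun F => S ⊆ F ∧ ∀ S', S ⊆ S' → S' ⊆ F →
      (∀ T ⊆ S', T.card = t → x F T ∈ S') → S' = F).card ≤ (2 ^ k * k) ^ (k - S.card) := by
  classical
  induction hd : k - S.card generalizing S with
  | zero =>
    rw [pow_zero, Finset.card_le_one]
    have h : ∀ F ∈ 𝒢, S ⊆ F → S = F := fun F hF hS =>
      Finset.eq_of_subset_of_card_le hS (by rw [hk F hF]; omega)
    intro F hF F' hF'
    obtain ⟨h1, h2, -⟩ := Finset.mem_filter.1 hF
    obtain ⟨h1', h2', -⟩ := Finset.mem_filter.1 hF'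
    exact (h F h1 h2).symm.trans (h F' h1' h2')
  | succ d ih =>
    have hsub : (𝒢.filter fun F => S ⊆ F ∧ ∀ S', S ⊆ S' → S' ⊆ F →
        (∀ T ⊆ S', T.card = t → x F T ∈ S') → S' = F) ⊆
        S.powerset.biUnion fun T => (R T \ S).biUnion fun y =>
          (𝒢.filter fun F => insert y S ⊆ F ∧ ∀ S', insert y S ⊆ S' → S' ⊆ F →
            (∀ T ⊆ S', T.card = t → x F T ∈ S') → S' = F) := by
      intro F hF
      obtain ⟨h1, h2, h3⟩ := Finset.mem_filter.1 hF
      have hSF : S ≠ F := by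
        rintro rfl
        have := hk S h1
        omega
      have : ¬ ∀ T ⊆ S, T.card = t → x F T ∈ S := fun hcl => hSF (h3 S subset_rfl h2 hcl)
      push Not at this
      obtain ⟨T, hTS, hT, hxT⟩ := this
      have hxT' := hx F h1 T (hTS.trans h2) hT
      refine Finset.mem_biUnion.2 ⟨T, Finset.mem_powerset.2 hTS, Finset.mem_biUnion.2
        ⟨x F T, Finset.mem_sdiff.2 ⟨hxT'.2, hxT⟩, Finset.mem_filter.2 ⟨h1, ?_, ?_⟩⟩⟩
      · exact Finset.insert_subset hxT'.1 h2
      · intro S' hS'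
        exact h3 S' ((Finset.subset_insert _ _).trans hS')
    refine (Finset.card_le_card hsub).trans ?_
    calc _ ≤ S.powerset.card * (k * (2 ^ k * k) ^ d) := by
          refine Finset.card_biUnion_le_card_mul _ _ _ fun T _ => ?_
          refine (Finset.card_biUnion_le_card_mul _ _ ((2 ^ k * k) ^ d) fun y hy => ?_).trans ?_
          · apply ih
            rw [Finset.card_insert_of_notMem (Finset.mem_sdiff.1 hy).2]
            omega
          · exact Nat.mul_le_mul_right _
              ((Finset.card_le_card Finset.sdiff_subset).trans (hR T))
      _ ≤ 2 ^ k * (k * (2 ^ k * k) ^ d) := by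
          refine Nat.mul_le_mul_right _ ?_
          rw [Finset.card_powerset]
          exact Nat.pow_le_pow_right (by norm_num) (by omega)
      _ = (2 ^ k * k) ^ (d + 1) := by ring

/-- A `t`-set lies next to boundedly many cores. -/
theorem card_cores_le {t k : ℕ} (R : Finset ℕ → Finset ℕ) (hR : ∀ T, (R T).card ≤ k)
    (T : Finset ℕ) (hT : T.card = t) (𝒦 : Finset (Finset ℕ))
    (h𝒦 : ∀ K ∈ 𝒦, K.card = t + 1 ∧ Disjoint T K ∧
      ∀ U ⊆ T ∪ K, U.card = t → ∃ y ∈ K, y ∈ R U ∧ y ∉ U) :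
    𝒦.card ≤ k ^ (t + 1) := by
  classical
  have key : ∀ d : ℕ, ∀ I : Finset ℕ, I.card + d = t + 1 →
      (𝒦.filter fun K => I ⊆ K).card ≤ k ^ d := by
    intro d
    induction d with
    | zero =>
      intro I hI
      rw [pow_zero, Finset.card_le_one]
      have h : ∀ K ∈ 𝒦, I ⊆ K → I = K := fun K hK hIK =>
        Finset.eq_of_subset_of_card_le hIK (by rw [(h𝒦 K hK).1]; omega)
      intro F hF F' hF'
      obtain ⟨h1, h2⟩ := Finset.mem_filter.1 hF
      obtain ⟨h1', h2'⟩ := Finset.mem_filter.1 hF'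
      exact (h F h1 h2).symm.trans (h F' h1' h2')
    | succ d ih =>
      intro I hI
      obtain ⟨T', hT'T, hT'⟩ := Finset.exists_subset_card_eq (s := T) (n := d) (by omega)
      have hsub : (𝒦.filter fun K => I ⊆ K) ⊆
          (R (I ∪ T') \ I).biUnion fun y => 𝒦.filter fun K => insert y I ⊆ K := by
        intro K hK
        obtain ⟨h1, h2⟩ := Finset.mem_filter.1 hK
        obtain ⟨hKc, hdis, hKU⟩ := h𝒦 K h1
        have hdis' : Disjoint I T' :=
          (Finset.disjoint_of_subset_left hT'T (Finset.disjoint_of_subset_right h2 hdis)).symm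
        obtain ⟨y, hyK, hyR, hyU⟩ := hKU (I ∪ T')
          (Finset.union_subset (h2.trans Finset.subset_union_right)
            (hT'T.trans Finset.subset_union_left))
          (by rw [Finset.card_union_of_disjoint hdis']; omega)
        refine Finset.mem_biUnion.2 ⟨y, Finset.mem_sdiff.2 ⟨hyR, fun h => hyU ?_⟩,
          Finset.mem_filter.2 ⟨h1, Finset.insert_subset hyK h2⟩⟩
        exact Finset.mem_union_left _ h
      refine (Finset.card_le_card hsub).trans ?_
      refine (Finset.card_biUnion_le_card_mul _ _ (k ^ d) fun y hy => ?_).trans ?_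
      · apply ih
        rw [Finset.card_insert_of_notMem (Finset.mem_sdiff.1 hy).2]
        omega
      · rw [pow_succ, mul_comm]
        exact Nat.mul_le_mul_left _ ((Finset.card_le_card Finset.sdiff_subset).trans (hR _))
  simpa using key (t + 1) ∅ (by simp)

theorem card_tShadow_add_le {n t j k : ℕ} (𝒢 : Finset (Finset ℕ))
    (h𝒢 : 𝒢 ⊆ (Finset.Icc 1 n).powersetCard k) :
    (tShadow (t + j) 𝒢).card ≤ (tShadow t 𝒢).card * n ^ j := by
  have hsub : tShadow (t + j) 𝒢 ⊆
      (tShadow t 𝒢).biUnion fun T => (tShadow (t + j) 𝒢).filter fun S => T ⊆ S := by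
    intro S hS
    obtain ⟨F, hF, hSF, hSc⟩ := mem_tShadow.1 hS
    obtain ⟨T, hTS, hT⟩ := Finset.exists_subset_card_eq (s := S) (n := t) (by omega)
    exact Finset.mem_biUnion.2 ⟨T, mem_tShadow.2 ⟨F, hF, hTS.trans hSF, hT⟩,
      Finset.mem_filter.2 ⟨hS, hTS⟩⟩
  refine (Finset.card_le_card hsub).trans (Finset.card_biUnion_le_card_mul _ _ _ fun T hT => ?_)
  obtain ⟨_, _, _, hT⟩ := mem_tShadow.1 hT
  have := card_filter_superset_le (n := n) (j := t + j) (tShadow (t + j) 𝒢) (by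
    intro S hS
    obtain ⟨F, hF, hSF, hSc⟩ := mem_tShadow.1 hS
    exact Finset.mem_powersetCard.2 ⟨hSF.trans (Finset.mem_powersetCard.1 (h𝒢 hF)).1, hSc⟩) T
  rwa [hT, Nat.add_sub_cancel_left] at this

/-- Up to few exceptional members, every member of a family with few pairs meeting in `t` points
contains a core of size `t + 1`, and every `t`-set is compatible with boundedly many cores. -/
theorem exists_core_decomposition (t a : ℕ) (ht : 1 ≤ t) (ha : 2 ≤ a) :
    ∃ C : ℕ, ∀ (n : ℕ) (𝒢 : Finset (Finset ℕ)),
      𝒢 ⊆ (Finset.Icc 1 n).powersetCard (2 * t + 1 + a) →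
      ∃ (ℬ : Finset (Finset ℕ)) (core : Finset ℕ → Finset ℕ) (D : ℕ),
        D ^ 2 ≤ (tShadow t 𝒢).card * crossPairs t 𝒢 𝒢 ∧
        ℬ.card ≤ D + C * ((tShadow t 𝒢).card * n ^ (a - 1)) ∧
        (∀ F ∈ 𝒢 \ ℬ, core F ⊆ F ∧ (core F).card = t + 1) ∧
        ∀ T : Finset ℕ, T.card = t →
          (((𝒢 \ ℬ).filter fun F => T ⊆ F \ core F).image core).card ≤ C := by
  classical
  set k := 2 * t + 1 + a with hkdef
  set C₁ := (2 ^ k * k) ^ (k - (t + (a - 1))) with hC₁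
  refine ⟨max C₁ (k ^ (t + 1)), fun n 𝒢 h𝒢 => ?_⟩
  have hk : ∀ F ∈ 𝒢, F.card = k := fun F hF => (Finset.mem_powersetCard.1 (h𝒢 hF)).2
  have h𝒮 : ∀ T ∈ tShadow t 𝒢, T.card = t := fun T hT => by
    obtain ⟨_, _, _, h⟩ := mem_tShadow.1 hT
    exact h
  obtain ⟨R, hRk, hRT, hR⟩ := exists_reference_sets ht 𝒢 (tShadow t 𝒢) hk h𝒮
  set 𝒟 := (tShadow t 𝒢).biUnion fun T => 𝒢.filter fun F => F ∩ R T = T with h𝒟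
  have hx : ∀ F : Finset ℕ, ∀ T : Finset ℕ, ∃ y : ℕ, F ∈ 𝒢 \ 𝒟 → T ⊆ F → T.card = t →
      y ∈ F ∧ y ∈ R T ∧ y ∉ T := by
    intro F T
    by_cases h : F ∈ 𝒢 \ 𝒟 ∧ T ⊆ F ∧ T.card = t
    · obtain ⟨hF, hTF, hT⟩ := h
      obtain ⟨hF𝒢, hF𝒟⟩ := Finset.mem_sdiff.1 hF
      have hne : F ∩ R T ≠ T := by
        intro heq
        exact hF𝒟 (Finset.mem_biUnion.2 ⟨T, mem_tShadow.2 ⟨F, hF𝒢, hTF, hT⟩,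
          Finset.mem_filter.2 ⟨hF𝒢, heq⟩⟩)
      have hss : T ⊂ F ∩ R T :=
        Finset.ssubset_iff_subset_ne.2 ⟨Finset.subset_inter hTF (hRT F hF𝒢 T hTF), hne.symm⟩
      obtain ⟨y, hy, hyT⟩ := Finset.exists_of_ssubset hss
      exact ⟨y, fun _ _ _ => ⟨(Finset.mem_inter.1 hy).1, (Finset.mem_inter.1 hy).2, hyT⟩⟩
    · exact ⟨0, fun h1 h2 h3 => absurd ⟨h1, h2, h3⟩ h⟩
  choose x hx using hx
  set 𝒩 := (tShadow (t + (a - 1)) 𝒢).biUnion fun S => (𝒢 \ 𝒟).filter fun F => S ⊆ F ∧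
    ∀ S', S ⊆ S' → S' ⊆ F → (∀ T ⊆ S', T.card = t → x F T ∈ S') → S' = F with h𝒩
  have hcard𝒩 : 𝒩.card ≤ (tShadow (t + (a - 1)) 𝒢).card * C₁ := by
    refine Finset.card_biUnion_le_card_mul _ _ _ fun S hS => ?_
    obtain ⟨_, _, _, hS⟩ := mem_tShadow.1 hS
    rw [hC₁, ← hS]
    refine (card_generated_le (𝒢 \ 𝒟) (fun F hF => hk F (Finset.mem_sdiff.1 hF).1) R hRk x
      (fun F hF T hT hc => ?_) S)
    exact ⟨(hx F T hF hT hc).1, (hx F T hF hT hc).2.1⟩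
  have hcore : ∀ F : Finset ℕ, ∃ K : Finset ℕ, F ∈ 𝒢 \ (𝒟 ∪ 𝒩) → K ⊆ F ∧ K.card = t + 1 ∧
      ∀ T ⊆ F, T.card = t → x F T ∈ K := by
    intro F
    by_cases hF : F ∈ 𝒢 \ (𝒟 ∪ 𝒩)
    · rw [Finset.mem_sdiff, Finset.mem_union, not_or] at hF
      obtain ⟨hF𝒢, hF𝒟, hF𝒩⟩ := hF
      have hFD := Finset.mem_sdiff.2 ⟨hF𝒢, hF𝒟⟩
      obtain ⟨K, hK⟩ := exists_core_of_closed_cover ha (hk F hF𝒢) (x F)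
        (fun T hT hc => ⟨(hx F T hFD hT hc).1, (hx F T hFD hT hc).2.2⟩) (fun S hSF hS => by
          by_contra hcon
          push Not at hcon
          refine hF𝒩 (Finset.mem_biUnion.2 ⟨S, mem_tShadow.2 ⟨F, hF𝒢, hSF, by omega⟩,
            Finset.mem_filter.2 ⟨hFD, hSF, fun S' h1 h2 h3 => ?_⟩⟩)
          by_contra hne
          obtain ⟨T, hT1, hT2, hT3⟩ := hcon S' h1 h2 hne
          exact hT3 (h3 T hT1 hT2))
      exact ⟨K, fun _ => hK⟩
    · exact ⟨∅, fun h => absurd h hF⟩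
  choose core hcore using hcore
  refine ⟨𝒟 ∪ 𝒩, core, _, hR, ?_, fun F hF => ⟨(hcore F hF).1, (hcore F hF).2.1⟩,
    fun T hT => ?_⟩
  · refine (Finset.card_union_le _ _).trans (Nat.add_le_add Finset.card_biUnion_le ?_)
    calc 𝒩.card ≤ (tShadow (t + (a - 1)) 𝒢).card * C₁ := hcard𝒩
      _ ≤ ((tShadow t 𝒢).card * n ^ (a - 1)) * max C₁ (k ^ (t + 1)) :=
          Nat.mul_le_mul (card_tShadow_add_le 𝒢 h𝒢) (le_max_left _ _)
      _ = _ := mul_comm _ _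
  · refine le_trans (card_cores_le R hRk T hT _ fun K hK => ?_) (le_max_right _ _)
    obtain ⟨F, hF, rfl⟩ := Finset.mem_image.1 hK
    obtain ⟨hF, hTF⟩ := Finset.mem_filter.1 hF
    obtain ⟨h1, h2, h3⟩ := hcore F hF
    have hTF' : T ⊆ F := hTF.trans Finset.sdiff_subset
    refine ⟨h2, Finset.disjoint_of_subset_left hTF Finset.sdiff_disjoint, fun U hU hUc => ?_⟩
    have hUF : U ⊆ F := hU.trans (Finset.union_subset hTF' h1)
    have hFD : F ∈ 𝒢 \ 𝒟 := by
      rw [Finset.mem_sdiff, Finset.mem_union, not_or] at hF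
      exact Finset.mem_sdiff.2 ⟨hF.1, hF.2.1⟩
    exact ⟨x F U, h3 U hUF hUc, (hx F U hFD hUF hUc).2⟩

/-- The Lovász form of the Kruskal–Katona theorem for families of finite sets of naturals. -/
theorem card_le_choose_of_card_tShadow_lt {n m t y : ℕ} (htm : t ≤ m) (𝒜 : Finset (Finset ℕ))
    (h𝒜 : 𝒜 ⊆ (Finset.Icc 1 n).powersetCard m) (hy : (tShadow t 𝒜).card < y.choose t) :
    𝒜.card ≤ y.choose m := by
  classical
  by_contra! hlt
  set f : Fin (n + 1) ↪ ℕ := Fin.valEmbedding with hf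
  have hrange : ∀ S : Finset ℕ, S ⊆ Finset.Icc 1 n → ∃ S' : Finset (Fin (n + 1)), S'.map f = S := by
    intro S hS
    refine ⟨S.attachFin fun i hi => ?_, Finset.map_valEmbedding_attachFin _⟩
    have := Finset.mem_Icc.1 (hS hi)
    omega
  set ℬ : Finset (Finset (Fin (n + 1))) := Finset.univ.filter fun S => S.map f ∈ 𝒜 with hℬ
  have hcard : ℬ.card = 𝒜.card := by
    refine Finset.card_nbij (fun S => S.map f) (fun S hS => (Finset.mem_filter.1 hS).2)
      (fun S _ S' _ h => Finset.map_injective f h) fun S hS => ?_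
    obtain ⟨S', hS'⟩ := hrange S (Finset.mem_powersetCard.1 (h𝒜 hS)).1
    exact ⟨S', by simpa [hℬ, hS'] using hS, hS'⟩
  have hsized : (ℬ : Set (Finset (Fin (n + 1)))).Sized m := by
    intro S hS
    have hS : S.map f ∈ 𝒜 := by simpa [hℬ] using hS
    have := (Finset.mem_powersetCard.1 (h𝒜 hS)).2
    rwa [Finset.card_map] at this
  have hshadow : (Finset.shadow^[m - t] ℬ).card ≤ (tShadow t 𝒜).card := by
    refine Finset.card_le_card_of_injOn (fun S => S.map f) (fun S hS => ?_)
      (fun S _ S' _ h => Finset.map_injective f h)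
    obtain ⟨B, hB, hSB, hc⟩ := Finset.mem_shadow_iterate_iff_exists_mem_card_add.1 hS
    have hBm := hsized hB
    refine mem_tShadow.2 ⟨B.map f, (Finset.mem_filter.1 hB).2, Finset.map_subset_map.2 hSB, ?_⟩
    rw [Finset.card_map]
    omega
  have hkk : ∀ k, m ≤ k → k ≤ n + 1 → k.choose m ≤ 𝒜.card →
      k.choose t ≤ (tShadow t 𝒜).card := by
    intro k hmk hkn hk
    have := Finset.kruskal_katona_lovasz_form (i := m - t) (Nat.sub_le _ _) hmk hkn hsized
      (by rw [hcard]; exact hk)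
    rw [Nat.sub_sub_self htm] at this
    exact this.trans hshadow
  have hle : 𝒜.card ≤ n.choose m := by
    simpa using Finset.card_le_card h𝒜
  rcases le_or_gt m y with hmy | hmy
  · have hyn : y ≤ n := by
      by_contra! hny
      have := Nat.choose_le_choose m hny.le
      omega
    have := hkk y hmy (by omega) hlt.le
    omega
  · have hmn : m ≤ n := by
      by_contra! hnm
      rw [Nat.choose_eq_zero_of_lt hnm] at hle
      omega
    have := hkk m le_rfl (by omega) (by rw [Nat.choose_self]; omega)
    have := Nat.choose_le_choose t hmy.le
    omega

theorem choose_add_le_pow_mul_choose (y t a : ℕ) :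
    y.choose (t + a) ≤ y ^ a * y.choose t := by
  have h1 := Nat.choose_mul (n := y) (Nat.le_add_right t a)
  rw [Nat.add_sub_cancel_left] at h1
  calc y.choose (t + a) ≤ y.choose (t + a) * (t + a).choose t :=
        Nat.le_mul_of_pos_right _ (Nat.choose_pos (Nat.le_add_right _ _))
    _ = y.choose t * (y - t).choose a := h1
    _ ≤ y.choose t * y ^ a := Nat.mul_le_mul_left _ ((Nat.choose_le_pow _ _).trans
        (Nat.pow_le_pow_left (Nat.sub_le _ _) _))
    _ = _ := mul_comm _ _

theorem choose_succ_left_le_mul {z t : ℕ} (htz : t ≤ z) :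
    (z + 1).choose t ≤ (t + 1) * z.choose t := by
  cases t with
  | zero => simp
  | succ t =>
    rw [Nat.choose_succ_succ]
    have h1 := Nat.choose_succ_right_eq z t
    have h2 : z.choose t ≤ z.choose t * (z - t) := Nat.le_mul_of_pos_right _ (by omega)
    nlinarith

theorem tShadow_eq_empty_iff {n m t : ℕ} (htm : t ≤ m) {𝒜 : Finset (Finset ℕ)}
    (h𝒜 : 𝒜 ⊆ (Finset.Icc 1 n).powersetCard m) : (tShadow t 𝒜).card = 0 ↔ 𝒜 = ∅ := by
  constructor
  · intro h
    by_contra hne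
    obtain ⟨A, hA⟩ := Finset.nonempty_iff_ne_empty.2 hne
    obtain ⟨T, hTA, hT⟩ := Finset.exists_subset_card_eq (s := A) (n := t)
      (by rw [(Finset.mem_powersetCard.1 (h𝒜 hA)).2]; exact htm)
    have := mem_tShadow.2 ⟨A, hA, hTA, hT⟩
    rw [Finset.card_eq_zero.1 h] at this
    simp at this
  · rintro rfl
    rfl

/-- The number `z` with `C(z, t) ≤ |∂𝒜| < C(z + 1, t)` controls the size of the family. -/
theorem exists_choose_le_card_tShadow {n t a : ℕ} (ht : 1 ≤ t) {𝒜 : Finset (Finset ℕ)}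
    (h𝒜 : 𝒜 ⊆ (Finset.Icc 1 n).powersetCard (t + a)) (hne : 𝒜.Nonempty) :
    ∃ z, t ≤ z ∧ z.choose t ≤ (tShadow t 𝒜).card ∧ 𝒜.card ≤ (z + 1).choose (t + a) ∧
      ∀ y, (tShadow t 𝒜).card < y.choose t → z + 1 ≤ y := by
  have hpos : (tShadow t 𝒜).card ≠ 0 := by
    rw [Ne, tShadow_eq_empty_iff (Nat.le_add_right t a) h𝒜]
    exact hne.ne_empty
  have hex : ∃ y : ℕ, (tShadow t 𝒜).card < y.choose t := by
    refine ⟨(tShadow t 𝒜).card + t, ?_⟩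
    have h1 : (tShadow t 𝒜).card + 1 ≤ ((tShadow t 𝒜).card + t).choose t := by
      obtain ⟨s, rfl⟩ : ∃ s, t = s + 1 := ⟨t - 1, by omega⟩
      induction (tShadow (s + 1) 𝒜).card with
      | zero => simp
      | succ d ih =>
        have : d + 1 + (s + 1) = (d + (s + 1)) + 1 := by ring
        rw [this, Nat.choose_succ_succ']
        have : 0 < (d + (s + 1)).choose s := Nat.choose_pos (by omega)
        omega
    omega
  classical
  have hy := Nat.find_spec hex
  have hmin : ∀ y, y < Nat.find hex → y.choose t ≤ (tShadow t 𝒜).card := fun y h => by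
    have := Nat.find_min hex h
    omega
  have hty : t < Nat.find hex := by
    by_contra! h
    have := Nat.choose_le_choose t h
    rw [Nat.choose_self] at this
    omega
  refine ⟨Nat.find hex - 1, by omega, hmin _ (by omega), ?_, fun y h => ?_⟩
  · rw [Nat.sub_add_cancel (by omega)]
    exact card_le_choose_of_card_tShadow_lt (Nat.le_add_right _ _) 𝒜 h𝒜 hy
  · have := Nat.find_min' hex h
    omega

theorem card_le_mul_card_tShadow {n t a y : ℕ} (ht : 1 ≤ t) (𝒜 : Finset (Finset ℕ))
    (h𝒜 : 𝒜 ⊆ (Finset.Icc 1 n).powersetCard (t + a)) (hy : (tShadow t 𝒜).card < y.choose t) :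
    𝒜.card ≤ (t + 1) * (tShadow t 𝒜).card * y ^ a := by
  rcases 𝒜.eq_empty_or_nonempty with rfl | hne
  · simp
  obtain ⟨z, htz, hz, hcard, hzy⟩ := exists_choose_le_card_tShadow ht h𝒜 hne
  calc 𝒜.card ≤ (z + 1).choose (t + a) := hcard
    _ ≤ (z + 1) ^ a * (z + 1).choose t := choose_add_le_pow_mul_choose _ _ _
    _ ≤ y ^ a * ((t + 1) * (tShadow t 𝒜).card) := by
        refine Nat.mul_le_mul (Nat.pow_le_pow_left (hzy y hy) _) ?_
        exact (choose_succ_left_le_mul htz).trans (Nat.mul_le_mul_left _ hz)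
    _ = _ := by ring

/-- The members of `𝒢` with core `τ`, with the core removed. -/
def coreLink (𝒢 : Finset (Finset ℕ)) (core : Finset ℕ → Finset ℕ) (τ : Finset ℕ) :
    Finset (Finset ℕ) :=
  (𝒢.filter fun F => core F = τ).image fun F => F \ τ

theorem mem_coreLink {𝒢 : Finset (Finset ℕ)} {core : Finset ℕ → Finset ℕ} {τ A : Finset ℕ} :
    A ∈ coreLink 𝒢 core τ ↔ ∃ F ∈ 𝒢, core F = τ ∧ F \ τ = A := by
  simp [coreLink, and_assoc]

theorem card_coreLink {𝒢 : Finset (Finset ℕ)} {core : Finset ℕ → Finset ℕ}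
    (hcore : ∀ F ∈ 𝒢, core F ⊆ F) (τ : Finset ℕ) :
    (coreLink 𝒢 core τ).card = (𝒢.filter fun F => core F = τ).card := by
  refine Finset.card_image_of_injOn fun F hF F' hF' h => ?_
  obtain ⟨h1, h2⟩ := Finset.mem_filter.1 hF
  obtain ⟨h1', h2'⟩ := Finset.mem_filter.1 hF'
  have h3 := hcore F h1
  have h3' := hcore F' h1'
  rw [h2] at h3
  rw [h2'] at h3'
  have h : F \ τ = F' \ τ := h
  rw [← Finset.sdiff_union_of_subset h3, h, Finset.sdiff_union_of_subset h3']

theorem coreLink_subset {n t m : ℕ} {𝒢 : Finset (Finset ℕ)} {core : Finset ℕ → Finset ℕ}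
    (h𝒢 : 𝒢 ⊆ (Finset.Icc 1 n).powersetCard (t + 1 + m))
    (hcore : ∀ F ∈ 𝒢, core F ⊆ F ∧ (core F).card = t + 1) (τ : Finset ℕ) :
    coreLink 𝒢 core τ ⊆ (Finset.Icc 1 n).powersetCard m := by
  intro A hA
  obtain ⟨F, hF, rfl, rfl⟩ := mem_coreLink.1 hA
  obtain ⟨h1, h2⟩ := Finset.mem_powersetCard.1 (h𝒢 hF)
  obtain ⟨h3, h4⟩ := hcore F hF
  refine Finset.mem_powersetCard.2 ⟨Finset.sdiff_subset.trans h1, ?_⟩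
  rw [Finset.card_sdiff_of_subset h3]
  omega

theorem tShadow_coreLink_subset {t : ℕ} (𝒢 : Finset (Finset ℕ)) (core : Finset ℕ → Finset ℕ)
    (τ : Finset ℕ) : tShadow t (coreLink 𝒢 core τ) ⊆ tShadow t 𝒢 := by
  intro T hT
  obtain ⟨A, hA, hTA, hTc⟩ := mem_tShadow.1 hT
  obtain ⟨F, hF, rfl, rfl⟩ := mem_coreLink.1 hA
  exact mem_tShadow.2 ⟨F, hF, hTA.trans Finset.sdiff_subset, hTc⟩

theorem sum_card_tShadow_coreLink_le {t C : ℕ} (𝒢 𝒮 : Finset (Finset ℕ))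
    (core : Finset ℕ → Finset ℕ) (h𝒮 : tShadow t 𝒢 ⊆ 𝒮)
    (hC : ∀ T : Finset ℕ, T.card = t →
      ((𝒢.filter fun F => T ⊆ F \ core F).image core).card ≤ C) :
    ∑ τ ∈ 𝒢.image core, (tShadow t (coreLink 𝒢 core τ)).card ≤ C * 𝒮.card := by
  have h1 : ∀ τ ∈ 𝒢.image core, (tShadow t (coreLink 𝒢 core τ)).card =
      ∑ T ∈ 𝒮.filter (fun T => T.card = t),
        if T ∈ tShadow t (coreLink 𝒢 core τ) then 1 else 0 := by
    intro τ _
    rw [← Finset.card_filter]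
    congr 1
    ext T
    refine ⟨fun hT => Finset.mem_filter.2 ⟨Finset.mem_filter.2
      ⟨h𝒮 (tShadow_coreLink_subset _ _ _ hT), ?_⟩, hT⟩, fun hT => (Finset.mem_filter.1 hT).2⟩
    obtain ⟨_, _, _, h⟩ := mem_tShadow.1 hT
    exact h
  rw [Finset.sum_congr rfl h1, Finset.sum_comm]
  calc _ ≤ ∑ T ∈ 𝒮.filter (fun T => T.card = t), C := by
        refine Finset.sum_le_sum fun T hT => ?_
        refine le_trans ?_ (hC T (Finset.mem_filter.1 hT).2)
        rw [← Finset.card_filter]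
        refine Finset.card_le_card fun τ hτ => ?_
        obtain ⟨A, hA, hTA, hT⟩ := mem_tShadow.1 (Finset.mem_filter.1 hτ).2
        obtain ⟨F, hF, rfl, rfl⟩ := mem_coreLink.1 hA
        exact Finset.mem_image.2 ⟨F, Finset.mem_filter.2 ⟨hF, hTA⟩, rfl⟩
    _ ≤ C * 𝒮.card := by
        rw [Finset.sum_const, smul_eq_mul, mul_comm]
        exact Nat.mul_le_mul_left _ (Finset.card_filter_le _ _)

/-- A family with few pairs meeting in `t` points and a small `t`-shadow is small. -/
theorem card_le_of_card_tShadow_lt (t a : ℕ) (ht : 1 ≤ t) (ha : 2 ≤ a) :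
    ∃ C : ℕ, ∀ (n : ℕ) (𝒢 : Finset (Finset ℕ)) (y : ℕ),
      𝒢 ⊆ (Finset.Icc 1 n).powersetCard (2 * t + 1 + a) →
      (tShadow t 𝒢).card < y.choose t →
      ∃ D : ℕ, D ^ 2 ≤ (tShadow t 𝒢).card * crossPairs t 𝒢 𝒢 ∧
        𝒢.card ≤ D + C * (tShadow t 𝒢).card * (n ^ (a - 1) + y ^ a) := by
  classical
  obtain ⟨C, hC⟩ := exists_core_decomposition t a ht ha
  refine ⟨(t + 1) * C, fun n 𝒢 y h𝒢 hy => ?_⟩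
  obtain ⟨ℬ, core, D, hD, hℬ, hcore, hcount⟩ := hC n 𝒢 h𝒢
  refine ⟨D, hD, ?_⟩
  set ℋ := 𝒢 \ ℬ with hℋ
  have hℋ𝒢 : ℋ ⊆ 𝒢 := Finset.sdiff_subset
  have hℋn : ℋ ⊆ (Finset.Icc 1 n).powersetCard (t + 1 + (t + a)) := by
    rw [show t + 1 + (t + a) = 2 * t + 1 + a by ring]
    exact hℋ𝒢.trans h𝒢
  have hsum := sum_card_tShadow_coreLink_le ℋ (tShadow t 𝒢) core (tShadow_mono hℋ𝒢) hcount
  have hℋcard : ℋ.card ≤ (t + 1) * y ^ a * (C * (tShadow t 𝒢).card) := by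
    calc ℋ.card = ∑ τ ∈ ℋ.image core, (coreLink ℋ core τ).card := by
          rw [Finset.card_eq_sum_card_image core ℋ]
          exact Finset.sum_congr rfl fun τ _ =>
            (card_coreLink (fun F hF => (hcore F hF).1) τ).symm
      _ ≤ ∑ τ ∈ ℋ.image core, (t + 1) * y ^ a * (tShadow t (coreLink ℋ core τ)).card := by
          refine Finset.sum_le_sum fun τ _ => ?_
          refine (card_le_mul_card_tShadow (y := y) ht _
            (coreLink_subset hℋn hcore τ) ?_).trans (by apply le_of_eq; ring)
          exact (Finset.card_le_card ((tShadow_coreLink_subset ℋ core τ).trans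
            (tShadow_mono hℋ𝒢))).trans_lt hy
      _ ≤ _ := by
          rw [← Finset.mul_sum]
          exact Nat.mul_le_mul_left _ hsum
  have h1 : 𝒢.card ≤ ℬ.card + ℋ.card := by
    have : 𝒢.card - ℬ.card ≤ ℋ.card := Finset.le_card_sdiff ℬ 𝒢
    omega
  have h2 : C * ((tShadow t 𝒢).card * n ^ (a - 1)) ≤
      (t + 1) * (C * ((tShadow t 𝒢).card * n ^ (a - 1))) :=
    Nat.le_mul_of_pos_left _ (by omega)
  calc 𝒢.card ≤ (D + (t + 1) * (C * ((tShadow t 𝒢).card * n ^ (a - 1)))) +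
        (t + 1) * y ^ a * (C * (tShadow t 𝒢).card) := by omega
    _ = _ := by ring

theorem card_filter_superset_le_add {n k : ℕ} (𝒢 : Finset (Finset ℕ))
    (h𝒢 : 𝒢 ⊆ (Finset.Icc 1 n).powersetCard k) (U W : Finset ℕ) (hUW : Disjoint W U) :
    (𝒢.filter fun F => U ⊆ F).card ≤
      (𝒢.filter fun F => U ⊆ F ∧ Disjoint F W).card + W.card * n ^ (k - (U.card + 1)) := by
  have hsub : (𝒢.filter fun F => U ⊆ F) ⊆ (𝒢.filter fun F => U ⊆ F ∧ Disjoint F W) ∪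
      W.biUnion fun w => 𝒢.filter fun F => insert w U ⊆ F := by
    intro F hF
    obtain ⟨h1, h2⟩ := Finset.mem_filter.1 hF
    by_cases hd : Disjoint F W
    · exact Finset.mem_union_left _ (Finset.mem_filter.2 ⟨h1, h2, hd⟩)
    · obtain ⟨w, hwF, hwW⟩ := Finset.not_disjoint_iff.1 hd
      exact Finset.mem_union_right _ (Finset.mem_biUnion.2 ⟨w, hwW, Finset.mem_filter.2
        ⟨h1, Finset.insert_subset hwF h2⟩⟩)
  refine (Finset.card_le_card hsub).trans ((Finset.card_union_le _ _).trans
    (Nat.add_le_add_left (Finset.card_biUnion_le_card_mul _ _ _ fun w hw => ?_) _))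
  have := card_filter_superset_le 𝒢 h𝒢 (insert w U)
  rwa [Finset.card_insert_of_notMem (Finset.disjoint_left.1 hUW hw)] at this

/-- If two sets meet in `t` points and both lie in many members of the family, then many pairs of
members meet in exactly `t` points. -/
theorem mul_card_filter_superset_le {n k u t : ℕ} (hu : u ≤ k) (𝒢 : Finset (Finset ℕ))
    (h𝒢 : 𝒢 ⊆ (Finset.Icc 1 n).powersetCard k) {U U' : Finset ℕ} (hU : U.card = u)
    (hU' : U'.card = u) (ht : (U ∩ U').card = t)
    (hd : 2 * (k * n ^ (k - (u + 1))) ≤ (𝒢.filter fun F => U ⊆ F).card)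
    (hd' : 2 * (k * n ^ (k - (u + 1))) ≤ (𝒢.filter fun F => U' ⊆ F).card) :
    (𝒢.filter fun F => U ⊆ F).card * (𝒢.filter fun F => U' ⊆ F).card ≤
      4 * crossPairs t 𝒢 𝒢 := by
  have hhalf : ∀ V W : Finset ℕ, V.card = u → W.card ≤ k → Disjoint W V →
      2 * (k * n ^ (k - (u + 1))) ≤ (𝒢.filter fun F => V ⊆ F).card →
      (𝒢.filter fun F => V ⊆ F).card ≤ 2 * (𝒢.filter fun F => V ⊆ F ∧ Disjoint F W).card := by
    intro V W hV hW hdis h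
    have h1 := card_filter_superset_le_add 𝒢 h𝒢 V W hdis
    rw [hV] at h1
    have := Nat.mul_le_mul_right (n ^ (k - (u + 1))) hW
    omega
  have h1 := hhalf U (U' \ U) hU ((Finset.card_le_card Finset.sdiff_subset).trans (by omega))
    Finset.sdiff_disjoint hd
  have h2 : (𝒢.filter fun F => U ⊆ F ∧ Disjoint F (U' \ U)).card *
      (𝒢.filter fun F => U' ⊆ F).card ≤ 2 * crossPairs t 𝒢 𝒢 := by
    calc _ = ∑ F ∈ 𝒢.filter (fun F => U ⊆ F ∧ Disjoint F (U' \ U)),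
          (𝒢.filter fun F' => U' ⊆ F').card := by rw [Finset.sum_const, smul_eq_mul]
      _ ≤ ∑ F ∈ 𝒢.filter (fun F => U ⊆ F ∧ Disjoint F (U' \ U)),
          2 * (𝒢.filter fun F' => (F ∩ F').card = t).card := by
          refine Finset.sum_le_sum fun F hF => ?_
          obtain ⟨hF, hUF, hdis⟩ := Finset.mem_filter.1 hF
          have hFk := (Finset.mem_powersetCard.1 (h𝒢 hF)).2
          refine (hhalf U' (F \ U') hU' ((Finset.card_le_card Finset.sdiff_subset).trans hFk.le)
            Finset.sdiff_disjoint hd').trans (Nat.mul_le_mul_left _ (Finset.card_le_card ?_))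
          intro F' hF'
          obtain ⟨hF', hUF', hdis'⟩ := Finset.mem_filter.1 hF'
          refine Finset.mem_filter.2 ⟨hF', ?_⟩
          rw [← ht]
          congr 1
          ext x
          simp only [Finset.mem_inter]
          constructor
          · rintro ⟨hx, hx'⟩
            have hxU' : x ∈ U' := by
              by_contra h
              exact Finset.disjoint_left.1 hdis' hx' (Finset.mem_sdiff.2 ⟨hx, h⟩)
            refine ⟨?_, hxU'⟩
            by_contra h
            exact Finset.disjoint_left.1 hdis hx (Finset.mem_sdiff.2 ⟨hxU', h⟩)
          · exact fun ⟨hx, hx'⟩ => ⟨hUF hx, hUF' hx'⟩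
      _ ≤ ∑ F ∈ 𝒢, 2 * (𝒢.filter fun F' => (F ∩ F').card = t).card :=
          Finset.sum_le_sum_of_subset (Finset.filter_subset _ _)
      _ = 2 * crossPairs t 𝒢 𝒢 := by
          rw [← Finset.mul_sum, crossPairs, Finset.card_filter, Finset.sum_product]
          simp_rw [Finset.card_filter]
  calc _ ≤ (2 * (𝒢.filter fun F => U ⊆ F ∧ Disjoint F (U' \ U)).card) *
        (𝒢.filter fun F => U' ⊆ F).card := Nat.mul_le_mul_right _ h1
    _ ≤ _ := by nlinarith

/-- Few `t`-sets have large degree with respect to two distinct cores. -/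
theorem card_common_mul_le {n t a H s : ℕ} (hn : 0 < n) (ha : 1 ≤ a) (𝒢 : Finset (Finset ℕ))
    (h𝒢 : 𝒢 ⊆ (Finset.Icc 1 n).powersetCard (2 * t + 1 + a)) {τ τ' : Finset ℕ}
    (hτ : τ.card = t + 1) (hτ' : τ'.card = t + 1) (hne : τ ≠ τ') (𝒬 : Finset (Finset ℕ))
    (h𝒬 : 𝒬 ⊆ (Finset.Icc 1 n).powersetCard t)
    (hdeg : ∀ T ∈ 𝒬, Disjoint T τ ∧ Disjoint T τ' ∧
      H ≤ (𝒢.filter fun F => τ ∪ T ⊆ F).card ∧ H ≤ (𝒢.filter fun F => τ' ∪ T ⊆ F).card)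
    (hs : 4 * crossPairs t 𝒢 𝒢 < s ^ 2) :
    𝒬.card * H ≤ 2 ^ (2 * t + 1 + a) *
      (2 * (2 * t + 1 + a) * n ^ (t + a - 1) + s * n ^ t) := by
  set k := 2 * t + 1 + a with hk
  set i := (τ ∩ τ').card with hi
  have hit : i ≤ t := by
    by_contra! h
    have h1 : τ ∩ τ' = τ := Finset.eq_of_subset_of_card_le Finset.inter_subset_left (by omega)
    have h2 : τ ∩ τ' = τ' := Finset.eq_of_subset_of_card_le Finset.inter_subset_right (by omega)
    exact hne (h1.symm.trans h2)
  set M := 2 * (k * n ^ (a + i - 1)) + s with hM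
  have hcover : 𝒬 ⊆ ((Finset.Icc 1 n).powersetCard (t - i)).biUnion fun X =>
      𝒬.filter fun T => X ⊆ T := by
    intro T hT
    obtain ⟨h1, h2⟩ := Finset.mem_powersetCard.1 (h𝒬 hT)
    obtain ⟨X, hX, hXc⟩ := Finset.exists_subset_card_eq (s := T) (n := t - i) (by omega)
    exact Finset.mem_biUnion.2 ⟨X, Finset.mem_powersetCard.2 ⟨hX.trans h1, hXc⟩,
      Finset.mem_filter.2 ⟨hT, hX⟩⟩
  have hfew : ∀ σ : Finset ℕ, (∀ T ∈ 𝒬, H ≤ (𝒢.filter fun F => σ ∪ T ⊆ F).card) →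
      ∀ X : Finset ℕ, (𝒢.filter fun F => σ ∪ X ⊆ F).card ≤ M →
      (𝒬.filter fun T => X ⊆ T).card * H ≤ 2 ^ k * M := by
    intro σ hσ X hX
    calc (𝒬.filter fun T => X ⊆ T).card * H
        ≤ ∑ T ∈ 𝒬.filter (fun T => X ⊆ T), (𝒢.filter fun F => σ ∪ T ⊆ F).card := by
          rw [← smul_eq_mul, ← Finset.sum_const]
          exact Finset.sum_le_sum fun T hT => hσ T (Finset.mem_filter.1 hT).1
      _ = ∑ T ∈ 𝒬.filter (fun T => X ⊆ T), ∑ F ∈ 𝒢.filter (fun F => σ ∪ X ⊆ F),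
            if σ ∪ T ⊆ F then 1 else 0 := by
          refine Finset.sum_congr rfl fun T hT => ?_
          rw [← Finset.card_filter, Finset.filter_filter]
          congr 1
          refine Finset.filter_congr fun F _ => ⟨fun h => ⟨?_, h⟩, fun h => h.2⟩
          exact (Finset.union_subset_union_right (Finset.mem_filter.1 hT).2).trans h
      _ = ∑ F ∈ 𝒢.filter (fun F => σ ∪ X ⊆ F), ∑ T ∈ 𝒬.filter (fun T => X ⊆ T),
            if σ ∪ T ⊆ F then 1 else 0 := Finset.sum_comm
      _ ≤ ∑ F ∈ 𝒢.filter (fun F => σ ∪ X ⊆ F), 2 ^ k := by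
          refine Finset.sum_le_sum fun F hF => ?_
          have hFk := (Finset.mem_powersetCard.1 (h𝒢 (Finset.mem_filter.1 hF).1)).2
          rw [← Finset.card_filter, ← hFk, ← Finset.card_powerset]
          refine Finset.card_le_card fun T hT => Finset.mem_powerset.2 ?_
          exact Finset.subset_union_right.trans (Finset.mem_filter.1 hT).2
      _ = (𝒢.filter fun F => σ ∪ X ⊆ F).card * 2 ^ k := by rw [Finset.sum_const, smul_eq_mul]
      _ ≤ 2 ^ k * M := by
          rw [mul_comm]
          exact Nat.mul_le_mul_left _ hX
  have hX : ∀ X ∈ (Finset.Icc 1 n).powersetCard (t - i),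
      (𝒬.filter fun T => X ⊆ T).card * H ≤ 2 ^ k * M := by
    intro X hX
    obtain ⟨hXn, hXc⟩ := Finset.mem_powersetCard.1 hX
    rcases (𝒬.filter fun T => X ⊆ T).eq_empty_or_nonempty with h0 | ⟨T, hT⟩
    · rw [h0]
      simp
    obtain ⟨hT, hXT⟩ := Finset.mem_filter.1 hT
    obtain ⟨hd, hd', -, -⟩ := hdeg T hT
    have hdX := Finset.disjoint_of_subset_left hXT hd
    have hdX' := Finset.disjoint_of_subset_left hXT hd'
    by_contra! hlt
    have h1 : M < (𝒢.filter fun F => τ ∪ X ⊆ F).card := by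
      by_contra! h
      exact absurd (hfew τ (fun T hT => (hdeg T hT).2.2.1) X h) (not_le.2 hlt)
    have h2 : M < (𝒢.filter fun F => τ' ∪ X ⊆ F).card := by
      by_contra! h
      exact absurd (hfew τ' (fun T hT => (hdeg T hT).2.2.2) X h) (not_le.2 hlt)
    have hexp : k - (2 * t + 1 - i + 1) = a + i - 1 := by omega
    have h3 := mul_card_filter_superset_le (u := 2 * t + 1 - i) (t := t) (by omega) 𝒢 h𝒢
      (U := τ ∪ X) (U' := τ' ∪ X)
      (by rw [Finset.card_union_of_disjoint hdX.symm]; omega)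
      (by rw [Finset.card_union_of_disjoint hdX'.symm]; omega)
      (by
        rw [← Finset.inter_union_distrib_right, Finset.card_union_of_disjoint]
        · omega
        · exact Finset.disjoint_of_subset_left Finset.inter_subset_left hdX.symm)
      (by rw [hexp]; omega) (by rw [hexp]; omega)
    have h4 : s ≤ M := by omega
    nlinarith
  calc 𝒬.card * H ≤ (∑ X ∈ (Finset.Icc 1 n).powersetCard (t - i),
        (𝒬.filter fun T => X ⊆ T).card) * H :=
        Nat.mul_le_mul_right _ ((Finset.card_le_card hcover).trans Finset.card_biUnion_le)
    _ = ∑ X ∈ (Finset.Icc 1 n).powersetCard (t - i), (𝒬.filter fun T => X ⊆ T).card * H :=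
        Finset.sum_mul _ _ _
    _ ≤ ∑ X ∈ (Finset.Icc 1 n).powersetCard (t - i), 2 ^ k * M := Finset.sum_le_sum hX
    _ = n.choose (t - i) * (2 ^ k * M) := by
        rw [Finset.sum_const, smul_eq_mul, Finset.card_powersetCard, Nat.card_Icc,
          Nat.add_sub_cancel]
    _ ≤ n ^ (t - i) * (2 ^ k * M) := Nat.mul_le_mul_right _ (Nat.choose_le_pow _ _)
    _ = 2 ^ k * (2 * k * (n ^ (t - i) * n ^ (a + i - 1)) + s * n ^ (t - i)) := by
        rw [hM]
        ring
    _ ≤ _ := by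
        rw [← pow_add, show t - i + (a + i - 1) = t + a - 1 by omega]
        refine Nat.mul_le_mul_left _ (Nat.add_le_add_left (Nat.mul_le_mul_left _ ?_) _)
        exact Nat.pow_le_pow_right hn (Nat.sub_le _ _)

theorem card_tShadow_le_pow {n t k : ℕ} {𝒢 : Finset (Finset ℕ)}
    (h𝒢 : 𝒢 ⊆ (Finset.Icc 1 n).powersetCard k) : (tShadow t 𝒢).card ≤ n ^ t := by
  have hsub : tShadow t 𝒢 ⊆ (Finset.Icc 1 n).powersetCard t := by
    intro T hT
    obtain ⟨F, hF, hTF, hT⟩ := mem_tShadow.1 hT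
    exact Finset.mem_powersetCard.2 ⟨hTF.trans (Finset.mem_powersetCard.1 (h𝒢 hF)).1, hT⟩
  refine (Finset.card_le_card hsub).trans ?_
  rw [Finset.card_powersetCard]
  simpa using Nat.choose_le_pow n t

/-- Up to few exceptional members, a family with few pairs meeting in `t` points splits into
boundedly many pieces, each with a common core of size `t + 1`, and with almost disjoint
`t`-shadows outside of the cores. -/
theorem exists_core_structure (t a : ℕ) (ht : 1 ≤ t) (ha : 2 ≤ a) :
    ∃ C : ℕ, ∀ (n y H s : ℕ) (𝓕 : Finset (Finset ℕ)), 0 < n →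
      𝓕 ⊆ (Finset.Icc 1 n).powersetCard (2 * t + 1 + a) → 4 * crossPairs t 𝓕 𝓕 < s ^ 2 →
      ∃ (I : Finset (Finset ℕ)) (ℋ 𝒜 𝒬 : Finset ℕ → Finset (Finset ℕ)) (D : ℕ),
        (∀ τ ∈ I, τ ⊆ Finset.Icc 1 n ∧ τ.card = t + 1) ∧
        (∀ τ ∈ I, 𝒬 τ ⊆ (Finset.Icc 1 n).powersetCard t) ∧
        (∀ τ ∈ I, 𝒜 τ ⊆ (Finset.Icc 1 n).powersetCard (t + a) ∧ tShadow t (𝒜 τ) ⊆ 𝒬 τ ∧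
          (ℋ τ).card = (𝒜 τ).card ∧ ∀ F ∈ ℋ τ, τ ⊆ F) ∧
        I.card * y.choose t ≤ C * n ^ t ∧
        (∀ τ ∈ I, ∀ τ' ∈ I, τ ≠ τ' → (𝒬 τ ∩ 𝒬 τ').card * H ≤ 2 ^ (2 * t + 1 + a) *
          (2 * (2 * t + 1 + a) * n ^ (t + a - 1) + s * n ^ t)) ∧
        D ^ 2 ≤ n ^ t * crossPairs t 𝓕 𝓕 ∧
        (𝓕 \ I.biUnion ℋ).card ≤
          D + C * n ^ (t + a - 1) + (t + 1) * C * n ^ t * y ^ a + C * n ^ t * (H - 1) := by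
  classical
  obtain ⟨C, hC⟩ := exists_core_decomposition t a ht ha
  refine ⟨C, fun n y H s 𝓕 hn h𝓕 hs => ?_⟩
  obtain ⟨ℬ, core, D, hD, hℬ, hcore, hcount⟩ := hC n 𝓕 h𝓕
  set 𝒢 := 𝓕 \ ℬ with h𝒢def
  have h𝒢𝓕 : 𝒢 ⊆ 𝓕 := Finset.sdiff_subset
  have h𝒢 : 𝒢 ⊆ (Finset.Icc 1 n).powersetCard (2 * t + 1 + a) := h𝒢𝓕.trans h𝓕
  have h𝒢n : 𝒢 ⊆ (Finset.Icc 1 n).powersetCard (t + 1 + (t + a)) := by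
    rw [show t + 1 + (t + a) = 2 * t + 1 + a by ring]
    exact h𝒢
  have hsum : ∑ τ ∈ 𝒢.image core, (tShadow t (coreLink 𝒢 core τ)).card ≤ C * n ^ t :=
    (sum_card_tShadow_coreLink_le 𝒢 (tShadow t 𝒢) core subset_rfl hcount).trans
      (Nat.mul_le_mul_left _ (card_tShadow_le_pow h𝒢))
  set deg : Finset ℕ → Finset ℕ → ℕ := fun τ T =>
    (𝒢.filter fun F => core F = τ ∧ T ⊆ F \ τ).card with hdeg
  set I := (𝒢.image core).filter fun τ => y.choose t ≤ (tShadow t (coreLink 𝒢 core τ)).card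
    with hI
  set ℋ : Finset ℕ → Finset (Finset ℕ) := fun τ =>
    𝒢.filter fun F => core F = τ ∧ ∀ T ⊆ F \ τ, T.card = t → H ≤ deg τ T with hℋ
  set 𝒬 : Finset ℕ → Finset (Finset ℕ) := fun τ =>
    ((Finset.Icc 1 n).powersetCard t).filter fun T => Disjoint T τ ∧ H ≤ deg τ T with h𝒬
  have hIprop : ∀ τ ∈ I, τ ⊆ Finset.Icc 1 n ∧ τ.card = t + 1 := by
    intro τ hτ
    obtain ⟨F, hF, rfl⟩ := Finset.mem_image.1 (Finset.mem_filter.1 hτ).1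
    exact ⟨(hcore F hF).1.trans (Finset.mem_powersetCard.1 (h𝒢 hF)).1, (hcore F hF).2⟩
  have hℋlink : ∀ τ, ((ℋ τ).image fun F => F \ τ) ⊆ coreLink 𝒢 core τ := by
    intro τ A hA
    obtain ⟨F, hF, rfl⟩ := Finset.mem_image.1 hA
    obtain ⟨h1, h2, h3⟩ := Finset.mem_filter.1 hF
    exact mem_coreLink.2 ⟨F, h1, h2, rfl⟩
  have hlink := coreLink_subset h𝒢n hcore
  refine ⟨I, ℋ, fun τ => (ℋ τ).image fun F => F \ τ, 𝒬, D, hIprop,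
    fun τ _ => Finset.filter_subset _ _, fun τ hτ => ⟨(hℋlink τ).trans (hlink τ), ?_, ?_, ?_⟩,
    ?_, ?_, ?_, ?_⟩
  · intro T hT
    obtain ⟨A, hA, hTA, hTc⟩ := mem_tShadow.1 hT
    obtain ⟨F, hF, rfl⟩ := Finset.mem_image.1 hA
    obtain ⟨h1, h2, h3⟩ := Finset.mem_filter.1 hF
    refine Finset.mem_filter.2 ⟨Finset.mem_powersetCard.2 ⟨?_, hTc⟩,
      Finset.disjoint_of_subset_left hTA Finset.sdiff_disjoint, h3 T hTA hTc⟩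
    exact (hTA.trans Finset.sdiff_subset).trans (Finset.mem_powersetCard.1 (h𝒢 h1)).1
  · refine (Finset.card_image_of_injOn fun F hF F' hF' h => ?_).symm
    obtain ⟨h1, h2, -⟩ := Finset.mem_filter.1 hF
    obtain ⟨h1', h2', -⟩ := Finset.mem_filter.1 hF'
    have h3 := (hcore F h1).1
    have h3' := (hcore F' h1').1
    rw [h2] at h3
    rw [h2'] at h3'
    have h : F \ τ = F' \ τ := h
    rw [← Finset.sdiff_union_of_subset h3, h, Finset.sdiff_union_of_subset h3']
  · intro F hF
    obtain ⟨h1, h2, -⟩ := Finset.mem_filter.1 hF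
    exact h2 ▸ (hcore F h1).1
  · calc I.card * y.choose t = ∑ τ ∈ I, y.choose t := by rw [Finset.sum_const, smul_eq_mul]
      _ ≤ ∑ τ ∈ I, (tShadow t (coreLink 𝒢 core τ)).card :=
          Finset.sum_le_sum fun τ hτ => (Finset.mem_filter.1 hτ).2
      _ ≤ _ := (Finset.sum_le_sum_of_subset (Finset.filter_subset _ _)).trans hsum
  · intro τ hτ τ' hτ' hne
    have hdegle : ∀ σ T : Finset ℕ, deg σ T ≤ (𝓕.filter fun F => σ ∪ T ⊆ F).card := by
      intro σ T
      refine Finset.card_le_card fun F hF => ?_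
      obtain ⟨h1, h2, h3⟩ := Finset.mem_filter.1 hF
      exact Finset.mem_filter.2 ⟨h𝒢𝓕 h1, Finset.union_subset (h2 ▸ (hcore F h1).1)
        (h3.trans Finset.sdiff_subset)⟩
    refine card_common_mul_le hn (by omega) 𝓕 h𝓕 (hIprop τ hτ).2 (hIprop τ' hτ').2 hne _
      (Finset.inter_subset_left.trans (Finset.filter_subset _ _)) (fun T hT => ?_) hs
    obtain ⟨h1, h2⟩ := Finset.mem_inter.1 hT
    obtain ⟨-, h3, h4⟩ := Finset.mem_filter.1 h1
    obtain ⟨-, h5, h6⟩ := Finset.mem_filter.1 h2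
    exact ⟨h3, h5, h4.trans (hdegle _ _), h6.trans (hdegle _ _)⟩
  · exact hD.trans (Nat.mul_le_mul_right _ (card_tShadow_le_pow h𝓕))
  · have hsub : 𝓕 \ I.biUnion ℋ ⊆ (ℬ ∪ ((𝒢.image core).filter fun τ =>
        (tShadow t (coreLink 𝒢 core τ)).card < y.choose t).biUnion
          fun τ => 𝒢.filter fun F => core F = τ) ∪
        (𝒢.image core).biUnion fun τ => ((tShadow t (coreLink 𝒢 core τ)).filter
          fun T => deg τ T < H).biUnion fun T => 𝒢.filter fun F => core F = τ ∧ T ⊆ F \ τ := by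
      intro F hF
      obtain ⟨hF𝓕, hFI⟩ := Finset.mem_sdiff.1 hF
      by_cases hFℬ : F ∈ ℬ
      · exact Finset.mem_union_left _ (Finset.mem_union_left _ hFℬ)
      have hF𝒢 : F ∈ 𝒢 := Finset.mem_sdiff.2 ⟨hF𝓕, hFℬ⟩
      have himg : core F ∈ 𝒢.image core := Finset.mem_image_of_mem _ hF𝒢
      by_cases hl : (tShadow t (coreLink 𝒢 core (core F))).card < y.choose t
      · exact Finset.mem_union_left _ (Finset.mem_union_right _ (Finset.mem_biUnion.2
          ⟨core F, Finset.mem_filter.2 ⟨himg, hl⟩, Finset.mem_filter.2 ⟨hF𝒢, rfl⟩⟩))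
      · have hFℋ : F ∉ ℋ (core F) := fun h => hFI (Finset.mem_biUnion.2
          ⟨core F, Finset.mem_filter.2 ⟨himg, not_lt.1 hl⟩, h⟩)
        have : ∃ T ⊆ F \ core F, T.card = t ∧ deg (core F) T < H := by
          by_contra! hcon
          exact hFℋ (Finset.mem_filter.2 ⟨hF𝒢, rfl, hcon⟩)
        obtain ⟨T, hTF, hTc, hTd⟩ := this
        refine Finset.mem_union_right _ (Finset.mem_biUnion.2 ⟨core F, himg,
          Finset.mem_biUnion.2 ⟨T, Finset.mem_filter.2 ⟨?_, hTd⟩,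
          Finset.mem_filter.2 ⟨hF𝒢, rfl, hTF⟩⟩⟩)
        exact mem_tShadow.2 ⟨_, mem_coreLink.2 ⟨F, hF𝒢, rfl, rfl⟩, hTF, hTc⟩
    have h1 : ℬ.card ≤ D + C * n ^ (t + a - 1) := by
      refine hℬ.trans (Nat.add_le_add_left (Nat.mul_le_mul_left _ ?_) _)
      rw [show t + a - 1 = t + (a - 1) by omega, pow_add]
      exact Nat.mul_le_mul_right _ (card_tShadow_le_pow h𝓕)
    have h2 : (((𝒢.image core).filter fun τ =>
        (tShadow t (coreLink 𝒢 core τ)).card < y.choose t).biUnion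
          fun τ => 𝒢.filter fun F => core F = τ).card ≤ (t + 1) * C * n ^ t * y ^ a := by
      calc _ ≤ ∑ τ ∈ (𝒢.image core).filter (fun τ =>
              (tShadow t (coreLink 𝒢 core τ)).card < y.choose t),
              (𝒢.filter fun F => core F = τ).card := Finset.card_biUnion_le
        _ ≤ ∑ τ ∈ (𝒢.image core).filter (fun τ =>
              (tShadow t (coreLink 𝒢 core τ)).card < y.choose t),
              (t + 1) * y ^ a * (tShadow t (coreLink 𝒢 core τ)).card := by
            refine Finset.sum_le_sum fun τ hτ => ?_
            rw [← card_coreLink (fun F hF => (hcore F hF).1)]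
            refine (card_le_mul_card_tShadow ht _ (hlink τ) (Finset.mem_filter.1 hτ).2).trans
              (by apply le_of_eq; ring)
        _ ≤ (t + 1) * y ^ a * (C * n ^ t) := by
            rw [← Finset.mul_sum]
            exact Nat.mul_le_mul_left _
              ((Finset.sum_le_sum_of_subset (Finset.filter_subset _ _)).trans hsum)
        _ = _ := by ring
    have h3 : ((𝒢.image core).biUnion fun τ => ((tShadow t (coreLink 𝒢 core τ)).filter
          fun T => deg τ T < H).biUnion fun T =>
            𝒢.filter fun F => core F = τ ∧ T ⊆ F \ τ).card ≤ C * n ^ t * (H - 1) := by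
      calc _ ≤ ∑ τ ∈ 𝒢.image core, (((tShadow t (coreLink 𝒢 core τ)).filter
              fun T => deg τ T < H).biUnion fun T =>
                𝒢.filter fun F => core F = τ ∧ T ⊆ F \ τ).card := Finset.card_biUnion_le
        _ ≤ ∑ τ ∈ 𝒢.image core, (tShadow t (coreLink 𝒢 core τ)).card * (H - 1) := by
            refine Finset.sum_le_sum fun τ hτ => ?_
            refine (Finset.card_biUnion_le_card_mul _ _ (H - 1) fun T hT => ?_).trans
              (Nat.mul_le_mul_right _ (Finset.card_filter_le _ _))
            have : deg τ T < H := (Finset.mem_filter.1 hT).2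
            exact Nat.le_sub_one_of_lt this
        _ ≤ _ := by
            rw [← Finset.sum_mul]
            exact Nat.mul_le_mul_right _ hsum
    refine (Finset.card_le_card hsub).trans ((Finset.card_union_le _ _).trans ?_)
    exact Nat.add_le_add ((Finset.card_union_le _ _).trans (Nat.add_le_add h1 h2)) h3

theorem sum_card_le_card_biUnion_add {ι α : Type*} [DecidableEq ι] [DecidableEq α]
    (I : Finset ι) (P : ι → Finset α) (κ : ℕ)
    (h : ∀ i ∈ I, ∀ j ∈ I, i ≠ j → (P i ∩ P j).card ≤ κ) :
    ∑ i ∈ I, (P i).card ≤ (I.biUnion P).card + I.card ^ 2 * κ := by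
  induction I using Finset.induction_on with
  | empty => simp
  | insert i I hi ih =>
    have ih := ih fun i' hi' j hj => h i' (Finset.mem_insert_of_mem hi') j
      (Finset.mem_insert_of_mem hj)
    rw [Finset.sum_insert hi, Finset.biUnion_insert, Finset.card_insert_of_notMem hi]
    have h1 : (P i ∩ I.biUnion P).card ≤ I.card * κ := by
      rw [Finset.inter_biUnion]
      exact Finset.card_biUnion_le_card_mul _ _ _ fun j hj =>
        h i (Finset.mem_insert_self _ _) j (Finset.mem_insert_of_mem hj)
          (by rintro rfl; exact hi hj)
    have h2 := Finset.card_union_add_card_inter (P i) (I.biUnion P)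
    nlinarith

/-- If the sum of `t`-th powers is nearly at most one and the sum of larger powers is nearly at
least one, then all but one of the numbers are negligible. -/
theorem exists_sum_erase_pow_le (t a : ℕ) (ha : 1 ≤ a) {ε : ℝ} (hε : 0 < ε) :
    ∃ s : ℝ, 0 < s ∧ ∀ (ι : Type) [DecidableEq ι] (I : Finset ι) (u : ι → ℝ),
      (∀ i ∈ I, 0 ≤ u i ∧ u i ≤ 1) → ∑ i ∈ I, u i ^ t ≤ 1 + s →
      1 - s ≤ ∑ i ∈ I, u i ^ (t + a) → ∃ i ∈ I, ∑ j ∈ I.erase i, u j ^ t ≤ ε := by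
  have hcont : Filter.Tendsto (fun s : ℝ => 1 + s - ((1 - s) / (1 + s)) ^ t)
      (nhds 0) (nhds 0) := by
    have : ContinuousAt (fun s : ℝ => 1 + s - ((1 - s) / (1 + s)) ^ t) 0 := by
      refine ContinuousAt.sub (by fun_prop) (ContinuousAt.pow (ContinuousAt.div (by fun_prop)
        (by fun_prop) (by norm_num)) t)
    simpa [ContinuousAt] using this
  have hev : ∀ᶠ s in nhdsWithin (0 : ℝ) (Set.Ioi 0),
      1 + s - ((1 - s) / (1 + s)) ^ t < ε ∧ s < 1 ∧ 0 < s := by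
    refine ((hcont.mono_left nhdsWithin_le_nhds).eventually_lt_const hε).and
      (Filter.Eventually.and ?_ self_mem_nhdsWithin)
    exact nhdsWithin_le_nhds (gt_mem_nhds one_pos)
  obtain ⟨s, hsε, hs1, hs0⟩ := hev.exists
  refine ⟨s, hs0, fun ι _ I u hu h1 h2 => ?_⟩
  have hne : I.Nonempty := by
    rw [Finset.nonempty_iff_ne_empty]
    rintro rfl
    simp at h2
    linarith
  obtain ⟨i, hi, hmax⟩ := Finset.exists_max_image I u hne
  refine ⟨i, hi, ?_⟩
  obtain ⟨hi0, hi1⟩ := hu i hi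
  have h3 : ∑ j ∈ I, u j ^ (t + a) ≤ u i ^ a * ∑ j ∈ I, u j ^ t := by
    rw [Finset.mul_sum]
    refine Finset.sum_le_sum fun j hj => ?_
    rw [pow_add, mul_comm]
    exact mul_le_mul_of_nonneg_right (pow_le_pow_left₀ (hu j hj).1 (hmax j hj) _)
      (pow_nonneg (hu j hj).1 _)
  have h4 : 1 - s ≤ u i ^ a * (1 + s) :=
    h2.trans (h3.trans (mul_le_mul_of_nonneg_left h1 (pow_nonneg hi0 _)))
  have h5 : (1 - s) / (1 + s) ≤ u i ^ a := by
    rw [div_le_iff₀ (by linarith)]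
    exact h4
  have h6 : (1 - s) / (1 + s) ≤ u i := h5.trans (pow_le_of_le_one hi0 hi1 (by omega))
  have h7 : ((1 - s) / (1 + s)) ^ t ≤ u i ^ t :=
    pow_le_pow_left₀ (div_nonneg (by linarith) (by linarith)) h6 _
  have h8 := Finset.add_sum_erase I (fun j => u j ^ t) hi
  linarith

theorem add_pow_le_pow_add_mul {u x : ℝ} (hu : 0 ≤ u) (hu1 : u ≤ 1) (hx : 0 ≤ x) (hx1 : x ≤ 1)
    (m : ℕ) : (u + x) ^ m ≤ u ^ m + 3 ^ m * x := by
  induction m with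
  | zero => simpa using hx
  | succ m ih =>
    have h1 : u ^ m ≤ 1 := pow_le_one₀ hu hu1
    have h3 : (1 : ℝ) ≤ 3 ^ m := one_le_pow₀ (by norm_num)
    calc (u + x) ^ (m + 1) = (u + x) ^ m * (u + x) := pow_succ _ _
      _ ≤ (u ^ m + 3 ^ m * x) * (u + x) := mul_le_mul_of_nonneg_right ih (by linarith)
      _ = u ^ (m + 1) + (u ^ m + 3 ^ m * (u + x)) * x := by ring
      _ ≤ u ^ (m + 1) + 3 ^ (m + 1) * x := by
          refine add_le_add_right (mul_le_mul_of_nonneg_right ?_ hx) _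
          rw [pow_succ]
          nlinarith

/-- The asymptotic form of the Kruskal–Katona theorem. -/
theorem factorial_mul_card_le (t a : ℕ) (ht : 1 ≤ t) {η : ℝ} (hη : 0 < η) :
    ∃ n₀ : ℕ, ∀ n ≥ n₀, ∀ (𝒜 : Finset (Finset ℕ)) (u : ℝ), 0 ≤ u → u ≤ 1 →
      𝒜 ⊆ (Finset.Icc 1 n).powersetCard (t + a) →
      (t.factorial : ℝ) * (tShadow t 𝒜).card ≤ u ^ t * (n : ℝ) ^ t →
      ((t + a).factorial : ℝ) * 𝒜.card ≤ (u ^ (t + a) + η) * (n : ℝ) ^ (t + a) := by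
  obtain ⟨n₀, hn₀⟩ := exists_nat_ge (3 ^ (t + a) * (t : ℝ) / η)
  refine ⟨max n₀ t, fun n hn 𝒜 u hu hu1 h𝒜 hsh => ?_⟩
  have hnt : t ≤ n := (le_max_right _ _).trans hn
  have hnpos : (0 : ℝ) < n := by exact_mod_cast (by omega : 0 < n)
  rcases 𝒜.eq_empty_or_nonempty with rfl | hne
  · simp only [Finset.card_empty, Nat.cast_zero, mul_zero]
    positivity
  obtain ⟨z, htz, hz, hcard, -⟩ := exists_choose_le_card_tShadow ht h𝒜 hne
  have h1 : ((z + 1 - t : ℕ) : ℝ) ^ t ≤ (u * n) ^ t := by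
    have h2 := Nat.pow_sub_le_descFactorial z t
    rw [Nat.descFactorial_eq_factorial_mul_choose] at h2
    have h3 : (z + 1 - t) ^ t ≤ t.factorial * (tShadow t 𝒜).card :=
      h2.trans (Nat.mul_le_mul_left _ hz)
    rw [mul_pow]
    exact le_trans (by exact_mod_cast h3) hsh
  have h2 : ((z + 1 - t : ℕ) : ℝ) ≤ u * n :=
    le_of_pow_le_pow_left₀ (by omega) (by positivity) h1
  rw [Nat.cast_sub (by omega)] at h2
  push_cast at h2
  have h3 : (t + a).factorial * 𝒜.card ≤ (z + 1) ^ (t + a) := by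
    refine (Nat.mul_le_mul_left _ hcard).trans ?_
    rw [← Nat.descFactorial_eq_factorial_mul_choose]
    exact Nat.descFactorial_le_pow _ _
  have hx1 : (t : ℝ) / n ≤ 1 := by
    rw [div_le_one hnpos]
    exact_mod_cast hnt
  have hxη : 3 ^ (t + a) * ((t : ℝ) / n) ≤ η := by
    have : 3 ^ (t + a) * (t : ℝ) / η ≤ n :=
      hn₀.trans (by exact_mod_cast (le_max_left _ _).trans hn)
    rw [div_le_iff₀ hη] at this
    rw [← mul_div_assoc, div_le_iff₀ hnpos]
    linarith
  calc ((t + a).factorial : ℝ) * 𝒜.card ≤ ((z : ℝ) + 1) ^ (t + a) := by exact_mod_cast h3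
    _ ≤ ((u + t / n) * n) ^ (t + a) := by
        refine pow_le_pow_left₀ (by positivity) ?_ _
        rw [add_mul, div_mul_cancel₀ _ hnpos.ne']
        linarith
    _ = (u + t / n) ^ (t + a) * (n : ℝ) ^ (t + a) := mul_pow _ _ _
    _ ≤ (u ^ (t + a) + η) * (n : ℝ) ^ (t + a) := by
        refine mul_le_mul_of_nonneg_right ?_ (by positivity)
        have := add_pow_le_pow_add_mul hu hu1 (by positivity : (0 : ℝ) ≤ t / n) hx1 (t + a)
        linarith

theorem le_factorial_mul_choose_sub (c j : ℕ) {η : ℝ} (hη : 0 < η) :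
    ∃ n₀ : ℕ, ∀ n ≥ n₀, (1 - η) * (n : ℝ) ^ j ≤ (j.factorial : ℝ) * (n - c).choose j := by
  obtain ⟨n₀, hn₀⟩ := exists_nat_ge ((j : ℝ) * (c + j) / η)
  refine ⟨max n₀ (c + j + 1), fun n hn => ?_⟩
  have hnc : c + j + 1 ≤ n := (le_max_right _ _).trans hn
  have hnpos : (0 : ℝ) < n := by exact_mod_cast (by omega : 0 < n)
  have h1 : (n - c - j) ^ j ≤ j.factorial * (n - c).choose j := by
    rw [← Nat.descFactorial_eq_factorial_mul_choose]
    exact (Nat.pow_le_pow_left (by omega) _).trans (Nat.pow_sub_le_descFactorial _ _)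
  have hx : ((c : ℝ) + j) / n ≤ 1 := by
    rw [div_le_one hnpos]
    exact_mod_cast (by omega : c + j ≤ n)
  have h2 := one_add_mul_le_pow (a := -(((c : ℝ) + j) / n)) (by linarith) j
  have h3 : (j : ℝ) * (((c : ℝ) + j) / n) ≤ η := by
    have : (j : ℝ) * (c + j) / η ≤ n :=
      hn₀.trans (by exact_mod_cast (le_max_left _ _).trans hn)
    rw [div_le_iff₀ hη] at this
    rw [← mul_div_assoc, div_le_iff₀ hnpos]
    linarith
  calc (1 - η) * (n : ℝ) ^ j ≤ (1 + -(((c : ℝ) + j) / n)) ^ j * (n : ℝ) ^ j := by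
        refine mul_le_mul_of_nonneg_right ?_ (by positivity)
        linarith
    _ = ((n - c - j : ℕ) : ℝ) ^ j := by
        rw [← mul_pow, Nat.cast_sub (by omega), Nat.cast_sub (by omega)]
        congr 1
        field_simp
        ring
    _ ≤ _ := by exact_mod_cast h1

set_option maxHeartbeats 1600000 in
/-- Stability: a family at least as large as a full star with few pairs meeting in `t` points is
close to a star with a centre of size `t + 1`. -/
theorem exists_dominant_core (t a : ℕ) (ht : 1 ≤ t) (ha : 2 ≤ a) {ε : ℝ} (hε : 0 < ε) :
    ∃ δ : ℝ, 0 < δ ∧ ∃ n₀ : ℕ, ∀ n ≥ n₀, ∀ 𝓕 : Finset (Finset ℕ),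
      𝓕 ⊆ (Finset.Icc 1 n).powersetCard (2 * t + 1 + a) →
      (n - (t + 1)).choose (t + a) ≤ 𝓕.card →
      (crossPairs t 𝓕 𝓕 : ℝ) ≤ δ * (n : ℝ) ^ (2 * a) →
      ∃ T₀ ⊆ Finset.Icc 1 n, T₀.card = t + 1 ∧
        ((𝓕.filter fun F => ¬ T₀ ⊆ F).card : ℝ) ≤ ε * (n : ℝ) ^ (t + a) := by
  classical
  obtain ⟨C, hC⟩ := exists_core_structure t a ht ha
  obtain ⟨s, hs, hA⟩ := exists_sum_erase_pow_le t a (by omega) (half_pos hε)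
  set M : ℝ := ((t + a).factorial : ℝ) with hM
  have hM0 : 0 < M := by
    rw [hM]
    exact_mod_cast (t + a).factorial_pos
  set η : ℝ := min (ε / 2) (s / (4 * M)) with hηdef
  have hη : 0 < η := lt_min (half_pos hε) (by positivity)
  have hηε : η ≤ ε / 2 := min_le_left _ _
  have hηs : M * η ≤ s / 4 := by
    have : η ≤ s / (4 * M) := min_le_right _ _
    rw [le_div_iff₀ (by positivity)] at this
    linarith
  set θ : ℝ := min 1 (η / (2 * ((t + 2) * C + 1))) with hθdef
  have hθ : 0 < θ := lt_min one_pos (by positivity)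
  have hθ1 : θ ≤ 1 := min_le_left _ _
  have hθη : ((t : ℝ) + 2) * C * θ ≤ η / 2 := by
    have : θ ≤ η / (2 * ((t + 2) * C + 1)) := min_le_right _ _
    rw [le_div_iff₀ (by positivity)] at this
    linarith
  set K : ℝ := t.factorial * C * (2 / θ) ^ t with hK
  have hK0 : 0 ≤ K := by positivity
  set σ : ℝ := min (η / 4) (s * θ / (t.factorial * K ^ 2 * (2 ^ (2 * t + 1 + a) * 4) + 1)) with hσdef
  have hσ : 0 < σ := lt_min (by positivity) (by positivity)
  have hση : 2 * σ ≤ η / 2 := by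
    have : σ ≤ η / 4 := min_le_left _ _
    linarith
  have hσs : t.factorial * K ^ 2 * (2 ^ (2 * t + 1 + a) * (4 * σ)) ≤ s * θ := by
    have : σ ≤ s * θ / (t.factorial * K ^ 2 * (2 ^ (2 * t + 1 + a) * 4) + 1) := min_le_right _ _
    rw [le_div_iff₀ (by positivity)] at this
    linarith
  set κ : ℝ := 2 ^ (2 * t + 1 + a) * (4 * σ) / θ with hκ
  have hκ0 : 0 ≤ κ := by positivity
  have hκs : t.factorial * K ^ 2 * κ ≤ s := by
    rw [hκ, ← mul_div_assoc, div_le_iff₀ hθ]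
    exact hσs
  obtain ⟨n₁, hn₁⟩ := factorial_mul_card_le t a ht (η := s / (4 * (K + 1))) (by positivity)
  obtain ⟨n₂, hn₂⟩ := le_factorial_mul_choose_sub (t + 1) (t + a) (η := s / 4) (by positivity)
  obtain ⟨n₃, hn₃⟩ := exists_nat_ge ((C : ℝ) / σ)
  obtain ⟨n₄, hn₄⟩ := exists_nat_ge ((2 * (2 * t + 1 + a) + 1 : ℝ) / σ)
  obtain ⟨n₅, hn₅⟩ := exists_nat_ge (2 * (t : ℝ) / θ)
  refine ⟨σ ^ 2, by positivity, n₁ + n₂ + n₃ + n₄ + n₅ + 1, fun n hn 𝓕 h𝓕 hcard hE => ?_⟩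
  have hn1 : (1 : ℝ) ≤ n := by exact_mod_cast (by omega : 1 ≤ n)
  have hn0 : (0 : ℝ) < n := by linarith
  have hCn : (C : ℝ) ≤ σ * n := by
    have : (C : ℝ) / σ ≤ n := hn₃.trans (by exact_mod_cast (by omega : n₃ ≤ n))
    rw [div_le_iff₀ hσ] at this
    linarith
  have hkn : (2 * (2 * t + 1 + a) + 1 : ℝ) ≤ σ * n := by
    have : (2 * (2 * t + 1 + a) + 1 : ℝ) / σ ≤ n :=
      hn₄.trans (by exact_mod_cast (by omega : n₄ ≤ n))
    rw [div_le_iff₀ hσ] at this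
    linarith
  have htn : 2 * (t : ℝ) ≤ θ * n := by
    have : 2 * (t : ℝ) / θ ≤ n := hn₅.trans (by exact_mod_cast (by omega : n₅ ≤ n))
    rw [div_le_iff₀ hθ] at this
    linarith
  set y := ⌊θ * n⌋₊ with hy
  set H := ⌈θ * (n : ℝ) ^ a⌉₊ with hH
  set S := ⌈3 * σ * (n : ℝ) ^ a⌉₊ with hS
  have hHle : θ * (n : ℝ) ^ a ≤ H := Nat.le_ceil _
  have hH1 : ((H - 1 : ℕ) : ℝ) ≤ θ * (n : ℝ) ^ a := by
    have h1 : 0 < H := Nat.ceil_pos.2 (by positivity)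
    rw [Nat.cast_sub h1]
    have := Nat.ceil_lt_add_one (a := θ * (n : ℝ) ^ a) (by positivity)
    push_cast
    linarith
  have hSle : 3 * σ * (n : ℝ) ^ a ≤ S := Nat.le_ceil _
  have hS1 : (S : ℝ) ≤ 3 * σ * (n : ℝ) ^ a + 1 :=
    (Nat.ceil_lt_add_one (by positivity)).le
  have hyle : (y : ℝ) ≤ θ * n := Nat.floor_le (by positivity)
  have hylt : θ * n < y + 1 := Nat.lt_floor_add_one _
  have hna : (n : ℝ) ^ (2 * a) = (n : ℝ) ^ a * (n : ℝ) ^ a := by rw [two_mul, pow_add]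
  have hSE : 4 * crossPairs t 𝓕 𝓕 < S ^ 2 := by
    have h1 : (4 * crossPairs t 𝓕 𝓕 : ℝ) < (S : ℝ) ^ 2 := by
      have h2 : (3 * σ * (n : ℝ) ^ a) ^ 2 ≤ (S : ℝ) ^ 2 := pow_le_pow_left₀ (by positivity) hSle _
      have h3 : (0 : ℝ) < σ ^ 2 * (n : ℝ) ^ (2 * a) := by positivity
      have h4 : (3 * σ * (n : ℝ) ^ a) ^ 2 = 9 * (σ ^ 2 * (n : ℝ) ^ (2 * a)) := by
        rw [hna]
        ring
      linarith
    exact_mod_cast h1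
  obtain ⟨I, ℋ, 𝒜, 𝒬, D, hI, h𝒬, h𝒜, hIcard, hover, hD, hrest⟩ :=
    hC n y H S 𝓕 (by omega) h𝓕 hSE
  have hDle : (D : ℝ) ≤ σ * (n : ℝ) ^ (t + a) := by
    refine le_of_pow_le_pow_left₀ two_ne_zero (by positivity) ?_
    calc (D : ℝ) ^ 2 ≤ (n : ℝ) ^ t * crossPairs t 𝓕 𝓕 := by exact_mod_cast hD
      _ ≤ (n : ℝ) ^ t * (σ ^ 2 * (n : ℝ) ^ (2 * a)) :=
          mul_le_mul_of_nonneg_left hE (by positivity)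
      _ = σ ^ 2 * (n : ℝ) ^ (t + 2 * a) := by ring
      _ ≤ σ ^ 2 * (n : ℝ) ^ ((t + a) * 2) :=
          mul_le_mul_of_nonneg_left (pow_le_pow_right₀ hn1 (by omega)) (by positivity)
      _ = (σ * (n : ℝ) ^ (t + a)) ^ 2 := by ring
  have hpred : (n : ℝ) ^ (t + a) = n * (n : ℝ) ^ (t + a - 1) := by
    rw [← pow_succ', Nat.sub_add_cancel (by omega)]
  have hjunk : ((𝓕 \ I.biUnion ℋ).card : ℝ) ≤ η * (n : ℝ) ^ (t + a) := by
    have h1 : ((𝓕 \ I.biUnion ℋ).card : ℝ) ≤ D + C * (n : ℝ) ^ (t + a - 1) +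
        (t + 1) * C * (n : ℝ) ^ t * (y : ℝ) ^ a + C * (n : ℝ) ^ t * ((H - 1 : ℕ) : ℝ) := by
      exact_mod_cast hrest
    have h2 : C * (n : ℝ) ^ (t + a - 1) ≤ σ * (n : ℝ) ^ (t + a) := by
      rw [hpred, ← mul_assoc]
      exact mul_le_mul_of_nonneg_right hCn (by positivity)
    have h3 : (y : ℝ) ^ a ≤ θ * (n : ℝ) ^ a := by
      calc (y : ℝ) ^ a ≤ (θ * n) ^ a := pow_le_pow_left₀ (by positivity) hyle _
        _ = θ ^ a * (n : ℝ) ^ a := mul_pow _ _ _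
        _ ≤ θ * (n : ℝ) ^ a := mul_le_mul_of_nonneg_right
            (pow_le_of_le_one hθ.le hθ1 (by omega)) (by positivity)
    have h4 : (t + 1) * C * (n : ℝ) ^ t * (y : ℝ) ^ a ≤
        (t + 1) * C * θ * (n : ℝ) ^ (t + a) := by
      calc _ ≤ (t + 1) * C * (n : ℝ) ^ t * (θ * (n : ℝ) ^ a) :=
            mul_le_mul_of_nonneg_left h3 (by positivity)
        _ = _ := by ring
    have h5 : C * (n : ℝ) ^ t * ((H - 1 : ℕ) : ℝ) ≤ C * θ * (n : ℝ) ^ (t + a) := by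
      calc _ ≤ C * (n : ℝ) ^ t * (θ * (n : ℝ) ^ a) :=
            mul_le_mul_of_nonneg_left hH1 (by positivity)
        _ = _ := by ring
    have h6 : (2 * σ + (t + 2) * C * θ) * (n : ℝ) ^ (t + a) ≤ η * (n : ℝ) ^ (t + a) :=
      mul_le_mul_of_nonneg_right (by linarith) (by positivity)
    linarith
  have hIK : (I.card : ℝ) ≤ K := by
    have h1 : (θ * n / 2) ^ t ≤ t.factorial * (y.choose t : ℝ) := by
      have h2 := Nat.pow_sub_le_descFactorial y t
      rw [Nat.descFactorial_eq_factorial_mul_choose] at h2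
      have h3 : θ * n / 2 ≤ ((y + 1 - t : ℕ) : ℝ) := by
        have : (t : ℝ) ≤ y + 1 := by linarith
        rw [Nat.cast_sub (by exact_mod_cast this)]
        push_cast
        linarith
      exact (pow_le_pow_left₀ (by positivity) h3 _).trans (by exact_mod_cast h2)
    have h2 : (I.card : ℝ) * y.choose t ≤ C * (n : ℝ) ^ t := by exact_mod_cast hIcard
    have h3 : (I.card : ℝ) * (θ / 2) ^ t * (n : ℝ) ^ t ≤ (t.factorial * C) * (n : ℝ) ^ t := by
      calc _ = (I.card : ℝ) * (θ * n / 2) ^ t := by ring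
        _ ≤ I.card * (t.factorial * (y.choose t : ℝ)) :=
            mul_le_mul_of_nonneg_left h1 (by positivity)
        _ = t.factorial * (I.card * y.choose t) := by ring
        _ ≤ t.factorial * (C * (n : ℝ) ^ t) := mul_le_mul_of_nonneg_left h2 (by positivity)
        _ = _ := by ring
    have h4 := le_of_mul_le_mul_right h3 (by positivity)
    rw [← le_div_iff₀ (by positivity)] at h4
    refine h4.trans (le_of_eq ?_)
    rw [hK, div_eq_mul_inv, ← inv_pow, inv_div]
  have hoverκ : ∀ τ ∈ I, ∀ τ' ∈ I, τ ≠ τ' → (𝒬 τ ∩ 𝒬 τ').card ≤ ⌊κ * (n : ℝ) ^ t⌋₊ := by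
    intro τ hτ τ' hτ' hne
    refine Nat.le_floor ?_
    have h1 : ((𝒬 τ ∩ 𝒬 τ').card : ℝ) * H ≤ 2 ^ (2 * t + 1 + a) *
        (2 * (2 * t + 1 + a) * (n : ℝ) ^ (t + a - 1) + S * (n : ℝ) ^ t) := by
      exact_mod_cast hover τ hτ τ' hτ' hne
    have h2 : 2 * (2 * t + 1 + a) * (n : ℝ) ^ (t + a - 1) + S * (n : ℝ) ^ t ≤
        4 * σ * (n : ℝ) ^ (t + a) := by
      have h3 : (n : ℝ) ^ t ≤ (n : ℝ) ^ (t + a - 1) := pow_le_pow_right₀ hn1 (by omega)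
      have h4 : S * (n : ℝ) ^ t ≤ 3 * σ * (n : ℝ) ^ (t + a) + (n : ℝ) ^ (t + a - 1) := by
        calc S * (n : ℝ) ^ t ≤ (3 * σ * (n : ℝ) ^ a + 1) * (n : ℝ) ^ t :=
              mul_le_mul_of_nonneg_right hS1 (by positivity)
          _ = 3 * σ * (n : ℝ) ^ (t + a) + (n : ℝ) ^ t := by ring
          _ ≤ _ := by linarith
      have h5 : (2 * (2 * t + 1 + a) + 1 : ℝ) * (n : ℝ) ^ (t + a - 1) ≤
          σ * (n : ℝ) ^ (t + a) := by
        rw [hpred, ← mul_assoc]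
        exact mul_le_mul_of_nonneg_right hkn (by positivity)
      linarith
    have h3 : ((𝒬 τ ∩ 𝒬 τ').card : ℝ) * θ * (n : ℝ) ^ a ≤
        2 ^ (2 * t + 1 + a) * (4 * σ) * (n : ℝ) ^ t * (n : ℝ) ^ a := by
      calc _ = ((𝒬 τ ∩ 𝒬 τ').card : ℝ) * (θ * (n : ℝ) ^ a) := by ring
        _ ≤ ((𝒬 τ ∩ 𝒬 τ').card : ℝ) * H := mul_le_mul_of_nonneg_left hHle (by positivity)
        _ ≤ _ := h1
        _ ≤ 2 ^ (2 * t + 1 + a) * (4 * σ * (n : ℝ) ^ (t + a)) :=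
            mul_le_mul_of_nonneg_left h2 (by positivity)
        _ = _ := by ring
    have h4 := le_of_mul_le_mul_right h3 (by positivity)
    rw [hκ, div_mul_eq_mul_div, le_div_iff₀ hθ]
    exact h4
  have hsumQ : (t.factorial : ℝ) * ∑ τ ∈ I, ((𝒬 τ).card : ℝ) ≤ (1 + s) * (n : ℝ) ^ t := by
    have h1 := sum_card_le_card_biUnion_add I 𝒬 _ hoverκ
    have h2 : (I.biUnion 𝒬).card ≤ n.choose t := by
      have := Finset.card_le_card (Finset.biUnion_subset.2 h𝒬)
      simpa using this
    have h3 : t.factorial * n.choose t ≤ n ^ t := by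
      rw [← Nat.descFactorial_eq_factorial_mul_choose]
      exact Nat.descFactorial_le_pow _ _
    have h4 : (∑ τ ∈ I, ((𝒬 τ).card : ℝ)) ≤
        n.choose t + (I.card : ℝ) ^ 2 * ⌊κ * (n : ℝ) ^ t⌋₊ := by
      exact_mod_cast h1.trans (Nat.add_le_add_right h2 _)
    have h5 : (I.card : ℝ) ^ 2 * ⌊κ * (n : ℝ) ^ t⌋₊ ≤ K ^ 2 * (κ * (n : ℝ) ^ t) :=
      mul_le_mul (pow_le_pow_left₀ (by positivity) hIK _) (Nat.floor_le (by positivity))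
        (by positivity) (by positivity)
    have h6 : (t.factorial : ℝ) * n.choose t ≤ (n : ℝ) ^ t := by exact_mod_cast h3
    calc (t.factorial : ℝ) * ∑ τ ∈ I, ((𝒬 τ).card : ℝ)
        ≤ t.factorial * (n.choose t + K ^ 2 * (κ * (n : ℝ) ^ t)) :=
          mul_le_mul_of_nonneg_left (by linarith) (by positivity)
      _ = t.factorial * n.choose t + (t.factorial * K ^ 2 * κ) * (n : ℝ) ^ t := by ring
      _ ≤ (n : ℝ) ^ t + s * (n : ℝ) ^ t :=
          add_le_add h6 (mul_le_mul_of_nonneg_right hκs (by positivity))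
      _ = _ := by ring
  have hu : ∀ τ : Finset ℕ, ∃ u : ℝ, τ ∈ I → 0 ≤ u ∧ u ≤ 1 ∧
      u ^ t * (n : ℝ) ^ t = t.factorial * (𝒬 τ).card := by
    intro τ
    by_cases hτ : τ ∈ I
    · have h1 : (t.factorial : ℝ) * (𝒬 τ).card ≤ (n : ℝ) ^ t := by
        have h2 : (𝒬 τ).card ≤ n.choose t := by
          simpa using Finset.card_le_card (h𝒬 τ hτ)
        have h3 : t.factorial * n.choose t ≤ n ^ t := by
          rw [← Nat.descFactorial_eq_factorial_mul_choose]
          exact Nat.descFactorial_le_pow _ _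
        exact_mod_cast (Nat.mul_le_mul_left _ h2).trans h3
      have h0 : 0 ≤ (t.factorial : ℝ) * (𝒬 τ).card / (n : ℝ) ^ t := by positivity
      refine ⟨((t.factorial : ℝ) * (𝒬 τ).card / (n : ℝ) ^ t) ^ ((t : ℝ)⁻¹), fun _ =>
        ⟨Real.rpow_nonneg h0 _, Real.rpow_le_one h0 ?_ (by positivity), ?_⟩⟩
      · rw [div_le_one (by positivity)]
        exact h1
      · rw [Real.rpow_inv_natCast_pow h0 (by omega), div_mul_cancel₀ _ (by positivity)]
    · exact ⟨0, fun h => absurd h hτ⟩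
  choose u hu using hu
  have hsumt : ∑ τ ∈ I, u τ ^ t ≤ 1 + s := by
    refine le_of_mul_le_mul_right ?_ (by positivity : (0 : ℝ) < (n : ℝ) ^ t)
    rw [Finset.sum_mul, Finset.sum_congr rfl fun τ hτ => (hu τ hτ).2.2, ← Finset.mul_sum]
    exact hsumQ
  have hsumm : 1 - s ≤ ∑ τ ∈ I, u τ ^ (t + a) := by
    have h1 : ∀ τ ∈ I, M * (𝒜 τ).card ≤
        (u τ ^ (t + a) + s / (4 * (K + 1))) * (n : ℝ) ^ (t + a) := by
      intro τ hτ
      obtain ⟨h1, h2, -, -⟩ := h𝒜 τ hτ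
      obtain ⟨h3, h4, h5⟩ := hu τ hτ
      refine hn₁ n (by omega) (𝒜 τ) (u τ) h3 h4 h1 ?_
      rw [h5]
      exact mul_le_mul_of_nonneg_left (by exact_mod_cast Finset.card_le_card h2) (by positivity)
    have h2 : (𝓕.card : ℝ) ≤ (𝓕 \ I.biUnion ℋ).card + ∑ τ ∈ I, ((𝒜 τ).card : ℝ) := by
      have h3 : 𝓕.card ≤ (𝓕 \ I.biUnion ℋ).card + (I.biUnion ℋ).card := by
        rw [← Finset.card_sdiff_add_card_inter 𝓕 (I.biUnion ℋ)]
        exact Nat.add_le_add_left (Finset.card_le_card Finset.inter_subset_right) _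
      have h4 : (I.biUnion ℋ).card ≤ ∑ τ ∈ I, (𝒜 τ).card :=
        Finset.card_biUnion_le.trans (Finset.sum_le_sum fun τ hτ => (h𝒜 τ hτ).2.2.1.le)
      exact_mod_cast h3.trans (Nat.add_le_add_left h4 _)
    have h3 : (1 - s / 4) * (n : ℝ) ^ (t + a) ≤ M * 𝓕.card :=
      (hn₂ n (by omega)).trans (mul_le_mul_of_nonneg_left (by exact_mod_cast hcard) hM0.le)
    have h4 : M * ∑ τ ∈ I, ((𝒜 τ).card : ℝ) ≤
        (∑ τ ∈ I, u τ ^ (t + a)) * (n : ℝ) ^ (t + a) + s / 4 * (n : ℝ) ^ (t + a) := by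
      calc M * ∑ τ ∈ I, ((𝒜 τ).card : ℝ)
          ≤ ∑ τ ∈ I, (u τ ^ (t + a) + s / (4 * (K + 1))) * (n : ℝ) ^ (t + a) := by
            rw [Finset.mul_sum]
            exact Finset.sum_le_sum h1
        _ = (∑ τ ∈ I, u τ ^ (t + a)) * (n : ℝ) ^ (t + a) +
              I.card * (s / (4 * (K + 1))) * (n : ℝ) ^ (t + a) := by
            rw [← Finset.sum_mul, Finset.sum_add_distrib, Finset.sum_const, nsmul_eq_mul, add_mul]
        _ ≤ _ := by
            refine add_le_add_right (mul_le_mul_of_nonneg_right ?_ (by positivity)) _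
            rw [← mul_div_assoc, div_le_iff₀ (by positivity)]
            nlinarith
    have h5 : M * (𝓕 \ I.biUnion ℋ).card ≤ s / 4 * (n : ℝ) ^ (t + a) := by
      calc _ ≤ M * (η * (n : ℝ) ^ (t + a)) := mul_le_mul_of_nonneg_left hjunk hM0.le
        _ = M * η * (n : ℝ) ^ (t + a) := by ring
        _ ≤ _ := mul_le_mul_of_nonneg_right hηs (by positivity)
    have h6 : M * 𝓕.card ≤ M * ((𝓕 \ I.biUnion ℋ).card + ∑ τ ∈ I, ((𝒜 τ).card : ℝ)) :=
      mul_le_mul_of_nonneg_left h2 hM0.le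
    refine le_of_mul_le_mul_right ?_ (by positivity : (0 : ℝ) < (n : ℝ) ^ (t + a))
    have h7 : (0 : ℝ) < s * (n : ℝ) ^ (t + a) := by positivity
    linarith
  obtain ⟨T₀, hT₀, hothers⟩ := hA _ I u (fun τ hτ => ⟨(hu τ hτ).1, (hu τ hτ).2.1⟩) hsumt hsumm
  refine ⟨T₀, (hI T₀ hT₀).1, (hI T₀ hT₀).2, ?_⟩
  have hsub : (𝓕.filter fun F => ¬ T₀ ⊆ F) ⊆ (𝓕 \ I.biUnion ℋ) ∪ (I.erase T₀).biUnion ℋ := by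
    intro F hF
    obtain ⟨h1, h2⟩ := Finset.mem_filter.1 hF
    by_cases h3 : F ∈ I.biUnion ℋ
    · obtain ⟨τ, hτ, hFτ⟩ := Finset.mem_biUnion.1 h3
      refine Finset.mem_union_right _ (Finset.mem_biUnion.2 ⟨τ, Finset.mem_erase.2 ⟨?_, hτ⟩, hFτ⟩)
      rintro rfl
      exact h2 ((h𝒜 τ hτ).2.2.2 F hFτ)
    · exact Finset.mem_union_left _ (Finset.mem_sdiff.2 ⟨h1, h3⟩)
  have hℋ : ∀ τ ∈ I, ((ℋ τ).card : ℝ) ≤ u τ ^ t * (n : ℝ) ^ (t + a) := by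
    intro τ hτ
    obtain ⟨h1, h2, h3, -⟩ := h𝒜 τ hτ
    have h4 : (𝒜 τ).card ≤ (𝒬 τ).card * n ^ a := by
      have hcov : 𝒜 τ ⊆ (𝒬 τ).biUnion fun T => (𝒜 τ).filter fun A => T ⊆ A := by
        intro A hA
        obtain ⟨T, hT, hTc⟩ := Finset.exists_subset_card_eq (s := A) (n := t)
          (by rw [(Finset.mem_powersetCard.1 (h1 hA)).2]; omega)
        exact Finset.mem_biUnion.2 ⟨T, h2 (mem_tShadow.2 ⟨A, hA, hT, hTc⟩),
          Finset.mem_filter.2 ⟨hA, hT⟩⟩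
      refine (Finset.card_le_card hcov).trans
        (Finset.card_biUnion_le_card_mul _ _ _ fun T hT => ?_)
      have := card_filter_superset_le (𝒜 τ) h1 T
      rwa [(Finset.mem_powersetCard.1 (h𝒬 τ hτ hT)).2, Nat.add_sub_cancel_left] at this
    have h5 : ((𝒬 τ).card : ℝ) ≤ u τ ^ t * (n : ℝ) ^ t := by
      rw [(hu τ hτ).2.2]
      exact le_mul_of_one_le_left (by positivity) (by exact_mod_cast t.factorial_pos)
    calc ((ℋ τ).card : ℝ) ≤ (𝒬 τ).card * (n : ℝ) ^ a := by
          rw [h3]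
          exact_mod_cast h4
      _ ≤ u τ ^ t * (n : ℝ) ^ t * (n : ℝ) ^ a := mul_le_mul_of_nonneg_right h5 (by positivity)
      _ = _ := by ring
  calc ((𝓕.filter fun F => ¬ T₀ ⊆ F).card : ℝ)
      ≤ (𝓕 \ I.biUnion ℋ).card + ∑ τ ∈ I.erase T₀, ((ℋ τ).card : ℝ) := by
        exact_mod_cast (Finset.card_le_card hsub).trans ((Finset.card_union_le _ _).trans
          (Nat.add_le_add_left Finset.card_biUnion_le _))
    _ ≤ η * (n : ℝ) ^ (t + a) + ∑ τ ∈ I.erase T₀, u τ ^ t * (n : ℝ) ^ (t + a) :=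
        add_le_add hjunk (Finset.sum_le_sum fun τ hτ => hℋ τ (Finset.mem_of_mem_erase hτ))
    _ = (η + ∑ τ ∈ I.erase T₀, u τ ^ t) * (n : ℝ) ^ (t + a) := by
        rw [← Finset.sum_mul, add_mul]
    _ ≤ ε * (n : ℝ) ^ (t + a) := by
        refine mul_le_mul_of_nonneg_right ?_ (by positivity)
        linarith

theorem exists_pow_le_mul_choose_sub (c k : ℕ) :
    ∃ B : ℕ, 0 < B ∧ ∃ n₀ : ℕ, ∀ n ≥ n₀, ∀ j ≤ k, n ^ j ≤ B * (n - c).choose j := by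
  have h : ∀ j, ∃ n₀ : ℕ, ∀ n ≥ n₀, n ^ j ≤ 2 * j.factorial * (n - c).choose j := by
    intro j
    obtain ⟨n₀, hn₀⟩ := le_factorial_mul_choose_sub c j (η := 1 / 2) (by norm_num)
    refine ⟨n₀, fun n hn => ?_⟩
    have := hn₀ n hn
    have h2 : (n : ℝ) ^ j ≤ 2 * j.factorial * (n - c).choose j := by linarith
    exact_mod_cast h2
  choose N hN using h
  refine ⟨2 * k.factorial, by positivity, (Finset.range (k + 1)).sup N, fun n hn j hj => ?_⟩
  refine (hN j n ((Finset.le_sup (Finset.mem_range.2 (by omega))).trans hn)).trans ?_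
  gcongr

theorem crossPairs_eq_sum (t : ℕ) (𝒜 ℬ : Finset (Finset ℕ)) :
    crossPairs t 𝒜 ℬ = ∑ A ∈ 𝒜, (ℬ.filter fun S => (A ∩ S).card = t).card := by
  rw [crossPairs, Finset.card_filter, Finset.sum_product]
  exact Finset.sum_congr rfl fun A _ => (Finset.card_filter _ _).symm

theorem crossPairs_union_right (t : ℕ) (𝒜 : Finset (Finset ℕ)) {ℬ ℬ' : Finset (Finset ℕ)}
    (h : Disjoint ℬ ℬ') : crossPairs t 𝒜 (ℬ ∪ ℬ') = crossPairs t 𝒜 ℬ + crossPairs t 𝒜 ℬ' := by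
  rw [crossPairs_eq_sum, crossPairs_eq_sum, crossPairs_eq_sum, ← Finset.sum_add_distrib]
  refine Finset.sum_congr rfl fun A _ => ?_
  rw [Finset.filter_union, Finset.card_union_of_disjoint (Finset.disjoint_filter_filter h)]

theorem crossPairs_comm (t : ℕ) (𝒜 ℬ : Finset (Finset ℕ)) :
    crossPairs t 𝒜 ℬ = crossPairs t ℬ 𝒜 := by
  refine Finset.card_bij' (fun p _ => p.swap) (fun p _ => p.swap) ?_ ?_ ?_ ?_ <;>
    simp +contextual [Finset.inter_comm]

theorem crossPairs_union_self (t : ℕ) {𝒜 ℬ : Finset (Finset ℕ)} (h : Disjoint 𝒜 ℬ) :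
    crossPairs t (𝒜 ∪ ℬ) (𝒜 ∪ ℬ)
      = crossPairs t 𝒜 𝒜 + 2 * crossPairs t 𝒜 ℬ + crossPairs t ℬ ℬ := by
  rw [crossPairs_union_right _ _ h, crossPairs_comm t _ 𝒜, crossPairs_comm t _ ℬ,
    crossPairs_union_right _ _ h, crossPairs_union_right _ _ h, crossPairs_comm t ℬ 𝒜]
  ring

theorem card_filter_inter_eq {V A T Z : Finset ℕ} {k : ℕ} (hA : A ⊆ V) (hT : T ⊆ V) (hZA : Z ⊆ A)
    (hZ : A ∩ T ⊆ Z) (hk : (T ∪ Z).card ≤ k) :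
    (((V.powersetCard k).filter fun S => T ⊆ S).filter fun S => A ∩ S = Z).card
      = (V \ (A ∪ T)).card.choose (k - (T ∪ Z).card) := by
  rw [← Finset.card_powersetCard]
  have key : ∀ S, T ⊆ S → A ∩ S = Z → S = (T ∪ Z) ∪ S \ (A ∪ T) := by
    intro S hS hSZ
    subst hSZ
    ext x
    simp only [Finset.mem_union, Finset.mem_sdiff, Finset.mem_inter]
    have := @hS x
    tauto
  have hdisj : ∀ Y, Y ⊆ V \ (A ∪ T) → Disjoint (T ∪ Z) Y := by
    intro Y hY
    rw [Finset.disjoint_left]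
    intro x hx hxY
    have h1 := Finset.mem_sdiff.1 (hY hxY)
    refine h1.2 (Finset.mem_union.2 ?_)
    rcases Finset.mem_union.1 hx with h | h
    · exact Or.inr h
    · exact Or.inl (hZA h)
  refine Finset.card_bij' (fun S _ => S \ (A ∪ T)) (fun Y _ => (T ∪ Z) ∪ Y) ?_ ?_ ?_ ?_
  · intro S hS
    simp only [Finset.mem_filter, Finset.mem_powersetCard] at hS ⊢
    obtain ⟨⟨⟨hSV, hSk⟩, hTS⟩, hSZ⟩ := hS
    have hsub : S \ (A ∪ T) ⊆ V \ (A ∪ T) := Finset.sdiff_subset_sdiff hSV le_rfl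
    refine ⟨hsub, ?_⟩
    have h1 := congrArg Finset.card (key S hTS hSZ)
    rw [Finset.card_union_of_disjoint (hdisj _ hsub)] at h1
    omega
  · intro Y hY
    simp only [Finset.mem_filter, Finset.mem_powersetCard] at hY ⊢
    obtain ⟨hYV, hYk⟩ := hY
    refine ⟨⟨⟨?_, ?_⟩, ?_⟩, ?_⟩
    · exact Finset.union_subset (Finset.union_subset hT (hZA.trans hA))
        (hYV.trans Finset.sdiff_subset)
    · rw [Finset.card_union_of_disjoint (hdisj _ hYV)]
      omega
    · exact Finset.subset_union_left.trans Finset.subset_union_left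
    · ext x
      simp only [Finset.mem_union, Finset.mem_inter]
      have h1 := @hYV x
      have h2 := @hZ x
      have h3 := @hZA x
      simp only [Finset.mem_sdiff, Finset.mem_union, Finset.mem_inter] at h1 h2
      tauto
  · intro S hS
    simp only [Finset.mem_filter, Finset.mem_powersetCard] at hS
    exact (key S hS.1.2 hS.2).symm
  · intro Y hY
    simp only [Finset.mem_powersetCard] at hY
    ext x
    simp only [Finset.mem_union, Finset.mem_sdiff]
    have h1 := @hY.1 x
    have h3 := @hZA x
    simp only [Finset.mem_sdiff, Finset.mem_union] at h1
    tauto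

theorem card_filter_card_inter_eq_of_disjoint {n t a : ℕ} {A T : Finset ℕ}
    (hA : A ∈ (Finset.Icc 1 n).powersetCard (2 * t + 1 + a)) (hT : T ⊆ Finset.Icc 1 n)
    (hTc : T.card = t + 1) (hAT : Disjoint A T) :
    ((((Finset.Icc 1 n).powersetCard (2 * t + 1 + a)).filter fun S => T ⊆ S).filter
        fun S => (A ∩ S).card = t).card
      = (2 * t + 1 + a).choose t * (n - (2 * t + 1 + a + t + 1)).choose a := by
  rw [Finset.mem_powersetCard] at hA
  rw [Finset.card_eq_sum_card_fiberwise (f := fun S => A ∩ S) (t := A.powersetCard t),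
    Finset.sum_const_nat (m := (n - (2 * t + 1 + a + t + 1)).choose a),
    Finset.card_powersetCard, hA.2]
  · intro Z hZ
    rw [Finset.mem_powersetCard] at hZ
    have hTZ : (T ∪ Z).card = 2 * t + 1 := by
      rw [Finset.card_union_of_disjoint (hAT.symm.mono_right hZ.1), hTc, hZ.2]
      omega
    have h1 := card_filter_inter_eq (k := 2 * t + 1 + a) hA.1 hT hZ.1
      (by rw [Finset.disjoint_iff_inter_eq_empty.1 hAT]; exact Finset.empty_subset _) (by omega)
    rw [hTZ, Finset.card_sdiff_of_subset (Finset.union_subset hA.1 hT),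
      Finset.card_union_of_disjoint hAT, hA.2, hTc, Nat.card_Icc] at h1
    rw [Finset.filter_filter, Finset.filter_congr (q := fun S => A ∩ S = Z), h1]
    · congr 1
      omega
    · intro S _
      constructor
      · exact fun h => h.2
      · rintro h
        exact ⟨by rw [h, hZ.2], h⟩
  · intro S hS
    have := (Finset.mem_filter.1 hS).2
    exact Finset.mem_coe.2 (Finset.mem_powersetCard.2 ⟨Finset.inter_subset_left, this⟩)

theorem choose_le_card_filter_inter_eq {n t a i : ℕ} {A T Z : Finset ℕ}
    (hA : A ∈ (Finset.Icc 1 n).powersetCard (2 * t + 1 + a)) (hT : T ⊆ Finset.Icc 1 n)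
    (hTc : T.card = t + 1) (hi : (A ∩ T).card = i) (hZA : Z ⊆ A) (hZ : A ∩ T ⊆ Z)
    (hZc : Z.card = t) :
    (n - (2 * t + 1 + a + t + 1)).choose (a + i)
      ≤ ((((Finset.Icc 1 n).powersetCard (2 * t + 1 + a)).filter fun S => T ⊆ S).filter
        fun S => A ∩ S = Z).card := by
  rw [Finset.mem_powersetCard] at hA
  have hTZi : T ∩ Z = A ∩ T := by
    ext x
    have h2 := @hZ x
    have h3 := @hZA x
    simp only [Finset.mem_inter] at h2 ⊢
    tauto
  have hTZ := Finset.card_union_add_card_inter T Z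
  rw [hTZi, hi] at hTZ
  have hAT := Finset.card_union_add_card_inter A T
  rw [hi] at hAT
  rw [card_filter_inter_eq hA.1 hT hZA hZ (by omega),
    Finset.card_sdiff_of_subset (Finset.union_subset hA.1 hT), Nat.card_Icc]
  have hit : i ≤ t := by
    rw [← hi, ← hZc]
    exact Finset.card_le_card hZ
  have : 2 * t + 1 + a - (T ∪ Z).card = a + i := by omega
  rw [this]
  exact Nat.choose_le_choose _ (by omega)

theorem mul_choose_le_card_filter_card_inter_eq {n t a B : ℕ} {A T : Finset ℕ}
    (hB : ∀ j ≤ 2 * t + 1 + a, n ^ j ≤ B * (n - (2 * t + 1 + a + t + 1)).choose j)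
    (hn : B * (2 * t + 1 + a).choose t ≤ n)
    (hA : A ∈ (Finset.Icc 1 n).powersetCard (2 * t + 1 + a)) (hT : T ⊆ Finset.Icc 1 n)
    (hTc : T.card = t + 1) (hAT : ¬ T ⊆ A) :
    (2 * t + 1 + a).choose t * (n - (2 * t + 1 + a + t + 1)).choose a
      ≤ ((((Finset.Icc 1 n).powersetCard (2 * t + 1 + a)).filter fun S => T ⊆ S).filter
        fun S => (A ∩ S).card = t).card := by
  by_cases hd : Disjoint A T
  · exact (card_filter_card_inter_eq_of_disjoint hA hT hTc hd).ge
  have hi1 : 1 ≤ (A ∩ T).card := by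
    rw [Nat.one_le_iff_ne_zero, Ne, Finset.card_eq_zero, ← Finset.disjoint_iff_inter_eq_empty]
    exact hd
  have hit : (A ∩ T).card ≤ t := by
    by_contra hcon
    refine hAT ?_
    have : A ∩ T = T := Finset.eq_of_subset_of_card_le Finset.inter_subset_right (by omega)
    exact Finset.inter_eq_right.1 this
  obtain ⟨Z, hZ1, hZ2, hZ3⟩ := Finset.exists_subsuperset_card_eq
    (Finset.inter_subset_left (s₁ := A) (s₂ := T)) hit
    (by rw [(Finset.mem_powersetCard.1 hA).2]; omega)
  refine le_trans ?_ ((choose_le_card_filter_inter_eq hA hT hTc rfl hZ2 hZ1 hZ3).trans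
    (Finset.card_le_card (Finset.monotone_filter_right _ fun S _ hS => ?_)))
  · have hB0 : 0 < B := by
      have := hB 0 (by omega)
      simp at this
      omega
    have h1 := hB (a + (A ∩ T).card) (by omega)
    have h2 : (n - (2 * t + 1 + a + t + 1)).choose a ≤ n ^ a :=
      (Nat.choose_le_pow _ _).trans (Nat.pow_le_pow_left (by omega) _)
    have h3 : B * ((2 * t + 1 + a).choose t * (n - (2 * t + 1 + a + t + 1)).choose a)
        ≤ B * (n - (2 * t + 1 + a + t + 1)).choose (a + (A ∩ T).card) := by
      refine le_trans ?_ h1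
      calc B * ((2 * t + 1 + a).choose t * (n - (2 * t + 1 + a + t + 1)).choose a)
          = B * (2 * t + 1 + a).choose t * (n - (2 * t + 1 + a + t + 1)).choose a := by ring
        _ ≤ n * n ^ a := Nat.mul_le_mul hn h2
        _ = n ^ (a + 1) := by ring
        _ ≤ n ^ (a + (A ∩ T).card) := by
            rcases Nat.eq_zero_or_pos n with h0 | h0
            · subst h0
              simp
            · exact Nat.pow_le_pow_right h0 (by omega)
    exact Nat.le_of_mul_le_mul_left h3 hB0
  · rw [hS, hZ3]

theorem card_filter_le_card_inter_le {n t i : ℕ} (hi : i ≤ t) (𝒯 : Finset (Finset ℕ))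
    (h𝒯 : 𝒯 ⊆ (Finset.Icc 1 n).powersetCard t) (S : Finset ℕ) :
    (𝒯.filter fun T => t - i ≤ (S ∩ T).card).card ≤ 2 ^ S.card * n ^ i := by
  have hsub : (𝒯.filter fun T => t - i ≤ (S ∩ T).card)
      ⊆ (S.powersetCard (t - i)).biUnion fun X => 𝒯.filter fun T => X ⊆ T := by
    intro T hT
    rw [Finset.mem_filter] at hT
    obtain ⟨X, hX, hXc⟩ := Finset.exists_subset_card_eq hT.2
    rw [Finset.mem_biUnion]
    exact ⟨X, Finset.mem_powersetCard.2 ⟨hX.trans Finset.inter_subset_left, hXc⟩,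
      Finset.mem_filter.2 ⟨hT.1, hX.trans Finset.inter_subset_right⟩⟩
  refine (Finset.card_le_card hsub).trans ((Finset.card_biUnion_le_card_mul _ _ (n ^ i) ?_).trans ?_)
  · intro X hX
    have h1 := card_filter_superset_le 𝒯 h𝒯 X
    rw [(Finset.mem_powersetCard.1 hX).2, Nat.sub_sub_self hi] at h1
    exact h1
  · refine Nat.mul_le_mul_right _ ?_
    rw [Finset.card_powersetCard]
    exact Nat.choose_le_two_pow _ _

/-- If every member of `𝒢` is adjacent to few members of `𝒫`, then the shadow of `𝒢` is controlled
by the number of missing members `ℳ` of the full star. -/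
theorem card_tShadow_mul_pow_le {n t a B : ℕ} {T₀ : Finset ℕ} (hn : 0 < n)
    (hB : ∀ j ≤ 2 * t + 1 + a, n ^ j ≤ B * (n - (2 * t + 1 + a + t + 1)).choose j)
    (hT : T₀ ⊆ Finset.Icc 1 n) (hTc : T₀.card = t + 1) (𝒢 𝒬 ℳ : Finset (Finset ℕ))
    (h𝒢 : 𝒢 ⊆ (Finset.Icc 1 n).powersetCard (2 * t + 1 + a)) (h𝒢T : ∀ A ∈ 𝒢, ¬ T₀ ⊆ A)
    (hℳ : ℳ ⊆ (Finset.Icc 1 n).powersetCard (2 * t + 1 + a))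
    (hstar : (((Finset.Icc 1 n).powersetCard (2 * t + 1 + a)).filter fun S => T₀ ⊆ S) ⊆ 𝒬 ∪ ℳ)
    (hdeg : ∀ A ∈ 𝒢, 2 * B * (𝒬.filter fun S => (A ∩ S).card = t).card ≤ n ^ a) :
    (tShadow t 𝒢).card * n ^ a ≤ (t + 1) * (2 * B * 2 ^ (2 * t + 1 + a)) * ℳ.card := by
  classical
  set 𝒯 : ℕ → Finset (Finset ℕ) := fun i =>
    (tShadow t 𝒢).filter fun T => ∃ A ∈ 𝒢, T ⊆ A ∧ (A ∩ T₀).card = i with h𝒯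
  have hshadow : tShadow t 𝒢 ⊆ (Finset.Icc 1 n).powersetCard t := by
    intro T hTs
    obtain ⟨A, hA, hTA, hc⟩ := mem_tShadow.1 hTs
    exact Finset.mem_powersetCard.2
      ⟨hTA.trans (Finset.mem_powersetCard.1 (h𝒢 hA)).1, hc⟩
  have hsmall : ∀ A ∈ 𝒢, (A ∩ T₀).card ≤ t := by
    intro A hA
    by_contra hcon
    refine h𝒢T A hA ?_
    have : A ∩ T₀ = T₀ := Finset.eq_of_subset_of_card_le Finset.inter_subset_right (by omega)
    exact Finset.inter_eq_right.1 this
  have hcover : tShadow t 𝒢 ⊆ (Finset.range (t + 1)).biUnion 𝒯 := by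
    intro T hTs
    obtain ⟨A, hA, hTA, hc⟩ := mem_tShadow.1 hTs
    refine Finset.mem_biUnion.2 ⟨(A ∩ T₀).card, ?_, Finset.mem_filter.2 ⟨hTs, A, hA, hTA, rfl⟩⟩
    have := hsmall A hA
    exact Finset.mem_range.2 (by omega)
  have hlow : ∀ i, ∀ T ∈ 𝒯 i,
      n ^ (a + i) ≤ 2 * B * (ℳ.filter fun S => t - i ≤ (S ∩ T).card).card := by
    intro i T hTi
    obtain ⟨hTs, A, hA, hTA, hAi⟩ := Finset.mem_filter.1 hTi
    have hTc' : T.card = t := (Finset.mem_powersetCard.1 (hshadow hTs)).2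
    have hit : i ≤ t := hAi ▸ hsmall A hA
    have hlarge : t ≤ ((A ∩ T₀) ∪ T).card := by
      rw [← hTc']
      exact Finset.card_le_card Finset.subset_union_right
    obtain ⟨Z, hZ1, hZ2, hZ3⟩ := Finset.exists_subsuperset_card_eq
      (Finset.subset_union_left (s₁ := A ∩ T₀) (s₂ := T)) (by omega) hlarge
    have hZA : Z ⊆ A := hZ2.trans (Finset.union_subset Finset.inter_subset_left hTA)
    have hfib := choose_le_card_filter_inter_eq (h𝒢 hA) hT hTc hAi hZA hZ1 hZ3
    have hZT : t - i ≤ (Z ∩ T).card := by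
      have h1 : Z ⊆ (A ∩ T₀) ∪ (Z ∩ T) := by
        intro x hx
        have := hZ2 hx
        simp only [Finset.mem_union, Finset.mem_inter] at this ⊢
        tauto
      have h2 := (Finset.card_le_card h1).trans (Finset.card_union_le _ _)
      omega
    have hsub : ((((Finset.Icc 1 n).powersetCard (2 * t + 1 + a)).filter fun S => T₀ ⊆ S).filter
        fun S => A ∩ S = Z) ⊆ (𝒬.filter fun S => (A ∩ S).card = t)
          ∪ ℳ.filter fun S => t - i ≤ (S ∩ T).card := by
      intro S hS
      rw [Finset.mem_filter] at hS
      rcases Finset.mem_union.1 (hstar hS.1) with h | h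
      · exact Finset.mem_union_left _ (Finset.mem_filter.2 ⟨h, by rw [hS.2, hZ3]⟩)
      · refine Finset.mem_union_right _ (Finset.mem_filter.2 ⟨h, hZT.trans ?_⟩)
        refine Finset.card_le_card (Finset.inter_subset_inter_right ?_)
        rw [← hS.2]
        exact Finset.inter_subset_right
    have hcard := hfib.trans ((Finset.card_le_card hsub).trans (Finset.card_union_le _ _))
    have h1 := hB (a + i) (by omega)
    have h2 := hdeg A hA
    have h3 : n ^ a ≤ n ^ (a + i) := Nat.pow_le_pow_right hn (by omega)
    have h4 := Nat.mul_le_mul_left (2 * B) hcard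
    rw [mul_add] at h4
    have h5 : 2 * n ^ (a + i) ≤ 2 * B * (n - (2 * t + 1 + a + t + 1)).choose (a + i) := by
      rw [mul_assoc]
      exact Nat.mul_le_mul_left 2 h1
    omega
  have hlevel : ∀ i ∈ Finset.range (t + 1),
      (𝒯 i).card * n ^ a ≤ 2 * B * 2 ^ (2 * t + 1 + a) * ℳ.card := by
    intro i hi
    have hi' : i ≤ t := by
      rw [Finset.mem_range] at hi
      omega
    have hdouble : ∑ T ∈ 𝒯 i, (ℳ.filter fun S => t - i ≤ (S ∩ T).card).card
        = ∑ S ∈ ℳ, ((𝒯 i).filter fun T => t - i ≤ (S ∩ T).card).card :=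
      Finset.sum_card_bipartiteAbove_eq_sum_card_bipartiteBelow
        (fun T S : Finset ℕ => t - i ≤ (S ∩ T).card)
    have h1 : (𝒯 i).card * n ^ (a + i)
        ≤ 2 * B * ∑ T ∈ 𝒯 i, (ℳ.filter fun S => t - i ≤ (S ∩ T).card).card := by
      rw [Finset.mul_sum, ← smul_eq_mul]
      exact Finset.card_nsmul_le_sum _ _ _ (hlow i)
    have h2 : ∑ S ∈ ℳ, ((𝒯 i).filter fun T => t - i ≤ (S ∩ T).card).card
        ≤ ℳ.card * (2 ^ (2 * t + 1 + a) * n ^ i) := by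
      rw [← smul_eq_mul]
      refine Finset.sum_le_card_nsmul _ _ _ fun S hS => ?_
      have := card_filter_le_card_inter_le hi' (𝒯 i) ((Finset.filter_subset _ _).trans hshadow) S
      rwa [(Finset.mem_powersetCard.1 (hℳ hS)).2] at this
    rw [hdouble] at h1
    have h3 := h1.trans (Nat.mul_le_mul_left (2 * B) h2)
    refine Nat.le_of_mul_le_mul_right (c := n ^ i) ?_ (pow_pos hn i)
    calc (𝒯 i).card * n ^ a * n ^ i = (𝒯 i).card * n ^ (a + i) := by rw [pow_add, mul_assoc]
      _ ≤ _ := h3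
      _ = _ := by ring
  calc (tShadow t 𝒢).card * n ^ a ≤ (∑ i ∈ Finset.range (t + 1), (𝒯 i).card) * n ^ a :=
        Nat.mul_le_mul_right _ ((Finset.card_le_card hcover).trans Finset.card_biUnion_le)
    _ = ∑ i ∈ Finset.range (t + 1), (𝒯 i).card * n ^ a := Finset.sum_mul _ _ _
    _ ≤ (Finset.range (t + 1)).card • (2 * B * 2 ^ (2 * t + 1 + a) * ℳ.card) :=
        Finset.sum_le_card_nsmul _ _ _ hlevel
    _ = _ := by
        rw [Finset.card_range, smul_eq_mul]
        ring

/-- The members of `powersetCard k [n]` containing `T`. -/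
def starFamily (n k : ℕ) (T : Finset ℕ) : Finset (Finset ℕ) :=
  ((Finset.Icc 1 n).powersetCard k).filter fun S => T ⊆ S

theorem card_starFamily {n k : ℕ} {T : Finset ℕ} (hT : T ⊆ Finset.Icc 1 n) (hk : T.card ≤ k) :
    (starFamily n k T).card = (n - T.card).choose (k - T.card) := by
  have h := card_filter_inter_eq (V := Finset.Icc 1 n) (A := ∅) (Z := ∅) (k := k)
    (Finset.empty_subset _) hT le_rfl (by simp) (by simpa using hk)
  simpa [starFamily, Finset.card_sdiff_of_subset hT] using h

theorem two_mul_crossPairs_filter_le (t : ℕ) (T : Finset ℕ) (𝓕 : Finset (Finset ℕ)) :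
    2 * crossPairs t (𝓕.filter fun F => ¬ T ⊆ F) (𝓕.filter fun F => T ⊆ F)
      ≤ crossPairs t 𝓕 𝓕 := by
  have h := crossPairs_union_self t
    (Finset.disjoint_filter_filter_not 𝓕 𝓕 (fun F => T ⊆ F))
  rw [Finset.filter_union_filter_not_eq] at h
  rw [h, crossPairs_comm]
  omega

theorem card_filter_not_superset_eq {n k r : ℕ} {T : Finset ℕ} {𝓕 : Finset (Finset ℕ)}
    (h𝓕 : 𝓕 ⊆ (Finset.Icc 1 n).powersetCard k) (hcard : 𝓕.card = (starFamily n k T).card + r) :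
    (𝓕.filter fun F => ¬ T ⊆ F).card
      = r + (starFamily n k T \ 𝓕.filter fun F => T ⊆ F).card := by
  have h1 := Finset.card_filter_add_card_filter_not (s := 𝓕) (fun F => T ⊆ F)
  have hsub : (𝓕.filter fun F => T ⊆ F) ⊆ starFamily n k T := Finset.filter_subset_filter _ h𝓕
  have h2 := Finset.card_sdiff_add_card_eq_card hsub
  omega

theorem card_mul_le_crossPairs_add {n t a B : ℕ} {T : Finset ℕ}
    (hB : ∀ j ≤ 2 * t + 1 + a, n ^ j ≤ B * (n - (2 * t + 1 + a + t + 1)).choose j)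
    (hn : B * (2 * t + 1 + a).choose t ≤ n) (hT : T ⊆ Finset.Icc 1 n) (hTc : T.card = t + 1)
    {𝒢 𝒬 : Finset (Finset ℕ)} (h𝒢 : 𝒢 ⊆ (Finset.Icc 1 n).powersetCard (2 * t + 1 + a))
    (h𝒢T : ∀ A ∈ 𝒢, ¬ T ⊆ A) (h𝒬 : 𝒬 ⊆ starFamily n (2 * t + 1 + a) T) :
    𝒢.card * ((2 * t + 1 + a).choose t * (n - (2 * t + 1 + a + t + 1)).choose a)
      ≤ crossPairs t 𝒢 𝒬 + 𝒢.card * (starFamily n (2 * t + 1 + a) T \ 𝒬).card := by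
  have h1 : 𝒢.card * ((2 * t + 1 + a).choose t * (n - (2 * t + 1 + a + t + 1)).choose a)
      ≤ crossPairs t 𝒢 (starFamily n (2 * t + 1 + a) T) := by
    rw [crossPairs_eq_sum, ← smul_eq_mul]
    exact Finset.card_nsmul_le_sum _ _ _ fun A hA =>
      mul_choose_le_card_filter_card_inter_eq hB hn (h𝒢 hA) hT hTc (h𝒢T A hA)
  refine h1.trans ?_
  conv_lhs => rw [← Finset.union_sdiff_of_subset h𝒬]
  rw [crossPairs_union_right _ _ Finset.disjoint_sdiff]
  refine Nat.add_le_add_left ?_ _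
  rw [crossPairs, ← Finset.card_product]
  exact Finset.card_filter_le _ _

theorem card_filter_lt_mul_le_crossPairs {t b c : ℕ} (𝒢 𝒬 : Finset (Finset ℕ)) :
    (𝒢.filter fun A => ¬ b * (𝒬.filter fun S => (A ∩ S).card = t).card ≤ c).card * c
      ≤ b * crossPairs t 𝒢 𝒬 := by
  rw [crossPairs_eq_sum, Finset.mul_sum, ← smul_eq_mul]
  refine (Finset.card_nsmul_le_sum _ _ _ fun A hA => ?_).trans
    (Finset.sum_le_sum_of_subset (Finset.filter_subset _ _))
  exact (not_le.1 (Finset.mem_filter.1 hA).2).le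

theorem exists_lt_choose_of_mul_le (t s : ℕ) (hs : 0 < s) :
    ∃ b : ℕ, 0 < b ∧ ∃ n₀ : ℕ, ∀ n ≥ n₀, ∀ x : ℕ, b * x ≤ n ^ t →
      x < (n / s).choose t := by
  obtain ⟨B, hB, n₁, hn₁⟩ := exists_pow_le_mul_choose_sub 0 t
  refine ⟨2 * B * (2 * s) ^ t, by positivity, s * (n₁ + t + 1), fun n hn x hx => ?_⟩
  have hy : n₁ + t + 1 ≤ n / s := by
    rw [Nat.le_div_iff_mul_le hs, mul_comm]
    exact hn
  have h1 := hn₁ (n / s) (by omega) t le_rfl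
  have h2 : n ≤ 2 * s * (n / s) := by
    have h3 := Nat.div_add_mod n s
    have h4 := Nat.mod_lt n hs
    have h5 : s * 1 ≤ s * (n / s) := Nat.mul_le_mul_left _ (by omega)
    nlinarith
  have h3 : n ^ t ≤ (2 * s) ^ t * (B * (n / s).choose t) := by
    calc n ^ t ≤ (2 * s * (n / s)) ^ t := Nat.pow_le_pow_left h2 _
      _ = (2 * s) ^ t * (n / s) ^ t := mul_pow _ _ _
      _ ≤ _ := Nat.mul_le_mul_left _ (by simpa using h1)
  have h4 : (B * (2 * s) ^ t) * (2 * x) ≤ (B * (2 * s) ^ t) * (n / s).choose t := by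
    calc (B * (2 * s) ^ t) * (2 * x) = 2 * B * (2 * s) ^ t * x := by ring
      _ ≤ _ := hx.trans h3
      _ = _ := by ring
  have h5 := Nat.le_of_mul_le_mul_left h4 (by positivity)
  have h6 : 0 < (n / s).choose t := Nat.choose_pos (by omega)
  omega

theorem le_crossPairs_self_of_card_eq (t a : ℕ) (ht : 1 ≤ t) (ha : 2 ≤ a) :
    ∃ N n₀ : ℕ, ∀ n ≥ n₀, ∀ r : ℕ, N * r ≤ n ^ a → ∀ 𝓕 : Finset (Finset ℕ),
      𝓕 ⊆ (Finset.Icc 1 n).powersetCard (2 * t + 1 + a) →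
      𝓕.card = (n - (t + 1)).choose (t + a) + r →
      2 * (r * ((2 * t + 1 + a).choose t * (n - (2 * t + 1 + a + t + 1)).choose a))
        ≤ crossPairs t 𝓕 𝓕 := by
  classical
  obtain ⟨B, hB0, n₁, hB⟩ := exists_pow_le_mul_choose_sub (2 * t + 1 + a + t + 1) (2 * t + 1 + a)
  obtain ⟨C, hC⟩ := card_le_of_card_tShadow_lt t a ht ha
  set K : ℕ := (2 * t + 1 + a).choose t with hK
  have hK0 : 0 < K := Nat.choose_pos (by omega)
  set C₁ : ℕ := (t + 1) * (2 * B * 2 ^ (2 * t + 1 + a)) with hC₁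
  have hC₁0 : 0 < C₁ := by positivity
  set s : ℕ := 8 * C * C₁ + 1 with hs
  obtain ⟨b, hb0, n₂, hb⟩ := exists_lt_choose_of_mul_le t s (by omega)
  obtain ⟨δ, hδ, n₃, hdom⟩ := exists_dominant_core t a ht ha
    (ε := 1 / (b * C₁ : ℝ)) (by positivity)
  obtain ⟨N₀, hN₀⟩ := exists_nat_ge (2 * K / δ)
  refine ⟨N₀ + 8 * B ^ 2 * K + 32 * C₁ * K * B, n₁ + n₂ + n₃ + B * K + s + 1, ?_⟩
  intro n hn r hr 𝓕 h𝓕 hcard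
  have hn0 : 0 < n := by omega
  have hna : 0 < n ^ a := pow_pos hn0 a
  have hBn := hB n (by omega)
  set c : ℕ := (n - (2 * t + 1 + a + t + 1)).choose a with hc
  have hcn : c ≤ n ^ a := (Nat.choose_le_pow _ _).trans (Nat.pow_le_pow_left (by omega) _)
  have hcB : n ^ a ≤ B * c := hBn a (by omega)
  by_contra hcon
  rw [not_le] at hcon
  have hE : crossPairs t 𝓕 𝓕 ≤ 2 * K * r * n ^ a := by
    calc crossPairs t 𝓕 𝓕 ≤ 2 * (r * (K * c)) := hcon.le
      _ = 2 * K * r * c := by ring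
      _ ≤ _ := Nat.mul_le_mul_left _ hcn
  have hEδ : (crossPairs t 𝓕 𝓕 : ℝ) ≤ δ * (n : ℝ) ^ (2 * a) := by
    have h1 : N₀ * r ≤ n ^ a := le_trans (Nat.mul_le_mul_right _ (by omega)) hr
    have h2 : (N₀ : ℝ) * r ≤ (n : ℝ) ^ a := by exact_mod_cast h1
    have h3 : (crossPairs t 𝓕 𝓕 : ℝ) ≤ 2 * K * r * (n : ℝ) ^ a := by exact_mod_cast hE
    rw [div_le_iff₀ hδ] at hN₀
    calc (crossPairs t 𝓕 𝓕 : ℝ) ≤ 2 * K * (r * (n : ℝ) ^ a) := by linarith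
      _ ≤ N₀ * δ * (r * (n : ℝ) ^ a) := mul_le_mul_of_nonneg_right hN₀ (by positivity)
      _ = δ * (N₀ * r * (n : ℝ) ^ a) := by ring
      _ ≤ δ * ((n : ℝ) ^ a * (n : ℝ) ^ a) := by gcongr
      _ = _ := by rw [two_mul, pow_add]
  obtain ⟨T, hT, hTc, hfar⟩ := hdom n (by omega) 𝓕 h𝓕 (by omega) hEδ
  have hstar : (starFamily n (2 * t + 1 + a) T).card = (n - (t + 1)).choose (t + a) := by
    rw [card_starFamily hT (by omega), hTc]
    congr 1
    omega
  have hG := card_filter_not_superset_eq (T := T) h𝓕 (by rw [hstar, hcard])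
  have hEG := two_mul_crossPairs_filter_le t T 𝓕
  set 𝒢 := 𝓕.filter fun F => ¬ T ⊆ F with h𝒢
  set 𝒬 := 𝓕.filter fun F => T ⊆ F with h𝒬
  set ℳ := starFamily n (2 * t + 1 + a) T \ 𝒬 with hℳ
  have h𝒢V : 𝒢 ⊆ (Finset.Icc 1 n).powersetCard (2 * t + 1 + a) :=
    (Finset.filter_subset _ _).trans h𝓕
  have h𝒢T : ∀ A ∈ 𝒢, ¬ T ⊆ A := fun A hA => (Finset.mem_filter.1 hA).2
  have h𝒬s : 𝒬 ⊆ starFamily n (2 * t + 1 + a) T := Finset.filter_subset_filter _ h𝓕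
  have hmain := card_mul_le_crossPairs_add hBn (by rw [← hK]; omega) hT hTc h𝒢V h𝒢T h𝒬s
  rw [← hK, ← hc, ← hℳ] at hmain
  have hcross : crossPairs t 𝒢 𝒬 < r * (K * c) := by omega
  have hbig : K * c < 𝒢.card := by
    by_contra hle
    rw [not_lt] at hle
    have h1 := Nat.mul_le_mul_right ℳ.card hle
    have h2 : 𝒢.card * (K * c) = r * (K * c) + ℳ.card * (K * c) := by rw [hG]; ring
    have h3 : K * c * ℳ.card = ℳ.card * (K * c) := by ring
    omega
  have hnG : n ^ a ≤ B * 𝒢.card := by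
    refine hcB.trans (Nat.mul_le_mul_left _ ((Nat.le_mul_of_pos_left c hK0).trans hbig.le))
  set 𝒢' := 𝒢.filter fun A => 2 * B * (𝒬.filter fun S => (A ∩ S).card = t).card ≤ n ^ a with h𝒢'
  have h𝒢'𝒢 : 𝒢' ⊆ 𝒢 := Finset.filter_subset _ _
  have hsplit := Finset.card_filter_add_card_filter_not (s := 𝒢)
    (fun A => 2 * B * (𝒬.filter fun S => (A ∩ S).card = t).card ≤ n ^ a)
  have hexc := card_filter_lt_mul_le_crossPairs (t := t) (b := 2 * B) (c := n ^ a) 𝒢 𝒬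
  rw [← h𝒢'] at hsplit
  set 𝒰 := 𝒢.filter fun A => ¬ 2 * B * (𝒬.filter fun S => (A ∩ S).card = t).card ≤ n ^ a
    with h𝒰
  have hrG1 : 8 * B * K * r ≤ 𝒢.card := by
    refine Nat.le_of_mul_le_mul_left (c := B) ?_ hB0
    calc B * (8 * B * K * r) = 8 * B ^ 2 * K * r := by ring
      _ ≤ (N₀ + 8 * B ^ 2 * K + 32 * C₁ * K * B) * r := Nat.mul_le_mul_right _ (by omega)
      _ ≤ _ := hr.trans hnG
  have hrG2 : 32 * C₁ * K * r ≤ 𝒢.card := by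
    refine Nat.le_of_mul_le_mul_left (c := B) ?_ hB0
    calc B * (32 * C₁ * K * r) = 32 * C₁ * K * B * r := by ring
      _ ≤ (N₀ + 8 * B ^ 2 * K + 32 * C₁ * K * B) * r := Nat.mul_le_mul_right _ (by omega)
      _ ≤ _ := hr.trans hnG
  have hU : 4 * 𝒰.card ≤ 𝒢.card := by
    have h1 : 𝒰.card ≤ 2 * B * K * r := by
      refine Nat.le_of_mul_le_mul_right (c := n ^ a) ?_ hna
      calc 𝒰.card * n ^ a ≤ 2 * B * crossPairs t 𝒢 𝒬 := hexc
        _ ≤ 2 * B * (r * (K * n ^ a)) := Nat.mul_le_mul_left _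
            (hcross.le.trans (Nat.mul_le_mul_left _ (Nat.mul_le_mul_left _ hcn)))
        _ = _ := by ring
    have h2 : 4 * (2 * B * K * r) = 8 * B * K * r := by ring
    omega
  have hshadow := card_tShadow_mul_pow_le hn0 hBn hT hTc 𝒢' 𝒬 ℳ (h𝒢'𝒢.trans h𝒢V)
    (fun A hA => h𝒢T A (h𝒢'𝒢 hA))
    (Finset.sdiff_subset.trans (Finset.filter_subset _ _))
    (by
      intro S hS
      by_cases hSQ : S ∈ 𝒬
      · exact Finset.mem_union_left _ hSQ
      · exact Finset.mem_union_right _ (Finset.mem_sdiff.2 ⟨hS, hSQ⟩))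
    (fun A hA => (Finset.mem_filter.1 hA).2)
  rw [← hC₁] at hshadow
  set x := (tShadow t 𝒢').card with hx
  have hxG : x * n ^ a ≤ C₁ * 𝒢.card :=
    hshadow.trans (Nat.mul_le_mul_left _ (by omega))
  have hbx : b * x ≤ n ^ t := by
    have h1 : (x : ℝ) * (n : ℝ) ^ a ≤ C₁ * 𝒢.card := by exact_mod_cast hxG
    have h2 : (b : ℝ) * x * (n : ℝ) ^ a ≤ (n : ℝ) ^ t * (n : ℝ) ^ a := by
      calc (b : ℝ) * x * (n : ℝ) ^ a = b * (x * (n : ℝ) ^ a) := by ring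
        _ ≤ b * (C₁ * (1 / (b * C₁ : ℝ) * (n : ℝ) ^ (t + a))) := by
            refine mul_le_mul_of_nonneg_left (h1.trans ?_) (by positivity)
            exact mul_le_mul_of_nonneg_left hfar (by positivity)
        _ = (n : ℝ) ^ t * (n : ℝ) ^ a := by
            rw [pow_add]
            field_simp
    have h3 : b * x * n ^ a ≤ n ^ t * n ^ a := by exact_mod_cast h2
    exact Nat.le_of_mul_le_mul_right h3 hna
  obtain ⟨D, hD, hDcard⟩ := hC n 𝒢' (n / s) (h𝒢'𝒢.trans h𝒢V) (hb n (by omega) x hbx)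
  rw [← hx] at hD hDcard
  have hD4 : 4 * D ≤ 𝒢.card := by
    have h1 : crossPairs t 𝒢' 𝒢' ≤ 2 * K * r * n ^ a :=
      (crossPairs_mono (h𝒢'𝒢.trans (Finset.filter_subset _ _))
        (h𝒢'𝒢.trans (Finset.filter_subset _ _))).trans hE
    refine (Nat.pow_le_pow_iff_left (n := 2) (by norm_num)).1 ?_
    calc (4 * D) ^ 2 = 16 * D ^ 2 := by ring
      _ ≤ 16 * (x * (2 * K * r * n ^ a)) :=
          Nat.mul_le_mul_left _ (hD.trans (Nat.mul_le_mul_left _ h1))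
      _ = 32 * K * r * (x * n ^ a) := by ring
      _ ≤ 32 * K * r * (C₁ * 𝒢.card) := Nat.mul_le_mul_left _ hxG
      _ = 32 * C₁ * K * r * 𝒢.card := by ring
      _ ≤ 𝒢.card * 𝒢.card := Nat.mul_le_mul_right _ hrG2
      _ = _ := (sq _).symm
  have hs0 : 0 < s := by omega
  have hrest : 4 * (C * x * (n ^ (a - 1) + (n / s) ^ a)) ≤ 𝒢.card := by
    have h1 : s * n ^ (a - 1) ≤ n ^ a := by
      calc s * n ^ (a - 1) ≤ n * n ^ (a - 1) := Nat.mul_le_mul_right _ (by omega)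
        _ = n ^ a := by rw [← pow_succ', Nat.sub_add_cancel (by omega)]
    have h2 : s * (n / s) ^ a ≤ n ^ a := by
      calc s * (n / s) ^ a ≤ s ^ a * (n / s) ^ a :=
            Nat.mul_le_mul_right _ (Nat.le_self_pow (by omega) _)
        _ = (s * (n / s)) ^ a := (mul_pow _ _ _).symm
        _ ≤ n ^ a := Nat.pow_le_pow_left (Nat.mul_div_le n s) _
    refine Nat.le_of_mul_le_mul_left (c := s) ?_ hs0
    calc s * (4 * (C * x * (n ^ (a - 1) + (n / s) ^ a)))
        = 4 * C * x * (s * n ^ (a - 1) + s * (n / s) ^ a) := by ring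
      _ ≤ 4 * C * x * (n ^ a + n ^ a) := Nat.mul_le_mul_left _ (Nat.add_le_add h1 h2)
      _ = 8 * C * (x * n ^ a) := by ring
      _ ≤ 8 * C * (C₁ * 𝒢.card) := Nat.mul_le_mul_left _ hxG
      _ = 8 * C * C₁ * 𝒢.card := by ring
      _ ≤ s * 𝒢.card := Nat.mul_le_mul_right _ (by omega)
  omega

theorem two_mul_rhoPairs {t : ℕ} {𝓕 : Finset (Finset ℕ)} (h : ∀ F ∈ 𝓕, F.card ≠ t) :
    2 * rhoPairs t 𝓕 = crossPairs t 𝓕 𝓕 := by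
  rw [rhoPairs, crossPairs, Finset.card_eq_sum_card_fiberwise
    (f := fun p : Finset ℕ × Finset ℕ => ({p.1, p.2} : Finset (Finset ℕ)))
    (t := (𝓕.powersetCard 2).filter (fun P => ∃ A ∈ P, ∃ B ∈ P, A ≠ B ∧ (A ∩ B).card = t)),
    Finset.sum_const_nat (m := 2), mul_comm]
  · intro P hP
    rw [Finset.mem_filter, Finset.mem_powersetCard] at hP
    obtain ⟨⟨hPF, hP2⟩, A, hA, B, hB, hAB, hABt⟩ := hP
    have hPeq : P = {A, B} := by
      refine (Finset.eq_of_subset_of_card_le ?_ ?_).symm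
      · exact Finset.insert_subset hA (Finset.singleton_subset_iff.2 hB)
      · rw [hP2, Finset.card_pair hAB]
    have hfib : (((𝓕 ×ˢ 𝓕).filter fun p => (p.1 ∩ p.2).card = t).filter
        fun p => ({p.1, p.2} : Finset (Finset ℕ)) = P) = {(A, B), (B, A)} := by
      ext ⟨X, Y⟩
      simp only [Finset.mem_filter, Finset.mem_product, Finset.mem_insert, Finset.mem_singleton,
        Prod.mk.injEq]
      constructor
      · rintro ⟨⟨⟨hX, hY⟩, hXY⟩, hXYP⟩
        have hne : X ≠ Y := by
          rintro rfl
          rw [Finset.inter_self] at hXY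
          exact h X hX hXY
        have h1 : X ∈ ({A, B} : Finset (Finset ℕ)) := by
          rw [← hPeq, ← hXYP]
          simp
        have h2 : Y ∈ ({A, B} : Finset (Finset ℕ)) := by
          rw [← hPeq, ← hXYP]
          simp
        rw [Finset.mem_insert, Finset.mem_singleton] at h1 h2
        rcases h1 with h1 | h1 <;> rcases h2 with h2 | h2
        · exact absurd (h1.trans h2.symm) hne
        · exact Or.inl ⟨h1, h2⟩
        · exact Or.inr ⟨h1, h2⟩
        · exact absurd (h1.trans h2.symm) hne
      · rintro (⟨rfl, rfl⟩ | ⟨rfl, rfl⟩)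
        · exact ⟨⟨⟨hPF hA, hPF hB⟩, hABt⟩, hPeq.symm⟩
        · exact ⟨⟨⟨hPF hB, hPF hA⟩, by rwa [Finset.inter_comm]⟩,
            by rw [hPeq, Finset.pair_comm]⟩
    rw [hfib, Finset.card_pair]
    intro heq
    exact hAB (Prod.mk.inj heq).1
  · rintro ⟨X, Y⟩ hXY
    have hXY := Finset.mem_filter.1 (Finset.mem_coe.1 hXY)
    obtain ⟨hX, hY⟩ := Finset.mem_product.1 hXY.1
    have hne : X ≠ Y := by
      rintro rfl
      have := hXY.2
      rw [Finset.inter_self] at this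
      exact h X hX this
    refine Finset.mem_coe.2 (Finset.mem_filter.2 ⟨Finset.mem_powersetCard.2 ⟨?_, ?_⟩,
      X, ?_, Y, ?_, hne, hXY.2⟩)
    · exact Finset.insert_subset hX (Finset.singleton_subset_iff.2 hY)
    · exact Finset.card_pair hne
    · simp
    · simp

theorem crossPairs_self_eq_zero {t : ℕ} {U : Finset ℕ} (hU : t < U.card) {𝒜 : Finset (Finset ℕ)}
    (h : ∀ A ∈ 𝒜, U ⊆ A) : crossPairs t 𝒜 𝒜 = 0 := by
  rw [crossPairs, Finset.card_eq_zero, Finset.filter_eq_empty_iff]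
  rintro ⟨A, B⟩ hAB
  obtain ⟨hA, hB⟩ := Finset.mem_product.1 hAB
  have := Finset.card_le_card (Finset.subset_inter (h A hA) (h B hB))
  exact (hU.trans_le this).ne'

/-- A full star together with `r` sets that avoid its centre and share `t + 1` points. -/
theorem exists_family_crossPairs_eq {n t a r : ℕ} (hn : 2 * t + 2 ≤ n)
    (hr : r ≤ (n - (2 * t + 2)).choose (t + a)) :
    ∃ 𝓕 ⊆ (Finset.Icc 1 n).powersetCard (2 * t + 1 + a),
      𝓕.card = (n - (t + 1)).choose (t + a) + r ∧
      crossPairs t 𝓕 𝓕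
        = 2 * (r * ((2 * t + 1 + a).choose t * (n - (2 * t + 1 + a + t + 1)).choose a)) := by
  classical
  set T : Finset ℕ := Finset.Icc 1 (t + 1) with hT
  set U : Finset ℕ := Finset.Icc (t + 2) (2 * t + 2) with hU
  have hTc : T.card = t + 1 := by simp [hT]
  have hUc : U.card = t + 1 := by
    rw [hU, Nat.card_Icc]
    omega
  have hTV : T ⊆ Finset.Icc 1 n := Finset.Icc_subset_Icc le_rfl (by omega)
  have hUV : U ⊆ Finset.Icc 1 n := Finset.Icc_subset_Icc (by omega) hn
  have hTU : Disjoint T U := by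
    rw [Finset.disjoint_left]
    intro x hx hx'
    rw [hT, Finset.mem_Icc] at hx
    rw [hU, Finset.mem_Icc] at hx'
    omega
  have hcount := card_filter_inter_eq (V := Finset.Icc 1 n) (A := T) (T := U) (Z := ∅)
    (k := 2 * t + 1 + a) hTV hUV (Finset.empty_subset _)
    (by rw [Finset.disjoint_iff_inter_eq_empty.1 hTU])
    (by rw [Finset.union_empty, hUc]; omega)
  rw [Finset.union_empty, hUc, Finset.card_sdiff_of_subset (Finset.union_subset hTV hUV),
    Finset.card_union_of_disjoint hTU, hTc, hUc, Nat.card_Icc] at hcount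
  have e1 : n + 1 - 1 - (t + 1 + (t + 1)) = n - (2 * t + 2) := by omega
  have e2 : 2 * t + 1 + a - (t + 1) = t + a := by omega
  rw [e1, e2] at hcount
  obtain ⟨ℛ, hℛ, hℛc⟩ := Finset.exists_subset_card_eq (hcount ▸ hr)
  have hℛ' : ∀ A ∈ ℛ, A ∈ (Finset.Icc 1 n).powersetCard (2 * t + 1 + a) ∧ U ⊆ A ∧
      Disjoint A T := by
    intro A hA
    have h1 := Finset.mem_filter.1 (hℛ hA)
    have h2 := Finset.mem_filter.1 h1.1
    exact ⟨h2.1, h2.2, (Finset.disjoint_iff_inter_eq_empty.2 h1.2).symm⟩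
  have hdisj : Disjoint ℛ (starFamily n (2 * t + 1 + a) T) := by
    rw [Finset.disjoint_left]
    intro A hA hA'
    have h1 := (Finset.mem_filter.1 hA').2
    have h2 := (hℛ' A hA).2.2.mono_left h1
    rw [disjoint_self, Finset.bot_eq_empty] at h2
    rw [h2] at hTc
    simp at hTc
  refine ⟨ℛ ∪ starFamily n (2 * t + 1 + a) T, ?_, ?_, ?_⟩
  · exact Finset.union_subset (fun A hA => (hℛ' A hA).1) (Finset.filter_subset _ _)
  · rw [Finset.card_union_of_disjoint hdisj, hℛc, card_starFamily hTV (by omega), hTc, e2, add_comm]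
  · have h1 : crossPairs t ℛ ℛ = 0 :=
      crossPairs_self_eq_zero (U := U) (by omega) fun A hA => (hℛ' A hA).2.1
    have h2 : crossPairs t (starFamily n (2 * t + 1 + a) T) (starFamily n (2 * t + 1 + a) T) = 0 :=
      crossPairs_self_eq_zero (U := T) (by omega) fun A hA => (Finset.mem_filter.1 hA).2
    have h3 : crossPairs t ℛ (starFamily n (2 * t + 1 + a) T)
        = r * ((2 * t + 1 + a).choose t * (n - (2 * t + 1 + a + t + 1)).choose a) := by
      rw [crossPairs_eq_sum, ← hℛc]
      exact Finset.sum_const_nat fun A hA =>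
        card_filter_card_inter_eq_of_disjoint (hℛ' A hA).1 hTV hTc (hℛ' A hA).2.2
    rw [crossPairs_union_self t hdisj, h1, h2, h3]
    omega

/-- Theorem 6: for `k ≥ 2t+3` and `r = o(n^{k-2t-1})`, the exact value
`ρ(C(n-t-1,k-t-1) + r) = r ⋅ C(k,t) ⋅ C(n-k-t-1, k-2t-1)` for large `n`. -/
theorem rho_thm6_exact (k t : ℕ) (ht : 0 < t) (h : 2 * t + 3 ≤ k) :
    ∀ r : ℕ → ℕ, (∀ n, 1 ≤ r n) →
      Filter.Tendsto (fun n => (r n : ℝ) / (n : ℝ) ^ (k - 2 * t - 1))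
        Filter.atTop (nhds 0) →
      ∃ n₀ : ℕ, ∀ n > n₀,
        rhoMin n k t ((n - t - 1).choose (k - t - 1) + r n)
          = r n * k.choose t * (n - k - t - 1).choose (k - 2 * t - 1) := by
  intro r _ hlim
  obtain ⟨a, rfl⟩ : ∃ a, k = 2 * t + 1 + a := ⟨k - (2 * t + 1), by omega⟩
  have ea : 2 * t + 1 + a - 2 * t - 1 = a := by omega
  have em : 2 * t + 1 + a - t - 1 = t + a := by omega
  rw [ea] at hlim ⊢
  rw [em]
  obtain ⟨N, n₁, hlow⟩ := le_crossPairs_self_of_card_eq t a ht (by omega)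
  obtain ⟨B, _, n₂, hB⟩ := exists_pow_le_mul_choose_sub (2 * t + 2) (t + a)
  obtain ⟨n₃, hn₃⟩ := Filter.eventually_atTop.1
    (hlim.eventually_lt_const (u := 1 / (N + 1 : ℝ)) (by positivity))
  refine ⟨n₁ + n₂ + n₃ + B + 2 * t + 2, fun n hn => ?_⟩
  have hn0 : (0 : ℝ) < (n : ℝ) ^ a := by
    have : 0 < n := by omega
    positivity
  have hr : (N + 1) * r n ≤ n ^ a := by
    have h1 := hn₃ n (by omega)
    rw [div_lt_div_iff₀ hn0 (by positivity)] at h1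
    have h2 : ((N : ℝ) + 1) * r n ≤ (n : ℝ) ^ a := by linarith
    exact_mod_cast h2
  have hrC : r n ≤ (n - (2 * t + 2)).choose (t + a) := by
    refine Nat.le_of_mul_le_mul_left (c := n) ?_ (by omega)
    calc n * r n ≤ n * n ^ a := Nat.mul_le_mul_left _ (by nlinarith)
      _ = n ^ (1 + a) := by rw [pow_add, pow_one]
      _ ≤ n ^ (t + a) := Nat.pow_le_pow_right (by omega) (by omega)
      _ ≤ B * (n - (2 * t + 2)).choose (t + a) := hB n (by omega) _ le_rfl
      _ ≤ _ := Nat.mul_le_mul_right _ (by omega)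
  have e1 : n - t - 1 = n - (t + 1) := by omega
  have e2 : n - (2 * t + 1 + a) - t - 1 = n - (2 * t + 1 + a + t + 1) := by omega
  rw [e1, e2, mul_assoc]
  have hne : ∀ 𝓕 : Finset (Finset ℕ), 𝓕 ⊆ (Finset.Icc 1 n).powersetCard (2 * t + 1 + a) →
      2 * rhoPairs t 𝓕 = crossPairs t 𝓕 𝓕 := by
    intro 𝓕 h𝓕
    refine two_mul_rhoPairs fun F hF => ?_
    rw [(Finset.mem_powersetCard.1 (h𝓕 hF)).2]
    omega
  refine le_antisymm ?_ ?_
  · obtain ⟨𝓕, h𝓕, hcard, hcross⟩ := exists_family_crossPairs_eq (by omega) hrC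
    refine Nat.sInf_le ⟨𝓕, h𝓕, hcard, ?_⟩
    have := hne 𝓕 h𝓕
    omega
  · refine le_csInf ?_ ?_
    · obtain ⟨𝓕, h𝓕, hcard, _⟩ := exists_family_crossPairs_eq (by omega) hrC
      exact ⟨_, 𝓕, h𝓕, hcard, rfl⟩
    · rintro m ⟨𝓕, h𝓕, hcard, rfl⟩
      have h1 := hlow n (by omega) (r n) (by nlinarith) 𝓕 h𝓕 hcard
      have h2 := hne 𝓕 h𝓕
      omega
end

section
/- (Füredi's structural theorem) Fix positive integers s and k. There exists a constant c(k,s) > 0 such that for every n and every family F of k-element subsets of [n] there exists a k-partite subfamily F* ⊆ F (with respect to some partition [n] = X₁ ⊔ … ⊔ X_k) such that: (1) |F*| ≥ c(k,s)·|F|; (2) π(F*|_A) = π(F*|_B) for any A, B ∈ F*; (3) for each pair of distinct A, B ∈ F*, the set A ∩ B is the kernel of a sunflower with s petals contained in F*. -/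
/-- `X : Fin k → Finset ℕ` is a partition of `[n] = {1,…,n}` into `k` parts. -/
def IsPartition (n k : ℕ) (X : Fin k → Finset ℕ) : Prop :=
  (∀ i j, i ≠ j → Disjoint (X i) (X j)) ∧ Finset.univ.biUnion X = Finset.Icc 1 n

/-- The projection `π(Y) = {i ∈ [k] : Y ∩ Xᵢ ≠ ∅}`. -/
def piProj {k : ℕ} (X : Fin k → Finset ℕ) (Y : Finset ℕ) : Finset (Fin k) :=
  Finset.univ.filter (fun i => (Y ∩ X i).Nonempty)

/-- The projected trace `π(F|_B) = {π(A ∩ B) : A ∈ F, A ≠ B}`. -/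
def traceProj {k : ℕ} (X : Fin k → Finset ℕ) (F : Finset (Finset ℕ)) (B : Finset ℕ) :
    Finset (Finset (Fin k)) :=
  (F.erase B).image (fun A => piProj X (A ∩ B))

/-- `f` restricts to a bijection from `A` onto the set of all colours. -/
def IsRainbow {k : ℕ} (f : ℕ → Fin k) (A : Finset ℕ) : Prop :=
  Set.InjOn f A ∧ ∀ i, ∃ x ∈ A, f x = i

/-- The part of `A` whose colours lie in `J`. -/
def colorPart {k : ℕ} (f : ℕ → Fin k) (J : Finset (Fin k)) (A : Finset ℕ) : Finset ℕ :=
  A.filter (fun x => f x ∈ J)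

/-- `D` is the kernel of a sunflower with `s` petals contained in `G`. -/
def IsKernel (s : ℕ) (G : Finset (Finset ℕ)) (D : Finset ℕ) : Prop :=
  ∃ S ⊆ G, S.card = s ∧ ∀ P ∈ S, ∀ Q ∈ S, P ≠ Q → P ∩ Q = D

theorem mem_colorPart {k : ℕ} {f : ℕ → Fin k} {J : Finset (Fin k)} {A : Finset ℕ} {x : ℕ} :
    x ∈ colorPart f J A ↔ x ∈ A ∧ f x ∈ J := by
  simp [colorPart]

theorem IsKernel.mono {s : ℕ} {G H : Finset (Finset ℕ)} {D : Finset ℕ}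
    (h : IsKernel s G D) (hGH : G ⊆ H) : IsKernel s H D := by
  obtain ⟨S, hS, h⟩ := h
  exact ⟨S, hS.trans hGH, h⟩

theorem IsKernel.of_le {s t : ℕ} {G : Finset (Finset ℕ)} {D : Finset ℕ}
    (h : IsKernel t G D) (hst : s ≤ t) : IsKernel s G D := by
  obtain ⟨S, hS, hc, h⟩ := h
  obtain ⟨T, hT, hTc⟩ := Finset.exists_subset_card_eq (hc ▸ hst)
  exact ⟨T, hT.trans hS, hTc, fun P hP Q hQ => h P (hT hP) Q (hT hQ)⟩

/-- The kernel of a sunflower with at least two petals is contained in every petal. -/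
theorem kernel_subset_petal {S : Finset (Finset ℕ)} {D : Finset ℕ} (hc : 2 ≤ S.card)
    (h : ∀ P ∈ S, ∀ Q ∈ S, P ≠ Q → P ∩ Q = D) {P : Finset ℕ} (hP : P ∈ S) : D ⊆ P := by
  obtain ⟨Q, hQ, hne⟩ := Finset.exists_mem_ne (Nat.lt_of_succ_le hc) P
  rw [← h P hP Q hQ hne.symm]
  exact Finset.inter_subset_left

theorem colorPart_eq_of_subset {k : ℕ} {f : ℕ → Fin k} {J : Finset (Fin k)} {A B : Finset ℕ}
    (hA : IsRainbow f A) (hB : IsRainbow f B) (h : colorPart f J A ⊆ B) :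
    colorPart f J A = colorPart f J B := by
  ext x
  simp only [mem_colorPart]
  constructor
  · rintro ⟨hx, hJ⟩
    exact ⟨h (mem_colorPart.2 ⟨hx, hJ⟩), hJ⟩
  · rintro ⟨hx, hJ⟩
    obtain ⟨y, hy, hyx⟩ := hA.2 (f x)
    have hyB : y ∈ B := h (mem_colorPart.2 ⟨hy, hyx ▸ hJ⟩)
    obtain rfl := hB.1 hyB hx hyx
    exact ⟨hy, hJ⟩

theorem inter_eq_colorPart {k : ℕ} {f : ℕ → Fin k} {A B : Finset ℕ}
    (hA : IsRainbow f A) : A ∩ B = colorPart f ((A ∩ B).image f) A := by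
  ext x
  simp only [mem_colorPart, Finset.mem_image, Finset.mem_inter]
  constructor
  · rintro ⟨hx, hB⟩
    exact ⟨hx, x, ⟨hx, hB⟩, rfl⟩
  · rintro ⟨hx, y, ⟨hy, hyB⟩, hyx⟩
    obtain rfl := hA.1 hy hx hyx
    exact ⟨hy, hyB⟩

theorem image_colorPart {k : ℕ} {f : ℕ → Fin k} {J : Finset (Fin k)} {A : Finset ℕ}
    (hA : IsRainbow f A) : (colorPart f J A).image f = J := by
  ext i
  simp only [mem_colorPart, Finset.mem_image]
  constructor
  · rintro ⟨x, ⟨-, h⟩, rfl⟩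
    exact h
  · intro hi
    obtain ⟨x, hx, rfl⟩ := hA.2 i
    exact ⟨x, ⟨hx, hi⟩, rfl⟩

theorem IsRainbow.card {k : ℕ} {f : ℕ → Fin k} {A : Finset ℕ} (hA : IsRainbow f A) :
    A.card = k := by
  have h : A.image f = Finset.univ := by
    ext i
    simpa using hA.2 i
  rw [← Finset.card_image_of_injOn hA.1, h, Finset.card_univ, Fintype.card_fin]

/-- A large enough sunflower has a petal that meets `A` in the kernel only. -/
theorem exists_inter_eq_kernel {s : ℕ} {G : Finset (Finset ℕ)} {D A : Finset ℕ}
    (hs : A.card + 2 ≤ s) (h : IsKernel s G D) (hDA : D ⊆ A) :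
    ∃ B ∈ G, B ≠ A ∧ B ∩ A = D := by
  obtain ⟨S, hS, hc, h⟩ := h
  by_contra! hcon
  have hx : ∀ P ∈ S.erase A, ∃ x ∈ A, x ∈ P ∧ x ∉ D := by
    intro P hP
    obtain ⟨hPA, hPS⟩ := Finset.mem_erase.1 hP
    by_contra! hx
    refine hcon P (hS hPS) hPA (Finset.Subset.antisymm ?_ ?_)
    · intro x hx'
      rw [Finset.mem_inter] at hx'
      exact hx x hx'.2 hx'.1
    · exact Finset.subset_inter (kernel_subset_petal (by omega) h hPS) hDA
  choose! g hgA hgP hgD using hx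
  have hle : (S.erase A).card ≤ A.card := by
    refine Finset.card_le_card_of_injOn g hgA ?_
    intro P hP Q hQ hPQ
    by_contra hne
    apply hgD P hP
    rw [← h P (Finset.mem_of_mem_erase hP) Q (Finset.mem_of_mem_erase hQ) hne, Finset.mem_inter]
    exact ⟨hgP P hP, hPQ ▸ hgP Q hQ⟩
  have := Finset.pred_card_le_card_erase (s := S) (a := A)
  omega

/-- A family whose members all properly contain `D`, with no sunflower of kernel `D`, has a
popular element outside `D`. -/
theorem exists_popular_element {s k : ℕ} {G : Finset (Finset ℕ)} {D : Finset ℕ}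
    (hcard : ∀ A ∈ G, A.card = k) (hD : ∀ A ∈ G, D ⊂ A) (h : ¬ IsKernel s G D) :
    ∃ x, x ∉ D ∧ G.card ≤ s * k * (G.filter (fun A => x ∈ A)).card := by
  classical
  obtain ⟨T, hT⟩ := ((G.powerset.filter
    (fun T => ∀ P ∈ T, ∀ Q ∈ T, P ≠ Q → P ∩ Q = D))).exists_maximal ⟨∅, by simp⟩
  have hTm := hT.prop
  simp only [Finset.mem_filter, Finset.mem_powerset] at hTm
  have hTs : T.card ≤ s := by
    by_contra! hlt
    exact h (IsKernel.of_le ⟨T, hTm.1, rfl, hTm.2⟩ hlt.le)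
  set U := T.biUnion id \ D with hU
  have hUc : U.card ≤ s * k := by
    calc U.card ≤ (T.biUnion id).card := Finset.card_le_card Finset.sdiff_subset
      _ ≤ T.card * k := Finset.card_biUnion_le_card_mul _ _ _
          (fun A hA => (hcard A (hTm.1 hA)).le)
      _ ≤ s * k := Nat.mul_le_mul_right _ hTs
  have hmeet : ∀ A ∈ G, ∃ x ∈ U, x ∈ A := by
    intro A hA
    by_contra! hno
    have hAT : A ∉ T := by
      intro hAT
      obtain ⟨x, hx, hxD⟩ := Finset.exists_of_ssubset (hD A hA)
      exact hno x (by simp only [hU, Finset.mem_sdiff, Finset.mem_biUnion]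
                      exact ⟨⟨A, hAT, hx⟩, hxD⟩) hx
    have hAP : ∀ P ∈ T, A ∩ P = D := by
      intro P hP
      refine Finset.Subset.antisymm ?_
        (Finset.subset_inter (hD A hA).1 (hD P (hTm.1 hP)).1)
      intro x hx
      rw [Finset.mem_inter] at hx
      by_contra hxD
      exact hno x (by simp only [hU, Finset.mem_sdiff, Finset.mem_biUnion]
                      exact ⟨⟨P, hP, hx.2⟩, hxD⟩) hx.1
    have hins : insert A T ∈ G.powerset.filter
        (fun T => ∀ P ∈ T, ∀ Q ∈ T, P ≠ Q → P ∩ Q = D) := by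
      simp only [Finset.mem_filter, Finset.mem_powerset]
      refine ⟨Finset.insert_subset hA hTm.1, ?_⟩
      intro P hP Q hQ hne
      rw [Finset.mem_insert] at hP hQ
      rcases hP with rfl | hP <;> rcases hQ with rfl | hQ
      · exact absurd rfl hne
      · exact hAP Q hQ
      · rw [Finset.inter_comm]
        exact hAP P hP
      · exact hTm.2 P hP Q hQ hne
    exact hAT (hT.le_of_ge hins (Finset.subset_insert A T) (Finset.mem_insert_self A T))
  rcases G.eq_empty_or_nonempty with rfl | ⟨A₀, hA₀⟩
  · obtain ⟨x, hx⟩ := D.exists_notMem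
    exact ⟨x, hx, by simp⟩
  obtain ⟨x₀, hx₀, -⟩ := hmeet A₀ hA₀
  obtain ⟨x, hxU, hx⟩ := U.exists_max_image (fun x => (G.filter (fun A => x ∈ A)).card) ⟨x₀, hx₀⟩
  refine ⟨x, (Finset.mem_sdiff.1 hxU).2, ?_⟩
  calc G.card ≤ (U.biUnion (fun x => G.filter (fun A => x ∈ A))).card := by
        apply Finset.card_le_card
        intro A hA
        obtain ⟨y, hy, hyA⟩ := hmeet A hA
        simp only [Finset.mem_biUnion, Finset.mem_filter]
        exact ⟨y, hy, hA, hyA⟩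
    _ ≤ U.card * (G.filter (fun A => x ∈ A)).card := Finset.card_biUnion_le_card_mul _ _ _ hx
    _ ≤ _ := Nat.mul_le_mul_right _ hUc

/-- If no `J`-part of a member is the kernel of a sunflower, then a positive proportion of the
family avoids the intersection pattern `J`. -/
theorem exists_subfamily_avoiding {s k : ℕ} {f : ℕ → Fin k} {J : Finset (Fin k)}
    (hJ : J ≠ Finset.univ) {E : Finset (Finset ℕ)} (hE : ∀ A ∈ E, IsRainbow f A)
    (h : ∀ A ∈ E, ¬ IsKernel s E (colorPart f J A)) :
    ∃ E' ⊆ E, E.card ≤ s * k * E'.card ∧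
      ∀ A ∈ E', ∀ B ∈ E', A ≠ B → (A ∩ B).image f ≠ J := by
  classical
  obtain ⟨j, hj⟩ : ∃ j, j ∉ J := by
    by_contra! hall
    exact hJ (Finset.eq_univ_iff_forall.2 hall)
  have key : ∀ D ∈ E.image (colorPart f J), ∃ x, x ∉ D ∧
      (E.filter (fun A => colorPart f J A = D)).card ≤
        s * k * ((E.filter (fun A => colorPart f J A = D)).filter (fun A => x ∈ A)).card := by
    intro D hD
    obtain ⟨A₀, hA₀, rfl⟩ := Finset.mem_image.1 hD
    refine exists_popular_element (fun A hA => (hE A (Finset.mem_filter.1 hA).1).card) ?_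
      (fun hk => h A₀ hA₀ (hk.mono (Finset.filter_subset _ _)))
    intro A hA
    obtain ⟨hAE, hAD⟩ := Finset.mem_filter.1 hA
    rw [← hAD]
    obtain ⟨x, hx, hxj⟩ := (hE A hAE).2 j
    refine (Finset.ssubset_iff_of_subset (Finset.filter_subset _ _)).2 ⟨x, hx, fun hx' => ?_⟩
    exact hj (hxj ▸ (mem_colorPart.1 hx').2)
  choose! x hxD hx using key
  refine ⟨E.filter (fun A => x (colorPart f J A) ∈ A), Finset.filter_subset _ _, ?_, ?_⟩
  · rw [Finset.card_eq_sum_card_image (colorPart f J) E,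
      Finset.card_eq_sum_card_fiberwise (f := colorPart f J) (t := E.image (colorPart f J))
        (fun A hA => Finset.mem_image_of_mem _ (Finset.mem_filter.1 hA).1), Finset.mul_sum]
    refine Finset.sum_le_sum fun D hD => (hx D hD).trans (Nat.mul_le_mul_left _ ?_)
    apply Finset.card_le_card
    intro A hA
    simp only [Finset.mem_filter] at hA ⊢
    obtain ⟨⟨hAE, rfl⟩, hxA⟩ := hA
    exact ⟨⟨hAE, hxA⟩, rfl⟩
  · intro A hA B hB _ hAB
    obtain ⟨hAE, hxA⟩ := Finset.mem_filter.1 hA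
    obtain ⟨hBE, hxB⟩ := Finset.mem_filter.1 hB
    have hpart : colorPart f J A = colorPart f J B := by
      apply colorPart_eq_of_subset (hE A hAE) (hE B hBE)
      rw [← hAB, ← inter_eq_colorPart (hE A hAE)]
      exact Finset.inter_subset_right
    rw [← hpart] at hxB
    apply hxD _ (Finset.mem_image_of_mem (colorPart f J) hAE)
    rw [mem_colorPart]
    refine ⟨hxA, ?_⟩
    have := Finset.mem_image_of_mem f (Finset.mem_inter.2 ⟨hxA, hxB⟩)
    rwa [hAB] at this

/-- Every rainbow family splits into a part in which all patterns from `𝒥` are kernels, and for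
each `J ∈ 𝒥` a part in which no `J`-part of a member is a kernel. -/
theorem exists_kernel_decomposition {s k : ℕ} (hs : 2 ≤ s) {f : ℕ → Fin k}
    (𝒥 : Finset (Finset (Fin k))) (G : Finset (Finset ℕ)) (hG : ∀ A ∈ G, IsRainbow f A) :
    ∃ K ⊆ G, ∃ E : Finset (Fin k) → Finset (Finset ℕ),
      (∀ J, E J ⊆ G) ∧ G ⊆ K ∪ 𝒥.biUnion E ∧
      (∀ A ∈ K, ∀ J ∈ 𝒥, IsKernel s K (colorPart f J A)) ∧
      ∀ J, ∀ A ∈ E J, ¬ IsKernel s (E J) (colorPart f J A) := by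
  classical
  induction G using Finset.strongInduction with
  | H G ih =>
  by_cases hgood : ∀ A ∈ G, ∀ J ∈ 𝒥, IsKernel s G (colorPart f J A)
  · exact ⟨G, subset_rfl, fun _ => ∅, by simp, by simp, hgood, by simp⟩
  push Not at hgood
  obtain ⟨A, hA, J, hJ, hAJ⟩ := hgood
  obtain ⟨K, hK, E, hEG, hcov, hKk, hEk⟩ := ih (G.erase A) (Finset.erase_ssubset hA)
    (fun B hB => hG B (Finset.mem_of_mem_erase hB))
  have hEG' : ∀ I, E I ⊆ G := fun I => (hEG I).trans (Finset.erase_subset _ _)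
  have hins : insert A (E J) ⊆ G := Finset.insert_subset hA (hEG' J)
  refine ⟨K, hK.trans (Finset.erase_subset _ _), Function.update E J (insert A (E J)),
    ?_, ?_, hKk, ?_⟩
  · intro I
    by_cases hI : I = J
    · subst hI
      simpa using hins
    · simpa [hI] using hEG' I
  · intro B hB
    rw [Finset.mem_union, Finset.mem_biUnion]
    by_cases hBA : B = A
    · exact Or.inr ⟨J, hJ, by simp [hBA]⟩
    · have := hcov (Finset.mem_erase.2 ⟨hBA, hB⟩)
      rw [Finset.mem_union, Finset.mem_biUnion] at this
      refine this.imp_right ?_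
      rintro ⟨I, hI, hBI⟩
      refine ⟨I, hI, ?_⟩
      by_cases hIJ : I = J
      · subst hIJ
        simp [hBI]
      · simpa [hIJ] using hBI
  · intro I B hB hker
    by_cases hIJ : I = J
    · subst hIJ
      simp only [Function.update_self] at hB hker
      obtain ⟨S, hS, hc, hpet⟩ := id hker
      by_cases hAS : A ∈ S
      · have := colorPart_eq_of_subset (hG B (hins hB)) (hG A hA)
          (kernel_subset_petal (hc ▸ hs) hpet hAS)
        exact hAJ (this ▸ hker.mono hins)
      · rcases Finset.mem_insert.1 hB with rfl | hBE
        · exact hAJ (hker.mono hins)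
        · exact hEk I B hBE ⟨S, (Finset.subset_insert_iff_of_notMem hAS).1 hS, hc, hpet⟩
    · simp only [Function.update_of_ne hIJ] at hB hker
      exact hEk I B hB hker

/-- A rainbow family avoiding all intersection patterns outside `𝒥` has a proportionally large
subfamily in which the intersection patterns are kernels at every member. -/
theorem exists_homogeneous_subfamily {s k : ℕ} (hs : 2 ≤ s) (hk : 0 < k) {f : ℕ → Fin k} (m : ℕ) :
    ∀ 𝒥 : Finset (Finset (Fin k)), 𝒥.card = m → Finset.univ ∉ 𝒥 →
    ∀ G : Finset (Finset ℕ), (∀ A ∈ G, IsRainbow f A) →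
      (∀ A ∈ G, ∀ B ∈ G, A ≠ B → (A ∩ B).image f ∈ 𝒥) →
      ∃ K ⊆ G, ∃ 𝒥' : Finset (Finset (Fin k)),
        G.card ≤ ((m + 1).factorial * (s * k) ^ m) * K.card ∧
        (∀ A ∈ K, ∀ B ∈ K, A ≠ B → (A ∩ B).image f ∈ 𝒥') ∧
        ∀ A ∈ K, ∀ J ∈ 𝒥', IsKernel s K (colorPart f J A) := by
  classical
  induction m with
  | zero =>
    intro 𝒥 hm _ G _ hint
    obtain rfl := Finset.card_eq_zero.1 hm
    exact ⟨G, subset_rfl, ∅, by simp, hint, by simp⟩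
  | succ m ih =>
    intro 𝒥 hm huniv G hG hint
    obtain ⟨K, hK, E, hEG, hcov, hKk, hEk⟩ := exists_kernel_decomposition hs 𝒥 G hG
    have hpos : 1 ≤ s * k := Nat.mul_pos (by omega) hk
    by_cases hbig : G.card ≤ (m + 2) * K.card
    · refine ⟨K, hK, 𝒥, hbig.trans (Nat.mul_le_mul_right _ ?_),
        fun A hA B hB => hint A (hK hA) B (hK hB), hKk⟩
      calc m + 2 ≤ (m + 1 + 1).factorial := Nat.self_le_factorial _
        _ ≤ _ := Nat.le_mul_of_pos_right _ (Nat.pow_pos hpos)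
    obtain ⟨J, hJ, hJbig⟩ : ∃ J ∈ 𝒥, G.card ≤ (m + 2) * (E J).card := by
      by_contra! hsmall
      have h1 : G.card ≤ K.card + ∑ J ∈ 𝒥, (E J).card :=
        (Finset.card_le_card hcov).trans ((Finset.card_union_le _ _).trans
          (Nat.add_le_add_left Finset.card_biUnion_le _))
      have h2 : ∑ J ∈ 𝒥, (m + 2) * (E J).card ≤ (m + 1) * G.card := by
        rw [← hm, ← smul_eq_mul]
        exact Finset.sum_le_card_nsmul _ _ _ (fun J hJ => (hsmall J hJ).le)
      rw [← Finset.mul_sum] at h2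
      nlinarith
    obtain ⟨E', hE', hE'c, hE'J⟩ := exists_subfamily_avoiding
      (fun h => huniv (h ▸ hJ)) (fun A hA => hG A (hEG J hA)) (hEk J)
    have hE'G := hE'.trans (hEG J)
    obtain ⟨K', hK', 𝒥', hcard, hint', hker'⟩ := ih (𝒥.erase J)
      (by rw [Finset.card_erase_of_mem hJ, hm]; rfl)
      (fun h => huniv (Finset.mem_of_mem_erase h)) E' (fun A hA => hG A (hE'G hA))
      (fun A hA B hB hne => Finset.mem_erase.2
        ⟨hE'J A hA B hB hne, hint A (hE'G hA) B (hE'G hB) hne⟩)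
    refine ⟨K', hK'.trans hE'G, 𝒥', ?_, hint', hker'⟩
    calc G.card ≤ (m + 2) * (E J).card := hJbig
      _ ≤ (m + 2) * (s * k * (((m + 1).factorial * (s * k) ^ m) * K'.card)) := by
        gcongr
        exact hE'c.trans (by gcongr)
      _ = _ := by
        rw [Nat.factorial_succ (m + 1)]
        ring

/-- Some colouring makes a proportion `k⁻ᵏ` of the members of a `k`-uniform family rainbow. -/
theorem exists_coloring_many_rainbow {k : ℕ} (hk : 0 < k) (n : ℕ) (F : Finset (Finset ℕ))
    (hF : ∀ A ∈ F, A ⊆ Finset.Icc 1 n ∧ A.card = k) :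
    ∃ f : ℕ → Fin k, ∃ G ⊆ F, (∀ A ∈ G, IsRainbow f A) ∧ F.card ≤ k ^ k * G.card := by
  classical
  let ext : (Finset.Icc 1 n → Fin k) → ℕ → Fin k :=
    fun g x => if h : x ∈ Finset.Icc 1 n then g ⟨x, h⟩ else ⟨0, hk⟩
  have hcount : ∀ A ∈ F, Fintype.card (Finset.Icc 1 n → Fin k) ≤
      k ^ k * (Finset.univ.filter (fun g => IsRainbow (ext g) A)).card := by
    intro A hA
    obtain ⟨hAn, hAk⟩ := hF A hA
    let e : A ≃ Fin k := A.equivFinOfCardEq hAk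
    let ov : (Finset.Icc 1 n → Fin k) → (Finset.Icc 1 n → Fin k) :=
      fun g x => if h : x.1 ∈ A then e ⟨x.1, h⟩ else g x
    have hov : ∀ g, ∀ x (hx : x ∈ A), ext (ov g) x = e ⟨x, hx⟩ := by
      intro g x hx
      have hx' := hAn hx
      simp only [ext, ov, dif_pos hx', dif_pos hx]
    have hrain : ∀ g, IsRainbow (ext (ov g)) A := by
      intro g
      constructor
      · intro x hx y hy hxy
        rw [hov g x hx, hov g y hy] at hxy
        simpa using e.injective hxy
      · intro i
        refine ⟨(e.symm i).1, (e.symm i).2, ?_⟩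
        rw [hov g _ (e.symm i).2]
        simp
    have hinj : Function.Injective (fun g : Finset.Icc 1 n → Fin k =>
        ((fun i => g ⟨(e.symm i).1, hAn (e.symm i).2⟩ : Fin k → Fin k),
          (⟨ov g, hrain g⟩ : {g // IsRainbow (ext g) A}))) := by
      intro g g' hgg
      simp only [Prod.mk.injEq, Subtype.mk.injEq] at hgg
      ext1 x
      by_cases hx : x.1 ∈ A
      · simpa using congrFun hgg.1 (e ⟨x.1, hx⟩)
      · simpa [ov, hx] using congrFun hgg.2 x
    have := Fintype.card_le_of_injective _ hinj
    rwa [Fintype.card_prod, Fintype.card_subtype, Fintype.card_fun (α := Fin k),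
      Fintype.card_fin] at this
  by_contra! hcon
  have hne : (Finset.univ : Finset (Finset.Icc 1 n → Fin k)).Nonempty :=
    ⟨fun _ => ⟨0, hk⟩, Finset.mem_univ _⟩
  have hlt : ∑ g : Finset.Icc 1 n → Fin k,
      k ^ k * (F.filter (fun A => IsRainbow (ext g) A)).card <
        ∑ _g : Finset.Icc 1 n → Fin k, F.card :=
    Finset.sum_lt_sum_of_nonempty hne fun g _ =>
      hcon (ext g) _ (Finset.filter_subset _ _) (fun A hA => (Finset.mem_filter.1 hA).2)
  have hge : ∑ _A ∈ F, Fintype.card (Finset.Icc 1 n → Fin k) ≤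
      ∑ A ∈ F, k ^ k * (Finset.univ.filter (fun g => IsRainbow (ext g) A)).card :=
    Finset.sum_le_sum hcount
  have hdc : ∑ g : Finset.Icc 1 n → Fin k, (F.filter (fun A => IsRainbow (ext g) A)).card =
      ∑ A ∈ F, (Finset.univ.filter (fun g => IsRainbow (ext g) A)).card :=
    Finset.sum_card_bipartiteAbove_eq_sum_card_bipartiteBelow (fun g A => IsRainbow (ext g) A)
  rw [← Finset.mul_sum, hdc] at hlt
  rw [← Finset.mul_sum] at hge
  simp only [Finset.sum_const, smul_eq_mul, Finset.card_univ] at hlt hge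
  rw [mul_comm] at hge
  omega

/-- Füredi's structural theorem. -/
theorem furedi_structure (s k : ℕ) (hs : 0 < s) (hk : 0 < k) :
    ∃ c : ℝ, 0 < c ∧ ∀ n : ℕ, ∀ F : Finset (Finset ℕ),
      (∀ A ∈ F, A ⊆ Finset.Icc 1 n ∧ A.card = k) →
      ∃ Fs ⊆ F, ∃ X : Fin k → Finset ℕ, IsPartition n k X ∧
        (∀ A ∈ Fs, ∀ i, (A ∩ X i).card = 1) ∧
        c * (F.card : ℝ) ≤ (Fs.card : ℝ) ∧
        (∀ A ∈ Fs, ∀ B ∈ Fs, traceProj X Fs A = traceProj X Fs B) ∧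
        (∀ A ∈ Fs, ∀ B ∈ Fs, A ≠ B →
          ∃ S ⊆ Fs, S.card = s ∧
            ∀ P ∈ S, ∀ Q ∈ S, P ≠ Q → P ∩ Q = A ∩ B) := by
  classical
  set t := s + k + 2 with ht
  set 𝒥 : Finset (Finset (Fin k)) := Finset.univ.erase Finset.univ with h𝒥
  set M : ℕ := k ^ k * ((𝒥.card + 1).factorial * (t * k) ^ 𝒥.card) with hM
  have hMpos : 0 < M := by positivity
  refine ⟨(M : ℝ)⁻¹, by positivity, fun n F hF => ?_⟩
  obtain ⟨f, G, hGF, hG, hGcard⟩ := exists_coloring_many_rainbow hk n F hF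
  have hint : ∀ A ∈ G, ∀ B ∈ G, A ≠ B → (A ∩ B).image f ∈ 𝒥 := by
    intro A hA B hB hne
    refine Finset.mem_erase.2 ⟨fun h => hne ?_, Finset.mem_univ _⟩
    have h1 := inter_eq_colorPart (B := B) (hG A hA)
    have h2 := inter_eq_colorPart (B := A) (hG B hB)
    rw [Finset.inter_comm, h] at h2
    rw [h] at h1
    simp only [colorPart, Finset.mem_univ, Finset.filter_true] at h1 h2
    exact h1.symm.trans h2
  obtain ⟨K, hKG, 𝒥', hKcard, hKint, hKker⟩ := exists_homogeneous_subfamily (s := t) (by omega) hk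
    𝒥.card 𝒥 rfl (Finset.notMem_erase _ _) G hG hint
  have hKF := hKG.trans hGF
  have hpi : ∀ Y ⊆ Finset.Icc 1 n,
      piProj (fun i => (Finset.Icc 1 n).filter (fun x => f x = i)) Y = Y.image f := by
    intro Y hY
    ext i
    simp only [piProj, Finset.mem_filter, Finset.mem_univ, true_and, Finset.Nonempty,
      Finset.mem_inter, Finset.mem_image]
    exact ⟨fun ⟨x, hx, _, h⟩ => ⟨x, hx, h⟩, fun ⟨x, hx, h⟩ => ⟨x, hx, hY hx, h⟩⟩
  have htrace : ∀ A ∈ K,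
      traceProj (fun i => (Finset.Icc 1 n).filter (fun x => f x = i)) K A = 𝒥' := by
    intro A hA
    have hAn := (hF A (hKF hA)).1
    ext J
    simp only [traceProj, Finset.mem_image, Finset.mem_erase]
    constructor
    · rintro ⟨B, ⟨hne, hB⟩, rfl⟩
      rw [hpi _ (Finset.inter_subset_right.trans hAn)]
      exact hKint B hB A hA hne
    · intro hJ
      obtain ⟨B, hB, hne, hBA⟩ := exists_inter_eq_kernel (A := A)
        (by rw [(hF A (hKF hA)).2]; omega) (hKker A hA J hJ) (Finset.filter_subset _ _)
      refine ⟨B, ⟨hne, hB⟩, ?_⟩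
      rw [hpi _ (Finset.inter_subset_right.trans hAn), hBA, image_colorPart (hG A (hKG hA))]
  refine ⟨K, hKF, fun i => (Finset.Icc 1 n).filter (fun x => f x = i), ⟨?_, ?_⟩, ?_, ?_, ?_, ?_⟩
  · intro i j hij
    rw [Finset.disjoint_left]
    intro x hx hx'
    exact hij ((Finset.mem_filter.1 hx).2.symm.trans (Finset.mem_filter.1 hx').2)
  · ext x
    simp
  · intro A hA i
    obtain ⟨x, hx, hxi⟩ := (hG A (hKG hA)).2 i
    rw [Finset.card_eq_one]
    refine ⟨x, ?_⟩
    ext y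
    simp only [Finset.mem_inter, Finset.mem_filter, Finset.mem_singleton]
    constructor
    · rintro ⟨hy, -, hyi⟩
      exact (hG A (hKG hA)).1 hy hx (hyi.trans hxi.symm)
    · rintro rfl
      exact ⟨hx, (hF A (hKF hA)).1 hx, hxi⟩
  · have hle : F.card ≤ M * K.card := by
      rw [hM, mul_assoc]
      exact hGcard.trans (Nat.mul_le_mul_left _ hKcard)
    rw [inv_mul_le_iff₀ (by positivity)]
    exact_mod_cast hle
  · intro A hA B hB
    rw [htrace A hA, htrace B hB]
  · intro A hA B hB hne
    have := hKker A hA _ (hKint A hA B hB hne)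
    rw [← inter_eq_colorPart (hG A (hKG hA))] at this
    exact this.of_le (by omega)
end
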